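/- Let μ_θ, θ ∈ Θ ⊆ ℝ^k, be the exponential family determined by (μ, t) under assumptions (A) and (B), and let ρ be an exchangeable probability measure on S^∞ whose directing measure satisfies p̃ = μ_θ̃ with ρ-probability 1, for a Θ-valued random element θ̃. Suppose that, with ρ-probability 1: μ_θ̃ has finite second moment; the Talagrand inequality d^{(2)}(μ_θ̃, μ_{θ̂_n})² ≤ C_T(θ̃)·K(μ_{θ̂_n} | μ_θ̃) holds; and the integrability condition (the paper's condition (eq:CostExp), with θ̃ in place of θ_0) holds. Let C_2(μ_θ) denote the constant of the exponential-family moment theorem, and assume C_2(μ_θ̃) is a real random variable with ρ[C_2(μ_θ̃)] < +∞. Then, with b_n := (n/Log₂(n))^{1/2}, p̂_n := μ_{θ̂_n}, θ̂_n := (1/n)Σ_{i=1}^n t(ξ_i), and Y_2(p̃) := √(2·C_T(θ̃))·Φ(θ̃)·σ_max(θ̃): (i) ρ( limsup_{n→∞} b_n · d^{(2)}_{[[S]_2]}( π(ξ^(n)), δ_{p̂_n} ) ≤ Y_2(p̃) ) = 1; and (ii) for every m ∈ ℕ, ρ( limsup_{n→∞} b_n · d^{(2)}_{[[S]_2]}(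 q_m(ξ^(n)), p̂_n^∞ ∘ ẽ_{n,m}^{−1} ) ≤ Y_2(p̃) ) = 1. -/

import Mathlib

open MeasureTheory ProbabilityTheory
open scoped ENNReal

noncomputable section

/-- `Log₂(x) = 1` for `x < e^e` and `Log₂(x) = log log x` for `x ≥ e^e`. -/
noncomputable def Log2 (x : ℝ) : ℝ :=
  if x < Real.exp (Real.exp 1) then 1 else Real.log (Real.log x)

/-- The `p`-Wasserstein-type distance associated with a cost function `c`. -/
noncomputable def wassW {X : Type*} [MeasurableSpace X] (c : X → X → ℝ) (p : ℝ)
    (μ ν : Measure X) : ℝ :=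
  sInf {r : ℝ | ∃ γ : Measure (X × X), γ.map Prod.fst = μ ∧ γ.map Prod.snd = ν ∧
    r = (∫ z, c z.1 z.2 ^ p ∂γ) ^ (1 / p)}

/-- The Kullback–Leibler information `K(ν | ρ) = ∫ log (dν/dρ) dν`. -/
noncomputable def klDiv' {S : Type*} [MeasurableSpace S] (ν ρ : Measure S) : ℝ :=
  ∫ x, Real.log (ν.rnDeriv ρ x).toReal ∂ν

/-- The Frobenius norm of a real square matrix. -/
noncomputable def frobNorm {k : ℕ} (A : Matrix (Fin k) (Fin k) ℝ) : ℝ :=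
  Real.sqrt (∑ i, ∑ j, A i j ^ 2)

/-- The largest eigenvalue of a matrix (as a supremum over eigenvector equations). -/
noncomputable def maxEig {k : ℕ} (V : Matrix (Fin k) (Fin k) ℝ) : ℝ :=
  sSup {r : ℝ | ∃ v : Fin k → ℝ, v ≠ 0 ∧ V.mulVec v = r • v}

/-- `Φ(η) = ( ∫₀¹ (1-s) ‖Hess I_μ(θ₀ + s(η-θ₀))‖_F ds )^{1/2}`. -/
noncomputable def PhiFn {k : ℕ} (HessI : (Fin k → ℝ) → Matrix (Fin k) (Fin k) ℝ)
    (θ₀ η : Fin k → ℝ) : ℝ :=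
  Real.sqrt (∫ s in (0 : ℝ)..1, (1 - s) * frobNorm (HessI (θ₀ + s • (η - θ₀))))

/-- The Euclidean distance on `ℝ^k`. -/
noncomputable def eucDist {k : ℕ} (x y : Fin k → ℝ) : ℝ :=
  Real.sqrt (∑ i, (x i - y i) ^ 2)

/-- The Euclidean norm on `ℝ^k`. -/
noncomputable def eucNorm {k : ℕ} (x : Fin k → ℝ) : ℝ :=
  Real.sqrt (∑ i, x i ^ 2)

/-- `N_{Φ₂}(R₁, R₂)`: the minimum number of closed convex sets contained in `R₂`
that cover `R₁` (equal to `⊤` if no finite such covering exists). -/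
noncomputable def minConvexCover {k : ℕ} (R₁ R₂ : Set (Fin k → ℝ)) : ℕ∞ :=
  sInf {N : ℕ∞ | ∃ n : ℕ, N = n ∧ ∃ C : Fin n → Set (Fin k → ℝ),
    (∀ i, IsClosed (C i) ∧ Convex ℝ (C i) ∧ C i ⊆ R₂) ∧ R₁ ⊆ ⋃ i, C i}

/-- The generalized inverse `Φ₁⁻¹(s) := inf {x ≥ 0 : Φ₁(x) ≥ s}`. -/
noncomputable def geninv (Φ₁ : ℝ → ℝ) (s : ℝ) : ℝ :=
  sInf {x : ℝ | 0 ≤ x ∧ s ≤ Φ₁ x}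

/-- The empirical measure `ẽ_{n,m}(ω) = (1/m) Σ_{i=1}^m δ_{ω_{i+n}}`. -/
noncomputable def empShift {S : Type*} [MeasurableSpace S] (n m : ℕ) (ω : ℕ → S) :
    Measure S :=
  (m : ℝ≥0∞)⁻¹ • ∑ i ∈ Finset.range m, Measure.dirac (ω (i + n))

/-- The paper's condition (eq:CostExp) for the base point `θ₀` of the
exponential family, with `Φ, Φ₁, Φ₂, τ, ρ, σ` quantified existentially. -/
def CostExpCond {k : ℕ} (Θ : Set (Fin k → ℝ))
    (HessI : (Fin k → ℝ) → Matrix (Fin k) (Fin k) ℝ)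
    (Iθ₀ : (Fin k → ℝ) → ℝ) (θ₀ : Fin k → ℝ) : Prop :=
  ∃ Φ₁ : ℝ → ℝ, Monotone Φ₁ ∧ Filter.Tendsto Φ₁ Filter.atTop Filter.atTop ∧
    (∀ x, 0 ≤ Φ₁ x) ∧
  ∃ Φ₂ : (Fin k → ℝ) → ℝ, (∀ η ∈ Θ, 0 ≤ Φ₂ η) ∧
    (∀ η ∈ Θ, PhiFn HessI θ₀ η ≤ Φ₁ (eucNorm η) + Φ₂ η) ∧
    (∀ ηs : ℕ → (Fin k → ℝ), (∀ n, ηs n ∈ Θ) →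
      Filter.Tendsto (fun n => Φ₂ (ηs n)) Filter.atTop Filter.atTop →
      Filter.Tendsto (fun n => sInf ((fun b => eucDist (ηs n) b) '' frontier Θ))
        Filter.atTop (nhds 0)) ∧
  ∃ τ : ℝ, 0 < τ ∧ ∃ ρf σf : ℝ → ℝ, (∀ s, τ ≤ s → 0 ≤ ρf s ∧ 0 ≤ σf s) ∧
    (∫⁻ s in Set.Ioi τ, ENNReal.ofReal
        (Real.exp (-(min (min (ρf s) (s / σf s)) (geninv Φ₁ (σf s / 2))))
          / (min (min (ρf s) (s / σf s)) (geninv Φ₁ (σf s / 2))) ^ 2)) < ⊤ ∧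
    (∫⁻ s in Set.Ioi τ,
        (minConvexCover {θ | θ ∈ Θ ∧ σf s / 2 ≤ Φ₂ θ ∧ eucDist θ θ₀ ≤ ρf s}
            {θ | θ ∈ Θ ∧ σf s / 4 ≤ Φ₂ θ ∧ eucDist θ θ₀ ≤ ρf s} : ℕ∞)
          * ENNReal.ofReal
            (Real.exp (-(sInf (Iθ₀ ''
                {θ | θ ∈ Θ ∧ σf s / 4 ≤ Φ₂ θ ∧ eucDist θ θ₀ ≤ ρf s})))
              / (sInf (Iθ₀ ''
                {θ | θ ∈ Θ ∧ σf s / 4 ≤ Φ₂ θ ∧ eucDist θ θ₀ ≤ ρf s})) ^ 2)) < ⊤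

section
lemma aux_lintegral_disint {Ω A P : Type*} [MeasurableSpace Ω] [MeasurableSpace A]
    [MeasurableSpace P] (ρ : Measure Ω) [IsProbabilityMeasure ρ]
    (ξ : Ω → A) (hξ : Measurable ξ) (pt : Ω → P) (hpt : Measurable pt)
    (κ : A → Measure P) (hκp : ∀ a, IsProbabilityMeasure (κ a)) (hκ : Measurable κ)
    (h : ∀ A' : Set A, MeasurableSet A' → ∀ B : Set P, MeasurableSet B →
      ρ (ξ ⁻¹' A' ∩ pt ⁻¹' B) = ∫⁻ ω in ξ ⁻¹' A', κ (ξ ω) B ∂ρ)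
    (F : A × P → ℝ≥0∞) (hF : Measurable F) :
    ∫⁻ ω, F (ξ ω, pt ω) ∂ρ = ∫⁻ ω, ∫⁻ p, F (ξ ω, p) ∂(κ (ξ ω)) ∂ρ := by
  let K : Kernel A P := ⟨κ, hκ⟩
  haveI : IsMarkovKernel K := ⟨hκp⟩
  haveI : IsProbabilityMeasure (ρ.map ξ) := Measure.isProbabilityMeasure_map hξ.aemeasurable
  have key : ρ.map (fun ω => (ξ ω, pt ω)) = (ρ.map ξ) ⊗ₘ K := by
    haveI : IsFiniteMeasure (ρ.map (fun ω => (ξ ω, pt ω))) := by infer_instance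
    apply Measure.ext_prod
    intro s t hs ht
    rw [Measure.map_apply (hξ.prodMk hpt) (hs.prod ht), Measure.compProd_apply_prod hs ht,
      setLIntegral_map hs (K.measurable_coe ht) hξ]
    exact h s hs t ht
  calc ∫⁻ ω, F (ξ ω, pt ω) ∂ρ = ∫⁻ z, F z ∂(ρ.map (fun ω => (ξ ω, pt ω))) :=
        (lintegral_map hF (hξ.prodMk hpt)).symm
    _ = ∫⁻ a, ∫⁻ p, F (a, p) ∂(K a) ∂(ρ.map ξ) := by
        rw [key, Measure.lintegral_compProd hF]
    _ = _ := by
        rw [lintegral_map (hF.lintegral_kernel_prod_right') hξ]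
        rfl

/-- filtration generated by the first `n` coordinates -/
def coordFilt (S : Type*) [MeasurableSpace S] : Filtration ℕ (MeasurableSpace.pi : MeasurableSpace (ℕ → S)) where
  seq n := MeasurableSpace.comap (fun (ω : ℕ → S) (i : Fin n) => ω i) MeasurableSpace.pi
  mono' := by
    intro a b hab
    have : (fun (ω : ℕ → S) (i : Fin a) => ω i) =
        (fun (v : Fin b → S) (i : Fin a) => v (Fin.castLE hab i)) ∘
          (fun (ω : ℕ → S) (i : Fin b) => ω i) := by
      funext ω i; rfl
    show MeasurableSpace.comap _ _ ≤ MeasurableSpace.comap _ _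
    rw [this, ← MeasurableSpace.comap_comp]
    apply MeasurableSpace.comap_mono
    exact (measurable_pi_lambda _ fun i => measurable_pi_apply _).comap_le
  le' := fun n => (measurable_pi_lambda _ fun i => measurable_pi_apply _).comap_le

lemma coordFilt_iSup (S : Type*) [MeasurableSpace S] :
    (⨆ n, coordFilt S n) = (MeasurableSpace.pi : MeasurableSpace (ℕ → S)) := by
  apply le_antisymm
  · exact iSup_le fun n => (coordFilt S).le n
  · refine iSup_le fun i => ?_
    refine le_trans ?_ (le_iSup _ (i+1))
    have : (fun (ω : ℕ → S) => ω i) =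
        (fun (v : Fin (i+1) → S) => v ⟨i, by omega⟩) ∘
          (fun (ω : ℕ → S) (j : Fin (i+1)) => ω j) := by
      funext ω; rfl
    show MeasurableSpace.comap (fun (ω : ℕ → S) => ω i) _ ≤ MeasurableSpace.comap _ _
    rw [this, ← MeasurableSpace.comap_comp]
    apply MeasurableSpace.comap_mono
    exact (measurable_pi_apply _).comap_le

lemma aux_merging_core {S P : Type*} [MeasurableSpace S] [MeasurableSpace P]
    (ρ : Measure (ℕ → S)) [IsProbabilityMeasure ρ]
    (pt : (ℕ → S) → P) (hpt : Measurable pt)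
    (post : (n : ℕ) → (Fin n → S) → Measure P)
    (hpost_prob : ∀ n v, IsProbabilityMeasure (post n v))
    (hpost_meas : ∀ n, Measurable (post n))
    (hpost : ∀ (n : ℕ) (A : Set (Fin n → S)), MeasurableSet A →
      ∀ B : Set P, MeasurableSet B →
        ρ {ω | (fun i : Fin n => ω (i : ℕ)) ∈ A ∧ pt ω ∈ B}
          = ∫⁻ ω in {ω | (fun i : Fin n => ω (i : ℕ)) ∈ A},
              post n (fun i : Fin n => ω (i : ℕ)) B ∂ρ)
    (X : (n : ℕ) → (Fin n → S) × P → ℝ≥0∞) (hX : ∀ n, Measurable (X n))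
    (hintg : ∫⁻ ω, ⨆ n, X n (fun i : Fin n => ω i, pt ω) ∂ρ ≠ ∞) :
    ∀ᵐ ω ∂ρ, Filter.limsup (fun n => ∫⁻ p, X n (fun i : Fin n => ω i, p)
        ∂(post n (fun i : Fin n => ω i))) Filter.atTop
      ≤ Filter.limsup (fun n => X n (fun i : Fin n => ω i, pt ω)) Filter.atTop := by
  have hξ : ∀ n, Measurable (fun (ω : ℕ → S) (i : Fin n) => ω i) :=
    fun n => measurable_pi_lambda _ fun i => measurable_pi_apply _
  have hdis : ∀ n (F : (Fin n → S) × P → ℝ≥0∞), Measurable F →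
      ∫⁻ ω, F (fun i : Fin n => ω i, pt ω) ∂ρ =
        ∫⁻ ω, ∫⁻ p, F (fun i : Fin n => ω i, p) ∂(post n (fun i : Fin n => ω i)) ∂ρ := by
    intro n F hF
    exact aux_lintegral_disint ρ _ (hξ n) pt hpt (post n) (hpost_prob n) (hpost_meas n)
      (fun A' hA' B hB => hpost n A' hA' B hB) F hF
  set x : ℕ → (ℕ → S) → ℝ≥0∞ := fun n ω => X n (fun i : Fin n => ω i, pt ω) with hx
  have hxm : ∀ n, Measurable (x n) := fun n => (hX n).comp ((hξ n).prodMk hpt)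
  set Q : ℕ → (ℕ → S) → ℝ≥0∞ := fun n ω =>
    ∫⁻ p, X n (fun i : Fin n => ω i, p) ∂(post n (fun i : Fin n => ω i)) with hQ
  have hQ' : ∀ n, ∃ q : (Fin n → S) → ℝ≥0∞, Measurable q ∧
      Q n = fun ω => q (fun i : Fin n => ω i) := by
    intro n
    let K : Kernel (Fin n → S) P := ⟨post n, hpost_meas n⟩
    haveI : IsMarkovKernel K := ⟨hpost_prob n⟩
    exact ⟨fun v => ∫⁻ p, X n (v, p) ∂(K v), (hX n).lintegral_kernel_prod_right', rfl⟩
  have hQm : ∀ n, Measurable (Q n) := by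
    intro n
    obtain ⟨q, hq, h⟩ := hQ' n
    rw [h]; exact hq.comp (hξ n)
  -- set integrals agree
  have hset : ∀ n (s : Set (ℕ → S)), MeasurableSet[coordFilt S n] s →
      ∫⁻ ω in s, Q n ω ∂ρ = ∫⁻ ω in s, x n ω ∂ρ := by
    intro n s hs
    obtain ⟨A, hA, rfl⟩ := hs
    have h1 := hdis n (fun z => (Prod.fst ⁻¹' A).indicator (X n) z)
      ((hX n).indicator (measurable_fst hA))
    rw [← lintegral_indicator (hξ n hA), ← lintegral_indicator (hξ n hA)]
    refine Eq.trans ?_ (h1.symm.trans ?_)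
    · refine lintegral_congr fun ω => ?_
      by_cases h : (fun i : Fin n => ω i) ∈ A <;> simp [Set.indicator, h, hQ]
    · refine lintegral_congr fun ω => ?_
      by_cases h : (fun i : Fin n => ω i) ∈ A <;> simp [Set.indicator, h, hx]
  have hxle : ∀ N n, N ≤ n → ∀ ω, x n ω ≤ ⨆ j ≥ N, x j ω := fun N n hn ω =>
    le_iSup₂ (f := fun j (_ : j ≥ N) => x j ω) n hn
  have hUm : ∀ N, Measurable (fun ω => ⨆ j ≥ N, x j ω) := fun N =>
    Measurable.iSup fun j => Measurable.iSup fun _ => hxm j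
  have hUfin : ∀ N, ∫⁻ ω, ⨆ j ≥ N, x j ω ∂ρ ≠ ∞ := fun N =>
    ne_top_of_le_ne_top hintg (lintegral_mono fun ω => iSup_mono fun j => iSup_le fun _ => le_rfl)
  have hxfin : ∀ n, ∫⁻ ω, x n ω ∂ρ ≠ ∞ := fun n =>
    ne_top_of_le_ne_top hintg (lintegral_mono fun ω => le_iSup (fun n => x n ω) n)
  have hQfin : ∀ n, ∫⁻ ω, Q n ω ∂ρ ≠ ∞ := by
    intro n
    rw [hQ, ← hdis n (X n) (hX n)]
    exact hxfin n
  have hQae : ∀ n, ∀ᵐ ω ∂ρ, Q n ω < ∞ := fun n => ae_lt_top (hQm n) (hQfin n)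
  have hUae : ∀ N, ∀ᵐ ω ∂ρ, (⨆ j ≥ N, x j ω) < ∞ := fun n => ae_lt_top (hUm n) (hUfin n)
  have hxae : ∀ n, ∀ᵐ ω ∂ρ, x n ω < ∞ := fun n => ae_lt_top (hxm n) (hxfin n)
  -- conditional expectation
  have hce : ∀ n, (fun ω => (Q n ω).toReal) =ᵐ[ρ] ρ[fun ω => (x n ω).toReal | coordFilt S n] := by
    intro n
    refine ae_eq_condExp_of_forall_setIntegral_eq ((coordFilt S).le n)
      (integrable_toReal_of_lintegral_ne_top (hxm n).aemeasurable (hxfin n)) ?_ ?_ ?_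
    · intro s hs _
      exact (integrable_toReal_of_lintegral_ne_top (hQm n).aemeasurable (hQfin n)).integrableOn
    · intro s hs _
      rw [integral_toReal (hQm n).aemeasurable.restrict (ae_restrict_of_ae (hQae n)),
        integral_toReal (hxm n).aemeasurable.restrict (ae_restrict_of_ae (hxae n)), hset n s hs]
    · obtain ⟨q, hq, h⟩ := hQ' n
      refine StronglyMeasurable.aestronglyMeasurable ?_
      refine Measurable.stronglyMeasurable ?_
      have : (fun ω => (Q n ω).toReal) = (fun v => (q v).toReal) ∘
          (fun (ω : ℕ → S) (i : Fin n) => ω i) := by rw [h]; rfl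
      rw [this]
      exact hq.ennreal_toReal.comp (comap_measurable _)
  have hle : ∀ N n, N ≤ n → ∀ᵐ ω ∂ρ, (Q n ω).toReal ≤
      (ρ[fun ω => (⨆ j ≥ N, x j ω).toReal | coordFilt S n]) ω := by
    intro N n hn
    have := condExp_mono (m := coordFilt S n) (μ := ρ)
      (integrable_toReal_of_lintegral_ne_top (hxm n).aemeasurable (hxfin n))
      (integrable_toReal_of_lintegral_ne_top (hUm N).aemeasurable (hUfin N))
      (by
        filter_upwards [hUae N] with ω hω
        exact ENNReal.toReal_mono hω.ne (hxle N n hn ω))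
    filter_upwards [hce n, this] with ω h1 h2
    rw [h1]; exact h2
  have hlim : ∀ N, ∀ᵐ ω ∂ρ, Filter.Tendsto (fun n =>
      (ρ[fun ω => (⨆ j ≥ N, x j ω).toReal | coordFilt S n]) ω) Filter.atTop
      (nhds ((⨆ j ≥ N, x j ω).toReal)) := by
    intro N
    refine Integrable.tendsto_ae_condExp
      (integrable_toReal_of_lintegral_ne_top (hUm N).aemeasurable (hUfin N)) ?_
    rw [coordFilt_iSup]
    exact (hUm N).ennreal_toReal.stronglyMeasurable
  have hle' : ∀ᵐ ω ∂ρ, ∀ N n, N ≤ n → (Q n ω).toReal ≤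
      (ρ[fun ω => (⨆ j ≥ N, x j ω).toReal | coordFilt S n]) ω := by
    rw [ae_all_iff]; intro N; rw [ae_all_iff]; intro n
    by_cases hn : N ≤ n
    · filter_upwards [hle N n hn] with ω h _ using h
    · exact Filter.Eventually.of_forall fun ω h => absurd h hn
  filter_upwards [hle', ae_all_iff.2 hlim, ae_all_iff.2 hQae, ae_all_iff.2 hUae]
    with ω h1 h2 h3 h4
  show Filter.limsup (fun n => Q n ω) Filter.atTop ≤ Filter.limsup (fun n => x n ω) Filter.atTop
  conv_rhs => rw [Filter.limsup_eq_iInf_iSup_of_nat]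
  refine le_iInf fun N => ?_
  have ht : Filter.Tendsto (fun n => ENNReal.ofReal
      ((ρ[fun ω => (⨆ j ≥ N, x j ω).toReal | coordFilt S n]) ω)) Filter.atTop
      (nhds (⨆ j ≥ N, x j ω)) := by
    have := ENNReal.tendsto_ofReal (h2 N)
    rwa [ENNReal.ofReal_toReal (h4 N).ne] at this
  rw [← ht.limsup_eq]
  refine Filter.limsup_le_limsup ?_
  filter_upwards [Filter.eventually_ge_atTop N] with n hn
  rw [← ENNReal.ofReal_toReal (h3 n).ne]
  exact ENNReal.ofReal_le_ofReal (h1 N n hn)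
end

section
lemma aux_max_ineq {Ω : Type*} [MeasurableSpace Ω] (P : Measure Ω) [IsProbabilityMeasure P]
    (X : ℕ → Ω → ℝ) (hXm : ∀ i, Measurable (X i)) (hind : iIndepFun X P) (l w : ℝ)
    (hintg : ∀ i, Integrable (fun ω => Real.exp (l * X i ω)) P)
    (h1 : ∀ i, 1 ≤ mgf (X i) P l) (h2 : ∀ i, mgf (X i) P l ≤ Real.exp w) (b : ℝ) (N : ℕ) :
    P {ω | ∃ k ≤ N, b ≤ l * ∑ i ∈ Finset.range (k + 1), X i ω}
      ≤ ENNReal.ofReal (Real.exp (-b + (N + 1) * w)) := by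
  let f : ℕ → Ω → ℝ := fun k ω => Real.exp (l * (∑ i ∈ Finset.range (k + 1), X i) ω)
  have hYs : ∀ i, StronglyMeasurable (X i) := fun i => (hXm i).stronglyMeasurable
  have hfint : ∀ k, Integrable (f k) P := fun k =>
    hind.integrable_exp_mul_sum hXm (fun i _ => hintg i)
  have hYi : iIndepFun (fun i ω => Real.exp (l * X i ω)) P :=
    hind.comp (fun _ x => Real.exp (l * x)) (fun _ => by fun_prop)
  have hYs' : ∀ i, StronglyMeasurable (fun ω => Real.exp (l * X i ω)) := fun i =>
    Measurable.stronglyMeasurable (by have := hXm i; fun_prop)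
  have hadp : StronglyAdapted (Filtration.natural (fun i ω => Real.exp (l * X i ω)) hYs') f := by
    intro k
    have : f k = ∏ i ∈ Finset.range (k + 1), (fun ω => Real.exp (l * X i ω)) := by
      funext ω
      simp [f, Finset.mul_sum, Real.exp_sum]
    rw [this]
    refine Finset.stronglyMeasurable_prod _ fun i hi => ?_
    have hik : i ≤ k := by simpa [Nat.lt_succ_iff] using hi
    exact ((Filtration.stronglyAdapted_natural hYs') i).mono
      ((Filtration.natural _ hYs').mono hik)
  have hsub : Submartingale f (Filtration.natural (fun i ω => Real.exp (l * X i ω)) hYs') P := by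
    refine submartingale_nat hadp hfint fun i => ?_
    have he : f (i + 1) = f i * (fun ω => Real.exp (l * X (i + 1) ω)) := by
      funext ω
      simp only [f, Pi.mul_apply, ← Real.exp_add]
      rw [Finset.sum_range_succ _ (i + 1), Pi.add_apply, mul_add]
    have hc := condExp_mul_of_stronglyMeasurable_left (μ := P) (hadp i)
      (he ▸ hfint (i + 1)) (hintg (i + 1))
    have hn := iIndepFun.condExp_natural_ae_eq_of_lt hYs' hYi (Nat.lt_succ_self i)
    rw [he]
    filter_upwards [hc, hn] with ω a1 a2
    rw [a1, Pi.mul_apply, a2]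
    exact le_mul_of_one_le_right (Real.exp_pos _).le (h1 (i + 1))
  have hmax := maximal_ineq hsub (fun k ω => (Real.exp_pos _).le)
    (ε := (Real.exp b).toNNReal) N
  set A : Set Ω := {ω | ((Real.exp b).toNNReal : ℝ) ≤
    (Finset.range (N + 1)).sup' Finset.nonempty_range_add_one fun k => f k ω} with hA
  have hAsub : {ω | ∃ k ≤ N, b ≤ l * ∑ i ∈ Finset.range (k + 1), X i ω} ⊆ A := by
    rintro ω ⟨k, hk, hb⟩
    simp only [hA, Set.mem_ofPred_eq, Finset.le_sup'_iff]
    refine ⟨k, by simp; omega, ?_⟩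
    rw [Real.coe_toNNReal _ (Real.exp_pos _).le]
    simp only [f, Finset.sum_apply]
    exact Real.exp_le_exp.2 hb
  have hI : ∫ ω in A, f N ω ∂P ≤ Real.exp ((N + 1) * w) := by
    calc ∫ ω in A, f N ω ∂P ≤ ∫ ω, f N ω ∂P :=
          setIntegral_le_integral (hfint N) (Filter.Eventually.of_forall fun ω => (Real.exp_pos _).le)
      _ = mgf (∑ i ∈ Finset.range (N + 1), X i) P l := rfl
      _ = ∏ i ∈ Finset.range (N + 1), mgf (X i) P l := hind.mgf_sum hXm _
      _ ≤ ∏ i ∈ Finset.range (N + 1), Real.exp w :=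
          Finset.prod_le_prod (fun i _ => zero_le_one.trans (h1 i)) (fun i _ => h2 i)
      _ = _ := by
          rw [Finset.prod_const, Finset.card_range, ← Real.exp_nat_mul]; push_cast; rfl
  refine (measure_mono hAsub).trans ?_
  have h3 : ENNReal.ofReal (Real.exp b) * P A ≤ ENNReal.ofReal (Real.exp ((N + 1) * w)) :=
    hmax.trans (ENNReal.ofReal_le_ofReal hI)
  rw [Real.exp_add, Real.exp_neg, ENNReal.ofReal_mul (by positivity),
    ENNReal.ofReal_inv_of_pos (Real.exp_pos _)]
  have hb0 : ENNReal.ofReal (Real.exp b) ≠ 0 := by simp [Real.exp_pos]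
  rw [← ENNReal.div_eq_inv_mul, ENNReal.le_div_iff_mul_le (Or.inl hb0) (Or.inl ENNReal.ofReal_ne_top)]
  rwa [mul_comm]

lemma aux_lil {Ω : Type*} [MeasurableSpace Ω] (P : Measure Ω) [IsProbabilityMeasure P]
    (X : ℕ → Ω → ℝ) (hXm : ∀ i, Measurable (X i)) (hind : iIndepFun X P) (v l₀ : ℝ)
    (hv : 0 < v) (hl₀ : 0 < l₀)
    (hintg : ∀ l, 0 < l → l ≤ l₀ → ∀ i, Integrable (fun ω => Real.exp (l * X i ω)) P)
    (h1 : ∀ l, 0 < l → l ≤ l₀ → ∀ i, 1 ≤ mgf (X i) P l)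
    (h2 : ∀ l, 0 < l → l ≤ l₀ → ∀ i, mgf (X i) P l ≤ Real.exp (l ^ 2 * v / 2))
    (c : ℝ) (hc : 2 * v < c) :
    ∀ᵐ ω ∂P, ∀ᶠ n : ℕ in Filter.atTop,
      ∑ i ∈ Finset.range n, X i ω ≤ Real.sqrt (c * (n * Log2 n)) := by
  -- choose the ratio
  obtain ⟨q, hq1, hqc⟩ : ∃ q : ℝ, 1 < q ∧ q * (2 * v) < c := by
    refine ⟨(1 + c / (2 * v)) / 2, ?_, ?_⟩
    · have : 1 < c / (2 * v) := by rw [lt_div_iff₀ (by positivity)]; linarith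
      linarith
    · have : 2 * v * (c / (2 * v)) = c := by field_simp
      nlinarith
  have hc0 : 0 < c := by nlinarith
  have hq0 : 0 < q := by linarith
  have hlq : 0 < Real.log q := Real.log_pos hq1
  set s : ℝ := c / (q * (2 * v)) with hs
  have hs1 : 1 < s := by rw [hs, lt_div_iff₀ (by positivity)]; linarith
  let g : ℕ → ℝ := fun j => Real.log (j * Real.log q)
  let a : ℕ → ℝ := fun j => Real.sqrt (c * (q ^ j * g j))
  let l : ℕ → ℝ := fun j => a j / (q ^ (j + 1) * v)
  -- l j → 0
  have hglim : Filter.Tendsto (fun j : ℕ => (j : ℝ) * Real.log q) Filter.atTop Filter.atTop :=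
    Filter.Tendsto.atTop_mul_const hlq tendsto_natCast_atTop_atTop
  have hllim : Filter.Tendsto l Filter.atTop (nhds 0) := by
    have hsq : Filter.Tendsto (fun j => (l j) ^ 2) Filter.atTop (nhds 0) := by
      have hb : ∀ᶠ j : ℕ in Filter.atTop, (l j) ^ 2 ≤ (c / (q * v) ^ 2 * Real.log q) * (j / q ^ j) := by
        filter_upwards [hglim.eventually_ge_atTop 1] with j hj
        have hg0 : 0 ≤ g j := Real.log_nonneg hj
        have hg1 : g j ≤ j * Real.log q := by
          have := Real.log_le_sub_one_of_pos (show 0 < (j : ℝ) * Real.log q by linarith)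
          simp only [g]; linarith
        have hqj : 0 < q ^ j := by positivity
        simp only [l, a]
        rw [div_pow, Real.sq_sqrt (by positivity)]
        rw [pow_succ q j]
        have : c * (q ^ j * g j) / (q ^ j * q * v) ^ 2 = c / (q * v) ^ 2 * (g j / q ^ j) := by
          field_simp
        rw [this, mul_assoc]
        apply mul_le_mul_of_nonneg_left _ (by positivity)
        rw [← mul_div_assoc, mul_comm (Real.log q)]
        gcongr
      have hz : Filter.Tendsto (fun j : ℕ => (c / (q * v) ^ 2 * Real.log q) * ((j : ℝ) / q ^ j))
          Filter.atTop (nhds 0) := by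
        have := tendsto_pow_const_div_const_pow_of_one_lt 1 hq1
        simp only [pow_one] at this
        simpa using this.const_mul (c / (q * v) ^ 2 * Real.log q)
      exact tendsto_of_tendsto_of_tendsto_of_le_of_le' tendsto_const_nhds hz
        (Filter.Eventually.of_forall fun j => sq_nonneg _) hb
    have := hsq.sqrt
    simp only [Real.sqrt_zero] at this
    refine this.congr fun j => Real.sqrt_sq ?_
    simp only [l, a]; positivity
  let E : ℕ → Set Ω := fun j =>
    {ω | ∃ k ≤ ⌈q ^ (j + 1)⌉₊ - 2, a j * l j ≤ l j * ∑ i ∈ Finset.range (k + 1), X i ω}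
  -- probability bound
  have hev : ∀ᶠ j : ℕ in Filter.atTop, l j ≤ l₀ ∧ 1 < (j : ℝ) * Real.log q ∧ 2 ≤ q ^ (j + 1) ∧
      Real.exp (Real.exp 1) ≤ q ^ j := by
    have hqq : Filter.Tendsto (fun j : ℕ => q ^ j) Filter.atTop Filter.atTop :=
      tendsto_pow_atTop_atTop_of_one_lt hq1
    filter_upwards [hllim.eventually (ge_mem_nhds hl₀), hglim.eventually_gt_atTop 1,
      (hqq.comp (Filter.tendsto_add_atTop_nat 1)).eventually_ge_atTop 2,
      hqq.eventually_ge_atTop (Real.exp (Real.exp 1))] with j h1 h2 h3 h4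
    exact ⟨h1, h2, h3, h4⟩
  obtain ⟨J, hJ⟩ := Filter.eventually_atTop.1 hev
  have hlpos : ∀ j, J ≤ j → 0 < l j := by
    intro j hj
    obtain ⟨-, h, -, -⟩ := hJ j hj
    have : 0 < g j := Real.log_pos h
    simp only [l, a]; positivity
  have hPE : ∀ j, J ≤ j → P (E j) ≤ ENNReal.ofReal (((j : ℝ) * Real.log q) ^ (-s)) := by
    intro j hj
    obtain ⟨hl, hj1, hq2, -⟩ := hJ j hj
    have hlp := hlpos j hj
    have := aux_max_ineq P X hXm hind (l j) ((l j) ^ 2 * v / 2) (hintg _ hlp hl) (h1 _ hlp hl)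
      (h2 _ hlp hl) (a j * l j) (⌈q ^ (j + 1)⌉₊ - 2)
    refine this.trans (ENNReal.ofReal_le_ofReal ?_)
    rw [Real.rpow_def_of_pos (by linarith)]
    apply Real.exp_le_exp.2
    have hg0 : 0 < g j := Real.log_pos hj1
    have hN : (((⌈q ^ (j + 1)⌉₊ - 2 : ℕ) : ℝ) + 1) ≤ q ^ (j + 1) := by
      have h5 : 2 ≤ ⌈q ^ (j + 1)⌉₊ := by
        have := Nat.le_ceil (q ^ (j + 1))
        have : (2 : ℝ) ≤ ⌈q ^ (j + 1)⌉₊ := by linarith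
        exact_mod_cast this
      rw [Nat.cast_sub h5]
      have := Nat.ceil_lt_add_one (show 0 ≤ q ^ (j + 1) by positivity)
      push_cast
      linarith
    have h6 : (((⌈q ^ (j + 1)⌉₊ - 2 : ℕ) : ℝ) + 1) * ((l j) ^ 2 * v / 2) ≤
        q ^ (j + 1) * ((l j) ^ 2 * v / 2) := mul_le_mul_of_nonneg_right hN (by positivity)
    have h7 : -(a j * l j) + q ^ (j + 1) * ((l j) ^ 2 * v / 2) = g j * (-s) := by
      have ha2 : a j ^ 2 = c * (q ^ j * g j) := by
        simp only [a]; rw [Real.sq_sqrt]; positivity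
      have hqj : 0 < q ^ j := by positivity
      have : -(a j * l j) + q ^ (j + 1) * ((l j) ^ 2 * v / 2) = - (a j ^ 2 / (2 * q ^ (j + 1) * v)) := by
        simp only [l]
        field_simp
        ring
      rw [this, ha2, hs, pow_succ]
      field_simp
    show _ ≤ g j * (-s)
    linarith
  have hsum : ∑' j, P (E (j + J)) ≠ ∞ := by
    have hsm : Summable (fun j : ℕ => ((j : ℝ) * Real.log q) ^ (-s)) := by
      have : (fun j : ℕ => ((j : ℝ) * Real.log q) ^ (-s)) =
          fun j : ℕ => (j : ℝ) ^ (-s) * (Real.log q) ^ (-s) := by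
        funext j
        rw [Real.mul_rpow (by positivity) hlq.le]
      rw [this]
      exact (Real.summable_nat_rpow.2 (by linarith)).mul_right _
    have hsm' := (summable_nat_add_iff J).2 hsm
    refine ne_top_of_le_ne_top ?_ (ENNReal.tsum_le_tsum fun j => hPE (j + J) (by omega))
    exact hsm'.tsum_ofReal_ne_top
  filter_upwards [ae_eventually_notMem hsum] with ω hω
  obtain ⟨J', hJ'⟩ := Filter.eventually_atTop.1 hω
  have hlarge : ∀ᶠ n : ℕ in Filter.atTop, q ^ (J + J' + 1) ≤ (n : ℝ) ∧ 1 ≤ n :=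
    (tendsto_natCast_atTop_atTop.eventually_ge_atTop _).and (Filter.eventually_ge_atTop 1)
  filter_upwards [hlarge] with n hn
  obtain ⟨hn1, hn2⟩ := hn
  obtain ⟨j, hj1, hj2⟩ := exists_nat_pow_near (show (1 : ℝ) ≤ n by exact_mod_cast hn2) hq1
  have hjJ : J + J' ≤ j := by
    have : q ^ (J + J' + 1) < q ^ (j + 1) := lt_of_le_of_lt hn1 hj2
    have := (pow_lt_pow_iff_right₀ hq1).1 this
    omega
  have hnot := hJ' (j - J) (by omega)
  rw [Nat.sub_add_cancel (by omega)] at hnot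
  obtain ⟨hl, hg1, hq2, hee⟩ := hJ j (by omega)
  have hlp := hlpos j (by omega)
  have hSlt : ∑ i ∈ Finset.range n, X i ω < a j := by
    by_contra hcon
    push Not at hcon
    apply hnot
    refine ⟨n - 1, ?_, ?_⟩
    · have : n < ⌈q ^ (j + 1)⌉₊ := Nat.lt_ceil.2 hj2
      omega
    · rw [Nat.sub_add_cancel hn2, mul_comm]
      exact mul_le_mul_of_nonneg_left hcon hlp.le
  refine hSlt.le.trans ?_
  apply Real.sqrt_le_sqrt
  have hnee : ¬ ((n : ℝ) < Real.exp (Real.exp 1)) := by linarith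
  rw [Log2, if_neg hnee]
  have h8 : g j ≤ Real.log (Real.log n) := by
    apply Real.log_le_log (by linarith)
    rw [← Real.log_pow]
    exact Real.log_le_log (by positivity) hj1
  have hg0 : 0 < g j := Real.log_pos hg1
  gcongr
end

section
open scoped Matrix

lemma aux_meas_exp {S : Type*} [MeasurableSpace S] {k : ℕ} (t : S → (Fin k → ℝ))
    (ht : Measurable t) (y : Fin k → ℝ) : Measurable (fun x => y ⬝ᵥ t x) := by
  unfold dotProduct
  exact Finset.measurable_sum _ fun i _ => ((measurable_pi_apply i).comp ht).const_mul _

lemma aux_dom {S : Type*} [MeasurableSpace S] {k : ℕ} (μ : Measure S) (t : S → (Fin k → ℝ))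
    (ht : Measurable t) (O : Set (Fin k → ℝ)) (hO : IsOpen O) (g : S → ℝ) (hg : Measurable g)
    (hintg : ∀ y ∈ O, Integrable (fun x => g x * Real.exp (y ⬝ᵥ t x)) μ)
    (y : Fin k → ℝ) (hy : y ∈ O) :
    ∃ δ > 0, Metric.closedBall y δ ⊆ O ∧
      Integrable (fun x => |g x| * Real.exp (y ⬝ᵥ t x) * Real.exp (δ * ∑ i, |t x i|)) μ := by
  classical
  obtain ⟨δ, hδ, hball⟩ := Metric.nhds_basis_closedBall.mem_iff.1 (hO.mem_nhds hy)
  refine ⟨δ, hδ, hball, ?_⟩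
  have hti : ∀ i, Measurable (fun x => t x i) := fun i => (measurable_pi_apply i).comp ht
  let sg : Finset (Fin k) → (Fin k → ℝ) := fun s i => if i ∈ s then δ else -δ
  have hsg : ∀ s, y + sg s ∈ O := by
    intro s
    apply hball
    rw [Metric.mem_closedBall, dist_eq_norm, add_sub_cancel_left, pi_norm_le_iff_of_nonneg hδ.le]
    intro i
    simp only [sg]
    split_ifs <;> simp [abs_of_pos hδ]
  have hI : Integrable (fun x => ∑ s, |g x * Real.exp ((y + sg s) ⬝ᵥ t x)|) μ :=
    integrable_finsetSum _ fun s _ => (hintg _ (hsg s)).abs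
  have hmy := aux_meas_exp t ht y
  refine hI.mono' ?_ (Filter.Eventually.of_forall fun x => ?_)
  · refine Measurable.aestronglyMeasurable ?_
    refine (Measurable.mul hg.abs hmy.exp).mul (Measurable.exp (Measurable.const_mul ?_ _))
    exact Finset.measurable_sum _ fun i _ => (hti i).abs
  · rw [Real.norm_eq_abs, abs_of_nonneg (by positivity)]
    have h1 : Real.exp (δ * ∑ i, |t x i|) ≤ ∑ s, Real.exp (sg s ⬝ᵥ t x) := by
      calc Real.exp (δ * ∑ i, |t x i|) = ∏ i, Real.exp (δ * |t x i|) := by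
            rw [Finset.mul_sum, Real.exp_sum]
        _ ≤ ∏ i, (Real.exp (δ * t x i) + Real.exp (-δ * t x i)) := by
            refine Finset.prod_le_prod (fun i _ => (Real.exp_pos _).le) fun i _ => ?_
            rcases abs_cases (t x i) with ⟨h, _⟩ | ⟨h, _⟩
            · rw [h]; linarith [Real.exp_pos (-δ * t x i)]
            · rw [h]
              have : δ * -t x i = -δ * t x i := by ring
              rw [this]; linarith [Real.exp_pos (δ * t x i)]
        _ = ∑ s, Real.exp (sg s ⬝ᵥ t x) := by
            rw [Fintype.prod_add]
            refine Finset.sum_congr rfl fun s _ => ?_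
            rw [← Real.exp_sum, ← Real.exp_sum, ← Real.exp_add]
            congr 1
            rw [dotProduct, ← Finset.sum_add_sum_compl s]
            congr 1
            · refine Finset.sum_congr rfl fun i hi => by simp [sg, hi]
            · refine Finset.sum_congr rfl fun i hi => by
                have : i ∉ s := by simpa using hi
                simp [sg, this]
    calc |g x| * Real.exp (y ⬝ᵥ t x) * Real.exp (δ * ∑ i, |t x i|)
        ≤ |g x| * Real.exp (y ⬝ᵥ t x) * ∑ s, Real.exp (sg s ⬝ᵥ t x) := by gcongr
      _ = _ := by
          rw [Finset.mul_sum]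
          refine Finset.sum_congr rfl fun s _ => ?_
          rw [abs_mul, abs_of_pos (Real.exp_pos _), add_dotProduct, Real.exp_add, mul_assoc]

lemma aux_abs_dot {k : ℕ} (z w : Fin k → ℝ) (δ : ℝ) (hz : ‖z‖ ≤ δ) :
    |z ⬝ᵥ w| ≤ δ * ∑ i, |w i| := by
  rw [dotProduct, Finset.mul_sum]
  refine (Finset.abs_sum_le_sum_abs _ _).trans (Finset.sum_le_sum fun i _ => ?_)
  rw [abs_mul]
  exact mul_le_mul_of_nonneg_right ((norm_le_pi_norm z i).trans hz) (abs_nonneg _)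

/-- the integrals are locally uniformly dominated: continuity in `L¹` -/
lemma aux_L1cont {S : Type*} [MeasurableSpace S] {k : ℕ} (μ : Measure S) (t : S → (Fin k → ℝ))
    (ht : Measurable t) (O : Set (Fin k → ℝ)) (hO : IsOpen O) (g : S → ℝ) (hg : Measurable g)
    (hintg : ∀ y ∈ O, Integrable (fun x => g x * Real.exp (y ⬝ᵥ t x)) μ)
    (y : Fin k → ℝ) (hy : y ∈ O) (a : (Fin k → ℝ) → ℝ) (ha : ContinuousAt a y) :
    Filter.Tendsto (fun z => ∫ x, |g x| * |a z * Real.exp (z ⬝ᵥ t x) - a y * Real.exp (y ⬝ᵥ t x)| ∂μ)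
      (nhds y) (nhds 0) := by
  obtain ⟨δ, hδ, hball, hI⟩ := aux_dom μ t ht O hO g hg hintg y hy
  have h0 : ∫ x, |g x| * |a y * Real.exp (y ⬝ᵥ t x) - a y * Real.exp (y ⬝ᵥ t x)| ∂μ = 0 := by simp
  rw [← h0]
  have hA : ∀ᶠ z in nhds y, |a z| ≤ |a y| + 1 :=
    (ha.abs.eventually (ge_mem_nhds (lt_add_one _)))
  refine tendsto_integral_filter_of_dominated_convergence
    (fun x => (2 * (|a y| + 1)) * (|g x| * Real.exp (y ⬝ᵥ t x) * Real.exp (δ * ∑ i, |t x i|))) ?_ ?_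
    (hI.const_mul _) ?_
  · refine Filter.Eventually.of_forall fun z => Measurable.aestronglyMeasurable ?_
    exact hg.abs.mul (((aux_meas_exp t ht z).exp.const_mul _).sub
      ((aux_meas_exp t ht y).exp.const_mul _)).abs
  · filter_upwards [Metric.closedBall_mem_nhds y hδ, hA] with z hz haz
    refine Filter.Eventually.of_forall fun x => ?_
    rw [Real.norm_eq_abs, abs_of_nonneg (by positivity)]
    have h1 : Real.exp (z ⬝ᵥ t x) ≤ Real.exp (y ⬝ᵥ t x) * Real.exp (δ * ∑ i, |t x i|) := by
      rw [← Real.exp_add]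
      apply Real.exp_le_exp.2
      have h2 := aux_abs_dot (z - y) (t x) δ (by rwa [← dist_eq_norm])
      have h3 := le_abs_self ((z - y) ⬝ᵥ t x)
      rw [sub_dotProduct] at h2 h3
      linarith
    have h1' : Real.exp (y ⬝ᵥ t x) ≤ Real.exp (y ⬝ᵥ t x) * Real.exp (δ * ∑ i, |t x i|) := by
      refine le_mul_of_one_le_right (Real.exp_pos _).le (Real.one_le_exp ?_)
      exact mul_nonneg hδ.le (Finset.sum_nonneg fun i _ => abs_nonneg _)
    have h4 : |a z * Real.exp (z ⬝ᵥ t x) - a y * Real.exp (y ⬝ᵥ t x)| ≤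
        (2 * (|a y| + 1)) * (Real.exp (y ⬝ᵥ t x) * Real.exp (δ * ∑ i, |t x i|)) := by
      refine (abs_sub _ _).trans ?_
      rw [abs_mul, abs_mul, abs_of_pos (Real.exp_pos _), abs_of_pos (Real.exp_pos _)]
      have e1 := mul_le_mul haz h1 (Real.exp_pos _).le (by positivity)
      have e2 := mul_le_mul (show |a y| ≤ |a y| + 1 by linarith) h1' (Real.exp_pos _).le (by positivity)
      linarith
    calc _ ≤ |g x| * ((2 * (|a y| + 1)) * (Real.exp (y ⬝ᵥ t x) * Real.exp (δ * ∑ i, |t x i|))) := by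
          gcongr
      _ = _ := by ring
  · refine Filter.Eventually.of_forall fun x => ?_
    have hc : ContinuousAt (fun z : Fin k → ℝ => |g x| * |a z * Real.exp (z ⬝ᵥ t x) - a y * Real.exp (y ⬝ᵥ t x)|) y := by
      have : Continuous (fun z : Fin k → ℝ => z ⬝ᵥ t x) := by unfold dotProduct; fun_prop
      exact (continuousAt_const.mul ((ha.mul this.rexp.continuousAt).sub continuousAt_const).abs)
    exact hc.tendsto

lemma aux_fderiv {S : Type*} [MeasurableSpace S] {k : ℕ} (μ : Measure S) (t : S → (Fin k → ℝ))
    (ht : Measurable t) (O : Set (Fin k → ℝ)) (hO : IsOpen O) (g : S → ℝ) (hg : Measurable g)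
    (hintg : ∀ y ∈ O, Integrable (fun x => g x * Real.exp (y ⬝ᵥ t x)) μ)
    (y : Fin k → ℝ) (hy : y ∈ O) :
    (∀ i, Integrable (fun x => (g x * t x i) * Real.exp (y ⬝ᵥ t x)) μ) ∧
    HasFDerivAt (fun y => ∫ x, g x * Real.exp (y ⬝ᵥ t x) ∂μ)
      (∑ i, (∫ x, (g x * t x i) * Real.exp (y ⬝ᵥ t x) ∂μ) •
        (ContinuousLinearMap.proj i : (Fin k → ℝ) →L[ℝ] ℝ)) y := by
  obtain ⟨δ, hδ, hball, hI⟩ := aux_dom μ t ht O hO g hg hintg y hy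
  have hti : ∀ i, Measurable (fun x => t x i) := fun i => (measurable_pi_apply i).comp ht
  have hmy := aux_meas_exp t ht
  have hbd : ∀ x, ∀ i, |t x i| ≤ (2 / δ) * Real.exp (δ / 2 * ∑ i, |t x i|) := by
    intro x i
    have h1 : |t x i| ≤ ∑ i, |t x i| :=
      Finset.single_le_sum (f := fun i => |t x i|) (fun i _ => abs_nonneg _) (Finset.mem_univ i)
    have h2 := Real.add_one_le_exp (δ / 2 * ∑ i, |t x i|)
    have h3 : δ / 2 * |t x i| ≤ Real.exp (δ / 2 * ∑ i, |t x i|) := by nlinarith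
    have : |t x i| = (2 / δ) * (δ / 2 * |t x i|) := by field_simp
    rw [this]; gcongr
  have hb : ∀ z ∈ Metric.ball y (δ / 2), ∀ x i, |(g x * t x i) * Real.exp (z ⬝ᵥ t x)| ≤
      (2 / δ) * (|g x| * Real.exp (y ⬝ᵥ t x) * Real.exp (δ * ∑ i, |t x i|)) := by
    intro z hz x i
    have h1 : Real.exp (z ⬝ᵥ t x) ≤ Real.exp (y ⬝ᵥ t x) * Real.exp (δ / 2 * ∑ i, |t x i|) := by
      rw [← Real.exp_add]
      apply Real.exp_le_exp.2
      have h2 := aux_abs_dot (z - y) (t x) (δ / 2) (by rw [← dist_eq_norm]; exact (Metric.mem_ball.1 hz).le)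
      have h3 := le_abs_self ((z - y) ⬝ᵥ t x)
      rw [sub_dotProduct] at h2 h3
      linarith
    rw [abs_mul, abs_mul, abs_of_pos (Real.exp_pos _)]
    have hsplit : Real.exp (δ * ∑ i, |t x i|) =
        Real.exp (δ / 2 * ∑ i, |t x i|) * Real.exp (δ / 2 * ∑ i, |t x i|) := by
      rw [← Real.exp_add]; congr 1; ring
    calc |g x| * |t x i| * Real.exp (z ⬝ᵥ t x)
        ≤ |g x| * ((2 / δ) * Real.exp (δ / 2 * ∑ i, |t x i|)) *
          (Real.exp (y ⬝ᵥ t x) * Real.exp (δ / 2 * ∑ i, |t x i|)) := by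
          have := hbd x i
          gcongr
      _ = _ := by rw [hsplit]; ring
  have hintg' : ∀ i, Integrable (fun x => (g x * t x i) * Real.exp (y ⬝ᵥ t x)) μ := by
    intro i
    refine (hI.const_mul (2 / δ)).mono' ?_ (Filter.Eventually.of_forall fun x => ?_)
    · exact (((hg.mul (hti i)).mul (hmy y).exp)).aestronglyMeasurable
    · exact hb y (Metric.mem_ball_self (by positivity)) x i
  refine ⟨hintg', ?_⟩
  let F' : (Fin k → ℝ) → S → ((Fin k → ℝ) →L[ℝ] ℝ) := fun z x =>
    ∑ i, ((g x * t x i) * Real.exp (z ⬝ᵥ t x)) • (ContinuousLinearMap.proj i : (Fin k → ℝ) →L[ℝ] ℝ)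
  have hmain := hasFDerivAt_integral_of_dominated_of_fderiv_le (𝕜 := ℝ) (μ := μ)
    (F := fun z x => g x * Real.exp (z ⬝ᵥ t x)) (F' := F') (x₀ := y) (s := Metric.ball y (δ / 2))
    (bound := fun x => ∑ i : Fin k, (2 / δ) * (|g x| * Real.exp (y ⬝ᵥ t x) * Real.exp (δ * ∑ i, |t x i|)) *
      ‖(ContinuousLinearMap.proj i : (Fin k → ℝ) →L[ℝ] ℝ)‖)
    (Metric.ball_mem_nhds y (by positivity))
    (Filter.Eventually.of_forall fun z => (hg.mul (hmy z).exp).aestronglyMeasurable)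
    (hintg y hy) ?_ ?_ ?_ ?_
  · refine hmain.congr_fderiv (Eq.symm ?_)
    change _ = ∫ x, ∑ i, ((g x * t x i) * Real.exp (y ⬝ᵥ t x)) •
      (ContinuousLinearMap.proj i : (Fin k → ℝ) →L[ℝ] ℝ) ∂μ
    rw [integral_finsetSum]
    · refine Finset.sum_congr rfl fun i _ => ?_
      rw [integral_smul_const]
    · intro i _
      exact (hintg' i).smul_const _
  · refine Finset.aestronglyMeasurable_fun_sum _ fun i _ => ?_
    exact (hintg' i).1.smul_const _
  · refine Filter.Eventually.of_forall fun x z hz => ?_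
    refine (norm_sum_le _ _).trans (Finset.sum_le_sum fun i _ => ?_)
    rw [norm_smul]
    exact mul_le_mul_of_nonneg_right (hb z hz x i) (norm_nonneg _)
  · refine integrable_finsetSum _ fun i _ => ?_
    exact (hI.const_mul _).mul_const _
  · refine Filter.Eventually.of_forall fun x z _ => ?_
    have h1 : HasFDerivAt (fun z : Fin k → ℝ => z ⬝ᵥ t x)
        (∑ i, t x i • (ContinuousLinearMap.proj i : (Fin k → ℝ) →L[ℝ] ℝ)) z := by
      have : (fun z : Fin k → ℝ => z ⬝ᵥ t x) =
          ⇑(∑ i, t x i • (ContinuousLinearMap.proj i : (Fin k → ℝ) →L[ℝ] ℝ)) := by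
        funext z; simp [dotProduct, mul_comm]
      rw [this]
      exact ContinuousLinearMap.hasFDerivAt _
    have h2 := (h1.exp).const_mul (g x)
    refine h2.congr_fderiv (Eq.symm ?_)
    change ∑ i, ((g x * t x i) * Real.exp (z ⬝ᵥ t x)) •
      (ContinuousLinearMap.proj i : (Fin k → ℝ) →L[ℝ] ℝ) = _
    rw [Finset.smul_sum, Finset.smul_sum]
    simp only [smul_smul]
    refine Finset.sum_congr rfl fun i _ => ?_
    congr 1; ring
end

section
open scoped Matrix

lemma aux_taylor2 {E : Type*} [NormedAddCommGroup E] [NormedSpace ℝ E]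
    (F : E → ℝ) (F' : E → E →L[ℝ] ℝ) (F'' : E →L[ℝ] E →L[ℝ] ℝ) (θ : E)
    (h1 : ∀ᶠ z in nhds θ, HasFDerivAt F (F' z) z) (h2 : HasFDerivAt F' F'' θ) (ε : ℝ) (hε : 0 < ε) :
    ∀ᶠ η in nhds θ, |F η - F θ - F' θ (η - θ) - (1 / 2) * F'' (η - θ) (η - θ)| ≤ ε * ‖η - θ‖ ^ 2 := by
  have hsymm : ∀ v w, F'' v w = F'' w v := fun v w =>
    second_derivative_symmetric_of_eventually h1 h2 v w
  have h3 : ∀ᶠ z in nhds θ, ‖F' z - F' θ - F'' (z - θ)‖ ≤ ε * ‖z - θ‖ := by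
    have := h2.isLittleO.bound hε
    exact this
  obtain ⟨r, hr, hball⟩ := Metric.eventually_nhds_iff_ball.1 (h1.and h3)
  filter_upwards [Metric.ball_mem_nhds θ hr] with η hη
  let R : E → ℝ := fun z => F z - F θ - F' θ (z - θ) - (1 / 2) * F'' (z - θ) (z - θ)
  have hR : ∀ z ∈ Metric.closedBall θ ‖η - θ‖, HasFDerivWithinAt R (F' z - F' θ - F'' (z - θ))
      (Metric.closedBall θ ‖η - θ‖) z := by
    intro z hz
    have hz' : z ∈ Metric.ball θ r := by
      rw [Metric.mem_closedBall] at hz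
      rw [Metric.mem_ball] at hη ⊢
      rw [← dist_eq_norm] at hz
      exact lt_of_le_of_lt hz hη
    have hd := (hball z hz').1
    have e1 : HasFDerivAt (fun z : E => z - θ) (ContinuousLinearMap.id ℝ E) z :=
      (hasFDerivAt_id z).sub_const θ
    have e2 : HasFDerivAt (fun z : E => F' θ (z - θ)) (F' θ) z := by
      have := (F' θ).hasFDerivAt.comp z e1
      rwa [ContinuousLinearMap.comp_id] at this
    have e3 : HasFDerivAt (fun z : E => F'' (z - θ)) F'' z := by
      have := F''.hasFDerivAt.comp z e1
      rwa [ContinuousLinearMap.comp_id] at this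
    have e4 := e3.clm_apply e1
    have e5 := ((hd.sub_const (F θ)).sub e2).sub (e4.const_mul (1 / 2))
    refine (e5.congr_fderiv ?_).hasFDerivWithinAt
    ext w
    have := hsymm w (z - θ)
    simp only [map_sub, sub_apply, smul_apply,
      add_apply, ContinuousLinearMap.comp_apply, ContinuousLinearMap.id_apply,
      ContinuousLinearMap.flip_apply, smul_eq_mul] at this ⊢
    linarith
  have hmv := (convex_closedBall θ ‖η - θ‖).norm_image_sub_le_of_norm_hasFDerivWithin_le
    (C := ε * ‖η - θ‖) hR ?_ (Metric.mem_closedBall_self (norm_nonneg _))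
    (show η ∈ Metric.closedBall θ ‖η - θ‖ by rw [Metric.mem_closedBall, dist_eq_norm])
  · have hR0 : R θ = 0 := by simp [R]
    rw [hR0, sub_zero, Real.norm_eq_abs] at hmv
    calc _ = |R η| := rfl
      _ ≤ _ := hmv
      _ = _ := by ring
  · intro z hz
    have hz' : z ∈ Metric.ball θ r := by
      rw [Metric.mem_closedBall] at hz
      rw [Metric.mem_ball] at hη ⊢
      rw [← dist_eq_norm] at hz
      exact lt_of_le_of_lt hz hη
    refine (hball z hz').2.trans ?_
    rw [Metric.mem_closedBall, dist_eq_norm] at hz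
    gcongr

structure EF {S : Type*} [MeasurableSpace S] {k : ℕ} (μ : Measure S) (t : S → (Fin k → ℝ))
    (Λ Θ : Set (Fin k → ℝ)) (M : (Fin k → ℝ) → ℝ) (Vinv : (Fin k → ℝ) → (Fin k → ℝ)) : Prop where
  sf : SigmaFinite μ
  ht : Measurable t
  ne : μ ≠ 0
  hintg : ∀ y ∈ Λ, Integrable (fun x => Real.exp (y ⬝ᵥ t x)) μ
  hM : ∀ y, M y = Real.log (∫ x, Real.exp (y ⬝ᵥ t x) ∂μ)
  nd : ∀ v : Fin k → ℝ, v ≠ 0 → ∀ c : ℝ, ¬ (∀ᵐ x ∂μ, v ⬝ᵥ t x = c)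
  oΛ : IsOpen Λ
  oΘ : IsOpen Θ
  hVinv : ∀ θ ∈ Θ, Vinv θ ∈ Λ ∧ (fun i => fderiv ℝ M (Vinv θ) (Pi.single i 1)) = θ

def efL {S : Type*} [MeasurableSpace S] {k : ℕ} (μ : Measure S) (t : S → (Fin k → ℝ))
    (g : S → ℝ) (y : Fin k → ℝ) : ℝ := ∫ x, g x * Real.exp (y ⬝ᵥ t x) ∂μ

/-- mean value map -/
def efV {S : Type*} [MeasurableSpace S] {k : ℕ} (μ : Measure S) (t : S → (Fin k → ℝ))
    (y : Fin k → ℝ) : Fin k → ℝ := fun i => efL μ t (fun x => t x i) y / efL μ t (fun _ => 1) y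

/-- covariance -/
def efH {S : Type*} [MeasurableSpace S] {k : ℕ} (μ : Measure S) (t : S → (Fin k → ℝ))
    (y : Fin k → ℝ) : Matrix (Fin k) (Fin k) ℝ :=
  fun i j => efL μ t (fun x => t x j * t x i) y / efL μ t (fun _ => 1) y - efV μ t y i * efV μ t y j

namespace EF
variable {S : Type*} [MeasurableSpace S] {k : ℕ} {μ : Measure S} {t : S → (Fin k → ℝ)}
    {Λ Θ : Set (Fin k → ℝ)} {M : (Fin k → ℝ) → ℝ} {Vinv : (Fin k → ℝ) → (Fin k → ℝ)}

lemma hti (h : EF μ t Λ Θ M Vinv) (i) : Measurable (fun x => t x i) :=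
  (measurable_pi_apply i).comp h.ht

lemma int1 (h : EF μ t Λ Θ M Vinv) : ∀ y ∈ Λ, Integrable (fun x => (1:ℝ) * Real.exp (y ⬝ᵥ t x)) μ := by
  intro y hy; simpa using h.hintg y hy

lemma intt (h : EF μ t Λ Θ M Vinv) (i) : ∀ y ∈ Λ, Integrable (fun x => t x i * Real.exp (y ⬝ᵥ t x)) μ := by
  intro y hy
  simpa using (aux_fderiv μ t h.ht Λ h.oΛ (fun _ => 1) measurable_const h.int1 y hy).1 i

lemma inttt (h : EF μ t Λ Θ M Vinv) (i j) : ∀ y ∈ Λ,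
    Integrable (fun x => (t x i * t x j) * Real.exp (y ⬝ᵥ t x)) μ := fun y hy =>
  (aux_fderiv μ t h.ht Λ h.oΛ _ (h.hti i) (h.intt i) y hy).1 j

lemma L_pos (h : EF μ t Λ Θ M Vinv) {y} (hy : y ∈ Λ) : 0 < efL μ t (fun _ => 1) y := by
  unfold efL
  have := h.ne
  simp only [one_mul]
  have : NeZero μ := ⟨h.ne⟩
  exact integral_exp_pos (h.hintg y hy)

lemma M_eq (h : EF μ t Λ Θ M Vinv) : M = fun y => Real.log (efL μ t (fun _ => 1) y) := by
  funext y
  rw [h.hM]; simp [efL]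

lemma L_fd (h : EF μ t Λ Θ M Vinv) {y} (hy : y ∈ Λ) : HasFDerivAt (efL μ t (fun _ => 1))
    (∑ i, efL μ t (fun x => t x i) y • (ContinuousLinearMap.proj i : (Fin k → ℝ) →L[ℝ] ℝ)) y := by
  have := (aux_fderiv μ t h.ht Λ h.oΛ (fun _ => 1) measurable_const h.int1 y hy).2
  simp only [one_mul] at this
  unfold efL
  simpa only [one_mul] using this

lemma Lt_fd (h : EF μ t Λ Θ M Vinv) (j) {y} (hy : y ∈ Λ) : HasFDerivAt (efL μ t (fun x => t x j))
    (∑ i, efL μ t (fun x => t x j * t x i) y • (ContinuousLinearMap.proj i : (Fin k → ℝ) →L[ℝ] ℝ)) y :=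
  (aux_fderiv μ t h.ht Λ h.oΛ _ (h.hti j) (h.intt j) y hy).2

lemma Ltt_cont (h : EF μ t Λ Θ M Vinv) (i j) {y} (hy : y ∈ Λ) :
    ContinuousAt (efL μ t (fun x => t x i * t x j)) y :=
  (aux_fderiv μ t h.ht Λ h.oΛ _ ((h.hti i).mul (h.hti j)) (h.inttt i j) y hy).2.continuousAt

lemma M_fd (h : EF μ t Λ Θ M Vinv) {y} (hy : y ∈ Λ) : HasFDerivAt M
    (∑ i, efV μ t y i • (ContinuousLinearMap.proj i : (Fin k → ℝ) →L[ℝ] ℝ)) y := by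
  rw [h.M_eq]
  refine ((h.L_fd hy).log (h.L_pos hy).ne').congr_fderiv ?_
  rw [Finset.smul_sum]
  refine Finset.sum_congr rfl fun i _ => ?_
  rw [smul_smul, efV]; congr 1; field_simp

lemma M_fd' (h : EF μ t Λ Θ M Vinv) {y} (hy : y ∈ Λ) (j : Fin k) :
    fderiv ℝ M y (Pi.single j 1) = efV μ t y j := by
  rw [(h.M_fd hy).fderiv]
  simp [Pi.single_apply]

lemma V_Vinv (h : EF μ t Λ Θ M Vinv) {θ} (hθ : θ ∈ Θ) : efV μ t (Vinv θ) = θ := by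
  have := (h.hVinv θ hθ).2
  rw [← this]
  funext j
  rw [h.M_fd' (h.hVinv θ hθ).1 j, this]

lemma V_fd1 (h : EF μ t Λ Θ M Vinv) {y} (hy : y ∈ Λ) (j) : HasFDerivAt (fun y => efV μ t y j)
    (∑ i, efH μ t y i j • (ContinuousLinearMap.proj i : (Fin k → ℝ) →L[ℝ] ℝ)) y := by
  have h1 := (h.Lt_fd j hy).mul ((hasDerivAt_inv (h.L_pos hy).ne').comp_hasFDerivAt y (h.L_fd hy))
  unfold efV
  simp only [div_eq_mul_inv]
  refine h1.congr_fderiv ?_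
  rw [Finset.smul_sum, Finset.smul_sum, Finset.smul_sum, ← Finset.sum_add_distrib]
  refine Finset.sum_congr rfl fun i _ => ?_
  rw [smul_smul, smul_smul, smul_smul, ← add_smul]
  congr 1
  have := (h.L_pos hy).ne'
  simp only [efH, efV, Function.comp_apply]
  field_simp
  ring

def Hclm (A : Matrix (Fin k) (Fin k) ℝ) : (Fin k → ℝ) →L[ℝ] (Fin k → ℝ) :=
  ContinuousLinearMap.pi fun j => ∑ i, A i j • (ContinuousLinearMap.proj i : (Fin k → ℝ) →L[ℝ] ℝ)

lemma Hclm_apply (A : Matrix (Fin k) (Fin k) ℝ) (v) (j) : Hclm A v j = ∑ i, A i j * v i := by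
  simp [Hclm]

lemma V_fd (h : EF μ t Λ Θ M Vinv) {y} (hy : y ∈ Λ) :
    HasFDerivAt (efV μ t) (Hclm (efH μ t y)) y :=
  hasFDerivAt_pi.2 fun j => h.V_fd1 hy j

lemma V_cont (h : EF μ t Λ Θ M Vinv) {y} (hy : y ∈ Λ) : ContinuousAt (efV μ t) y :=
  (h.V_fd hy).continuousAt

lemma H_cont (h : EF μ t Λ Θ M Vinv) {y} (hy : y ∈ Λ) :
    ContinuousAt (fun y => Hclm (efH μ t y)) y := by
  have h1 : ∀ i j, ContinuousAt (fun y => efH μ t y i j) y := by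
    intro i j
    have hv := fun i => (h.V_fd1 hy i).continuousAt
    exact ((h.Ltt_cont j i hy).div ((h.L_fd hy).continuousAt) (h.L_pos hy).ne').sub ((hv i).mul (hv j))
  refine continuousAt_clm_apply.2 fun v => ?_
  refine continuousAt_pi.2 fun j => ?_
  simp only [Hclm_apply]
  exact tendsto_finsetSum _ fun i _ => (h1 i j).mul continuousAt_const

lemma V_sfd (h : EF μ t Λ Θ M Vinv) {y} (hy : y ∈ Λ) :
    HasStrictFDerivAt (efV μ t) (Hclm (efH μ t y)) y :=
  hasStrictFDerivAt_of_hasFDerivAt_of_continuousAt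
    (Filter.eventually_of_mem (h.oΛ.mem_nhds hy) fun z hz => h.V_fd hz) (h.H_cont hy)

end EF
end

section
open scoped Matrix
namespace EF
variable {S : Type*} [MeasurableSpace S] {k : ℕ} {μ : Measure S} {t : S → (Fin k → ℝ)}
    {Λ Θ : Set (Fin k → ℝ)} {M : (Fin k → ℝ) → ℝ} {Vinv : (Fin k → ℝ) → (Fin k → ℝ)}

lemma int_dot (h : EF μ t Λ Θ M Vinv) {y} (hy : y ∈ Λ) (v : Fin k → ℝ) :
    Integrable (fun x => (v ⬝ᵥ t x) * Real.exp (y ⬝ᵥ t x)) μ ∧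
    ∫ x, (v ⬝ᵥ t x) * Real.exp (y ⬝ᵥ t x) ∂μ = (v ⬝ᵥ efV μ t y) * efL μ t (fun _ => 1) y := by
  have h1 : (fun x => (v ⬝ᵥ t x) * Real.exp (y ⬝ᵥ t x)) =
      fun x => ∑ i, v i * (t x i * Real.exp (y ⬝ᵥ t x)) := by
    funext x; simp only [dotProduct, Finset.sum_mul, mul_assoc]
  rw [h1]
  have h2 := fun i => (h.intt i y hy).const_mul (v i)
  refine ⟨integrable_finsetSum _ fun i _ => h2 i, ?_⟩
  rw [integral_finsetSum _ fun i _ => h2 i, dotProduct, Finset.sum_mul]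
  refine Finset.sum_congr rfl fun i _ => ?_
  rw [integral_const_mul, efV]
  have := (h.L_pos hy).ne'
  have e : ∫ x, t x i * Real.exp (y ⬝ᵥ t x) ∂μ = efL μ t (fun x => t x i) y := rfl
  rw [e]; field_simp

lemma int_dot2 (h : EF μ t Λ Θ M Vinv) {y} (hy : y ∈ Λ) (v : Fin k → ℝ) :
    Integrable (fun x => (v ⬝ᵥ t x) ^ 2 * Real.exp (y ⬝ᵥ t x)) μ ∧
    ∫ x, (v ⬝ᵥ t x) ^ 2 * Real.exp (y ⬝ᵥ t x) ∂μ =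
      ∑ i, ∑ j, v i * v j * efL μ t (fun x => t x j * t x i) y := by
  have h1 : (fun x => (v ⬝ᵥ t x) ^ 2 * Real.exp (y ⬝ᵥ t x)) =
      fun x => ∑ i, ∑ j, v i * v j * ((t x j * t x i) * Real.exp (y ⬝ᵥ t x)) := by
    funext x
    rw [sq, dotProduct, Finset.sum_mul_sum, Finset.sum_mul]
    refine Finset.sum_congr rfl fun i _ => ?_
    rw [Finset.sum_mul]
    refine Finset.sum_congr rfl fun j _ => ?_
    ring
  rw [h1]
  have h2 := fun i j => (h.inttt j i y hy).const_mul (v i * v j)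
  refine ⟨integrable_finsetSum _ fun i _ => integrable_finsetSum _ fun j _ => h2 i j, ?_⟩
  rw [integral_finsetSum _ fun i _ => integrable_finsetSum _ fun j _ => h2 i j]
  refine Finset.sum_congr rfl fun i _ => ?_
  rw [integral_finsetSum _ fun j _ => h2 i j]
  refine Finset.sum_congr rfl fun j _ => ?_
  rw [integral_const_mul]; rfl

/-- the quadratic form of the Hessian -/
def efQ {k : ℕ} (A : Matrix (Fin k) (Fin k) ℝ) (v : Fin k → ℝ) : ℝ := ∑ i, ∑ j, v i * v j * A i j

lemma Hsymm (y : Fin k → ℝ) (i j) : efH μ t y i j = efH μ t y j i := by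
  unfold efH
  rw [mul_comm (efV μ t y i)]
  simp only [mul_comm]

lemma Q_eq (h : EF μ t Λ Θ M Vinv) {y} (hy : y ∈ Λ) (v : Fin k → ℝ) :
    Integrable (fun x => (v ⬝ᵥ t x - v ⬝ᵥ efV μ t y) ^ 2 * Real.exp (y ⬝ᵥ t x)) μ ∧
    ∫ x, (v ⬝ᵥ t x - v ⬝ᵥ efV μ t y) ^ 2 * Real.exp (y ⬝ᵥ t x) ∂μ =
      efQ (efH μ t y) v * efL μ t (fun _ => 1) y := by
  set c := v ⬝ᵥ efV μ t y with hc
  have h1 : (fun x => (v ⬝ᵥ t x - c) ^ 2 * Real.exp (y ⬝ᵥ t x)) =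
      fun x => (v ⬝ᵥ t x) ^ 2 * Real.exp (y ⬝ᵥ t x) - 2 * c * ((v ⬝ᵥ t x) * Real.exp (y ⬝ᵥ t x))
        + c ^ 2 * (1 * Real.exp (y ⬝ᵥ t x)) := by
    funext x; ring
  rw [h1]
  obtain ⟨a1, a2⟩ := h.int_dot hy v
  obtain ⟨b1, b2⟩ := h.int_dot2 hy v
  have c1 := h.int1 y hy
  refine ⟨(b1.sub (a1.const_mul _)).add (c1.const_mul _), ?_⟩
  rw [integral_add (by exact b1.sub (a1.const_mul _)) (c1.const_mul _), integral_sub b1 (a1.const_mul _),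
    integral_const_mul, integral_const_mul, a2, b2]
  have e : ∫ x, 1 * Real.exp (y ⬝ᵥ t x) ∂μ = efL μ t (fun _ => 1) y := rfl
  rw [e, ← hc]
  have hL := (h.L_pos hy).ne'
  have hcc : c ^ 2 = ∑ i, ∑ j, v i * v j * (efV μ t y i * efV μ t y j) := by
    rw [hc, sq, dotProduct, Finset.sum_mul_sum]
    refine Finset.sum_congr rfl fun i _ => Finset.sum_congr rfl fun j _ => by ring
  have : efQ (efH μ t y) v * efL μ t (fun _ => 1) y =
      ∑ i, ∑ j, v i * v j * efL μ t (fun x => t x j * t x i) y - c ^ 2 * efL μ t (fun _ => 1) y := by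
    rw [hcc, efQ]
    simp only [Finset.sum_mul]
    rw [← Finset.sum_sub_distrib]
    refine Finset.sum_congr rfl fun i _ => ?_
    rw [← Finset.sum_sub_distrib]
    refine Finset.sum_congr rfl fun j _ => ?_
    unfold efH
    field_simp
  rw [this]; ring

lemma Q_pos (h : EF μ t Λ Θ M Vinv) {y} (hy : y ∈ Λ) {v : Fin k → ℝ} (hv : v ≠ 0) :
    0 < efQ (efH μ t y) v := by
  obtain ⟨h1, h2⟩ := h.Q_eq hy v
  have hL := h.L_pos hy
  have h3 : 0 < ∫ x, (v ⬝ᵥ t x - v ⬝ᵥ efV μ t y) ^ 2 * Real.exp (y ⬝ᵥ t x) ∂μ := by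
    have hnn : 0 ≤ fun x => (v ⬝ᵥ t x - v ⬝ᵥ efV μ t y) ^ 2 * Real.exp (y ⬝ᵥ t x) :=
      fun x => by positivity
    refine lt_of_le_of_ne (integral_nonneg hnn) fun h0 => ?_
    rw [eq_comm, integral_eq_zero_iff_of_nonneg hnn h1] at h0
    refine h.nd v hv (v ⬝ᵥ efV μ t y) ?_
    filter_upwards [h0] with x hx
    have := (mul_eq_zero.1 hx).resolve_right (Real.exp_pos _).ne'
    have := pow_eq_zero_iff (two_ne_zero) |>.1 this
    linarith
  rw [h2] at h3
  exact (pos_iff_pos_of_mul_pos h3).2 hL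

lemma Q_nonneg (h : EF μ t Λ Θ M Vinv) {y} (hy : y ∈ Λ) (v : Fin k → ℝ) :
    0 ≤ efQ (efH μ t y) v := by
  by_cases hv : v = 0
  · simp [efQ, hv]
  · exact (h.Q_pos hy hv).le

lemma strict (h : EF μ t Λ Θ M Vinv) {y z} (hy : y ∈ Λ) (hz : z ∈ Λ) (hne : z ≠ y) :
    (z - y) ⬝ᵥ efV μ t y < M z - M y := by
  set v := z - y with hv
  have hv0 : v ≠ 0 := sub_ne_zero.2 hne
  set c := v ⬝ᵥ efV μ t y with hc
  obtain ⟨a1, a2⟩ := h.int_dot hy v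
  have b1 := h.int1 y hy
  have c1 := h.int1 z hz
  have e : ∫ x, 1 * Real.exp (y ⬝ᵥ t x) ∂μ = efL μ t (fun _ => 1) y := rfl
  have e' : ∫ x, 1 * Real.exp (z ⬝ᵥ t x) ∂μ = efL μ t (fun _ => 1) z := rfl
  have hfun : (fun x => Real.exp (y ⬝ᵥ t x) * (Real.exp (v ⬝ᵥ t x - c) - (v ⬝ᵥ t x - c + 1))) =
     fun x => Real.exp (-c) * (1 * Real.exp (z ⬝ᵥ t x)) - ((v ⬝ᵥ t x) * Real.exp (y ⬝ᵥ t x) +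
       (1 - c) * (1 * Real.exp (y ⬝ᵥ t x))) := by
    funext x
    have : Real.exp (z ⬝ᵥ t x) = Real.exp (y ⬝ᵥ t x) * Real.exp (v ⬝ᵥ t x) := by
      rw [← Real.exp_add, hv, sub_dotProduct]; congr 1; ring
    rw [this, sub_eq_add_neg (v ⬝ᵥ t x) c, Real.exp_add]; ring
  have hI : Integrable (fun x => Real.exp (y ⬝ᵥ t x) * (Real.exp (v ⬝ᵥ t x - c) - (v ⬝ᵥ t x - c + 1))) μ := by
    rw [hfun]; exact (c1.const_mul _).sub (a1.add (b1.const_mul _))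
  have hV : ∫ x, Real.exp (y ⬝ᵥ t x) * (Real.exp (v ⬝ᵥ t x - c) - (v ⬝ᵥ t x - c + 1)) ∂μ =
      Real.exp (-c) * efL μ t (fun _ => 1) z - efL μ t (fun _ => 1) y := by
    rw [hfun, integral_sub (c1.const_mul _) (by exact a1.add (b1.const_mul _)), integral_add a1 (b1.const_mul _),
      integral_const_mul (Real.exp (-c)), integral_const_mul (1 - c), a2, e, e', ← hc]; ring
  have hpos : 0 < ∫ x, Real.exp (y ⬝ᵥ t x) * (Real.exp (v ⬝ᵥ t x - c) - (v ⬝ᵥ t x - c + 1)) ∂μ := by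
    have hnn : 0 ≤ fun x => Real.exp (y ⬝ᵥ t x) * (Real.exp (v ⬝ᵥ t x - c) - (v ⬝ᵥ t x - c + 1)) :=
      fun x => mul_nonneg (Real.exp_pos _).le (sub_nonneg.2 (Real.add_one_le_exp _))
    refine lt_of_le_of_ne (integral_nonneg hnn) fun h0 => ?_
    rw [eq_comm, integral_eq_zero_iff_of_nonneg hnn hI] at h0
    refine h.nd v hv0 c ?_
    filter_upwards [h0] with x hx
    have h1 := (mul_eq_zero.1 hx).resolve_left (Real.exp_pos _).ne'
    by_contra hcc
    have := Real.add_one_lt_exp (sub_ne_zero.2 hcc)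
    linarith
  rw [hV, sub_pos] at hpos
  have := Real.log_lt_log (h.L_pos hy) hpos
  rw [Real.log_mul (Real.exp_pos _).ne' (h.L_pos hz).ne', Real.log_exp] at this
  rw [h.M_eq]; simp only; linarith

lemma le_M (h : EF μ t Λ Θ M Vinv) {y z} (hy : y ∈ Λ) (hz : z ∈ Λ) :
    (z - y) ⬝ᵥ efV μ t y ≤ M z - M y := by
  by_cases hne : z = y
  · simp [hne]
  · exact (h.strict hy hz hne).le

lemma V_inj (h : EF μ t Λ Θ M Vinv) : Set.InjOn (efV μ t) Λ := by
  intro y hy z hz hyz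
  by_contra hne
  have h1 := h.strict hy hz (Ne.symm hne)
  have h2 := h.strict hz hy hne
  rw [hyz] at h1
  rw [sub_dotProduct] at h1 h2
  linarith

lemma Vinv_V (h : EF μ t Λ Θ M Vinv) {y} (hy : y ∈ Λ) (hV : efV μ t y ∈ Θ) :
    Vinv (efV μ t y) = y :=
  h.V_inj (h.hVinv _ hV).1 hy (h.V_Vinv hV)

lemma Hclm_dot (A : Matrix (Fin k) (Fin k) ℝ) (v : Fin k → ℝ) : v ⬝ᵥ (Hclm A v) = efQ A v := by
  simp only [dotProduct, Hclm_apply, efQ, Finset.mul_sum]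
  rw [Finset.sum_comm]
  refine Finset.sum_congr rfl fun i _ => Finset.sum_congr rfl fun j _ => by ring

lemma Vinv_sfd (h : EF μ t Λ Θ M Vinv) {θ} (hθ : θ ∈ Θ) :
    ∃ D : (Fin k → ℝ) →L[ℝ] (Fin k → ℝ), HasStrictFDerivAt Vinv D θ := by
  have hy := (h.hVinv θ hθ).1
  set y := Vinv θ with hyd
  have hinj : Function.Injective (Hclm (efH μ t y) : (Fin k → ℝ) →ₗ[ℝ] (Fin k → ℝ)) := by
    rw [injective_iff_map_eq_zero]
    intro v hv
    by_contra hv0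
    have := h.Q_pos hy hv0
    rw [← Hclm_dot] at this
    have e : Hclm (efH μ t y) v = 0 := hv
    rw [e, dotProduct_zero] at this
    exact lt_irrefl _ this
  let e : (Fin k → ℝ) ≃L[ℝ] (Fin k → ℝ) :=
    (LinearEquiv.ofInjectiveEndo _ hinj).toContinuousLinearEquiv
  have he : (e : (Fin k → ℝ) →L[ℝ] (Fin k → ℝ)) = Hclm (efH μ t y) := by
    ext v; rfl
  have hs : HasStrictFDerivAt (efV μ t) (e : (Fin k → ℝ) →L[ℝ] (Fin k → ℝ)) y := by
    rw [he]; exact h.V_sfd hy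
  have hVy : efV μ t y = θ := h.V_Vinv hθ
  have hl := hs.to_localInverse
  have hr := hs.eventually_right_inverse
  rw [hVy] at hl hr
  have hc : Filter.Tendsto (hs.localInverse (efV μ t) e y) (nhds θ) (nhds y) := by
    have := hl.continuousAt.tendsto
    have h0 : hs.localInverse (efV μ t) e y θ = y := by
      rw [← hVy]; exact hs.localInverse_apply_image
    rwa [h0] at this
  refine ⟨_, hl.congr_of_eventuallyEq ?_⟩
  filter_upwards [hr, hc.eventually (h.oΛ.mem_nhds hy), h.oΘ.mem_nhds hθ] with η h1 h2 h3
  have := h.Vinv_V h2 (by rw [h1]; exact h3)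
  rw [h1] at this
  exact this.symm

lemma Vinv_cont (h : EF μ t Λ Θ M Vinv) : ContinuousOn Vinv Θ := fun θ hθ =>
  (h.Vinv_sfd hθ).choose_spec.hasFDerivAt.continuousAt.continuousWithinAt

/-- the Kullback Leibler divergence -/
def efK (M : (Fin k → ℝ) → ℝ) (Vinv : (Fin k → ℝ) → (Fin k → ℝ)) (η θ : Fin k → ℝ) : ℝ :=
  (Vinv η - Vinv θ) ⬝ᵥ η - M (Vinv η) + M (Vinv θ)

end EF
end

section
open scoped Matrix

lemma aux_frob {k : ℕ} (A : Matrix (Fin k) (Fin k) ℝ) (v : Fin k → ℝ) :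
    EF.efQ A v ≤ frobNorm A * ∑ i, v i ^ 2 := by
  unfold EF.efQ frobNorm
  have h1 : ∑ i, ∑ j, v i * v j * A i j = ∑ p : Fin k × Fin k, A p.1 p.2 * (v p.1 * v p.2) := by
    rw [Fintype.sum_prod_type]
    refine Finset.sum_congr rfl fun i _ => Finset.sum_congr rfl fun j _ => by ring
  have h2 : ∑ i, ∑ j, A i j ^ 2 = ∑ p : Fin k × Fin k, A p.1 p.2 ^ 2 := by
    rw [Fintype.sum_prod_type]
  have h3 : ∑ p : Fin k × Fin k, (v p.1 * v p.2) ^ 2 = (∑ i, v i ^ 2) ^ 2 := by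
    rw [Fintype.sum_prod_type, sq (∑ i, v i ^ 2), Finset.sum_mul_sum]
    refine Finset.sum_congr rfl fun i _ => Finset.sum_congr rfl fun j _ => by ring
  rw [h1, h2]
  have := Real.sum_mul_le_sqrt_mul_sqrt Finset.univ (fun p : Fin k × Fin k => A p.1 p.2)
    (fun p => v p.1 * v p.2)
  rw [h3, Real.sqrt_sq (Finset.sum_nonneg fun i _ => sq_nonneg _)] at this
  exact this

lemma aux_norm_sq_le {k : ℕ} (v : Fin k → ℝ) : ‖v‖ ^ 2 ≤ ∑ i, v i ^ 2 := by
  have h0 : 0 ≤ ∑ i, v i ^ 2 := Finset.sum_nonneg fun i _ => sq_nonneg _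
  have : ‖v‖ ≤ Real.sqrt (∑ i, v i ^ 2) := by
    rw [pi_norm_le_iff_of_nonneg (Real.sqrt_nonneg _)]
    intro i
    rw [Real.norm_eq_abs]
    apply Real.abs_le_sqrt
    exact Finset.single_le_sum (f := fun i => v i ^ 2) (fun i _ => sq_nonneg _) (Finset.mem_univ i)
  calc ‖v‖ ^ 2 ≤ (Real.sqrt (∑ i, v i ^ 2)) ^ 2 := by gcongr
    _ = _ := Real.sq_sqrt h0

def dotL {k : ℕ} : (Fin k → ℝ) →L[ℝ] (Fin k → ℝ) →L[ℝ] ℝ :=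
  ∑ i, (ContinuousLinearMap.proj i : (Fin k → ℝ) →L[ℝ] ℝ).smulRight
    (ContinuousLinearMap.proj i : (Fin k → ℝ) →L[ℝ] ℝ)

lemma dotL_apply {k : ℕ} (v w : Fin k → ℝ) : dotL v w = v ⬝ᵥ w := by
  simp [dotL, dotProduct]

lemma dotL_eq {k : ℕ} (v : Fin k → ℝ) :
    dotL v = ∑ i, v i • (ContinuousLinearMap.proj i : (Fin k → ℝ) →L[ℝ] ℝ) := by
  ext w; simp [dotL]

namespace EF
variable {S : Type*} [MeasurableSpace S] {k : ℕ} {μ : Measure S} {t : S → (Fin k → ℝ)}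
    {Λ Θ : Set (Fin k → ℝ)} {M : (Fin k → ℝ) → ℝ} {Vinv : (Fin k → ℝ) → (Fin k → ℝ)}

/-- the Legendre transform on `Θ` -/
def efI (M : (Fin k → ℝ) → ℝ) (Vinv : (Fin k → ℝ) → (Fin k → ℝ)) (η : Fin k → ℝ) : ℝ :=
  Vinv η ⬝ᵥ η - M (Vinv η)

lemma I_fd (h : EF μ t Λ Θ M Vinv) {η} (hη : η ∈ Θ) : HasFDerivAt (efI M Vinv) (dotL (Vinv η)) η := by
  obtain ⟨D, hD⟩ := h.Vinv_sfd hη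
  have hD := hD.hasFDerivAt
  have h1 := (h.M_fd (h.hVinv η hη).1).comp η hD
  have h2 := (dotL.hasFDerivAt.comp η hD).clm_apply (hasFDerivAt_id η)
  have h3 := h2.sub h1
  have : efI M Vinv = (fun y => (dotL ∘ Vinv) y (id y)) - M ∘ Vinv := by
    funext y; simp [efI, dotL_apply]
  rw [this]
  refine h3.congr_fderiv ?_
  ext w
  rw [← dotL_eq, h.V_Vinv hη]
  simp [dotL_apply, dotProduct_comm]

lemma I_eq (h : EF μ t Λ Θ M Vinv) {Iμ : (Fin k → ℝ) → ℝ}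
    (hIμ : ∀ θ, Iμ θ = sSup ((fun y => ∑ i, θ i * y i - M y) '' Λ)) {η} (hη : η ∈ Θ) :
    Iμ η = efI M Vinv η := by
  rw [hIμ]
  refine IsGreatest.csSup_eq ⟨⟨Vinv η, (h.hVinv η hη).1, ?_⟩, ?_⟩
  · simp [efI, dotProduct, mul_comm]
  · rintro _ ⟨y, hy, rfl⟩
    have := h.le_M (h.hVinv η hη).1 hy
    rw [h.V_Vinv hη, sub_dotProduct] at this
    have e : ∑ i, η i * y i = y ⬝ᵥ η := by simp [dotProduct, mul_comm]
    simp only [e, efI]; linarith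

lemma HessI_eq (h : EF μ t Λ Θ M Vinv) {Iμ : (Fin k → ℝ) → ℝ}
    (hIμ : ∀ θ, Iμ θ = sSup ((fun y => ∑ i, θ i * y i - M y) '' Λ)) {θ} (hθ : θ ∈ Θ)
    {D : (Fin k → ℝ) →L[ℝ] (Fin k → ℝ)} (hD : HasStrictFDerivAt Vinv D θ) (i j : Fin k) :
    fderiv ℝ (fun η => fderiv ℝ Iμ η (Pi.single j 1)) θ (Pi.single i 1) = D (Pi.single i 1) j := by
  have h1 : (fun η => fderiv ℝ Iμ η (Pi.single j 1)) =ᶠ[nhds θ] fun η => Vinv η j := by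
    filter_upwards [h.oΘ.mem_nhds hθ] with η hη
    have : Iμ =ᶠ[nhds η] efI M Vinv := by
      filter_upwards [h.oΘ.mem_nhds hη] with ζ hζ
      exact h.I_eq hIμ hζ
    rw [this.fderiv_eq, (h.I_fd hη).fderiv, dotL_apply]
    simp
  rw [h1.fderiv_eq]
  have := (hasFDerivAt_pi'.1 hD.hasFDerivAt) j
  rw [this.fderiv]
  simp

lemma K_bound (h : EF μ t Λ Θ M Vinv) {Iμ : (Fin k → ℝ) → ℝ}
    (hIμ : ∀ θ, Iμ θ = sSup ((fun y => ∑ i, θ i * y i - M y) '' Λ)) {θ} (hθ : θ ∈ Θ)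
    (A : Matrix (Fin k) (Fin k) ℝ)
    (hA : ∀ i j, A i j = fderiv ℝ (fun η => fderiv ℝ Iμ η (Pi.single j 1)) θ (Pi.single i 1))
    (ε : ℝ) (hε : 0 < ε) :
    ∀ᶠ η in nhds θ, efK M Vinv η θ ≤ ((1 / 2) * frobNorm A + ε) * ∑ i, (η i - θ i) ^ 2 := by
  obtain ⟨D, hD⟩ := h.Vinv_sfd hθ
  have h1 := aux_taylor2 (efI M Vinv) (fun z => dotL (Vinv z)) (dotL ∘L D) θ
    (Filter.eventually_of_mem (h.oΘ.mem_nhds hθ) fun z hz => h.I_fd hz)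
    (dotL.hasFDerivAt.comp θ hD.hasFDerivAt) ε hε
  filter_upwards [h1] with η hη
  have h2 := (le_abs_self _).trans hη
  have h3 := aux_norm_sq_le (η - θ)
  have h4 : (dotL ∘L D) (η - θ) (η - θ) = efQ A (η - θ) := by
    rw [ContinuousLinearMap.comp_apply, dotL_apply]
    have : ∀ v, D v = Hclm A v := by
      intro v
      have : D = Hclm A := by
        refine ContinuousLinearMap.coe_injective (LinearMap.pi_ext' fun i => LinearMap.ext_ring ?_)
        funext j
        simp [Hclm_apply, hA, h.HessI_eq hIμ hθ hD, Pi.single_apply]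
      rw [this]
    rw [this, dotProduct_comm, Hclm_dot]
  have h5 := aux_frob A (η - θ)
  rw [h4] at h2
  simp only [Pi.sub_apply] at h3 h5
  have h6 : efK M Vinv η θ = efI M Vinv η - efI M Vinv θ - dotL (Vinv θ) (η - θ) := by
    simp only [efK, efI, dotL_apply, sub_dotProduct, dotProduct_sub]; ring
  rw [h6]
  nlinarith

lemma HessM_eq (h : EF μ t Λ Θ M Vinv) {y} (hy : y ∈ Λ) (i j : Fin k) :
    fderiv ℝ (fun y => fderiv ℝ M y (Pi.single j 1)) y (Pi.single i 1) = efH μ t y i j := by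
  have h1 : (fun z => fderiv ℝ M z (Pi.single j 1)) =ᶠ[nhds y] fun z => efV μ t z j := by
    filter_upwards [h.oΛ.mem_nhds hy] with η hη
    exact h.M_fd' hη j
  rw [h1.fderiv_eq, (h.V_fd1 hy j).fderiv]
  simp [Pi.single_apply]

lemma M_taylor (h : EF μ t Λ Θ M Vinv) {y} (hy : y ∈ Λ) (u : Fin k → ℝ) (ε : ℝ) (hε : 0 < ε) :
    ∃ l₀ > 0, ∀ l, 0 < l → l ≤ l₀ → y + l • u ∈ Λ ∧
      M (y + l • u) - M y - l * (u ⬝ᵥ efV μ t y) ≤ l ^ 2 * (efQ (efH μ t y) u + ε) / 2 := by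
  have h1 := aux_taylor2 M (fun z => dotL (efV μ t z)) (dotL ∘L (Hclm (efH μ t y))) y
    (Filter.eventually_of_mem (h.oΛ.mem_nhds hy) fun z hz => by rw [dotL_eq]; exact h.M_fd hz)
    (dotL.hasFDerivAt.comp y (h.V_fd hy)) (ε / 2 / (‖u‖ ^ 2 + 1)) (by positivity)
  have hc : Filter.Tendsto (fun l : ℝ => y + l • u) (nhds 0) (nhds y) := by
    have : Continuous fun l : ℝ => y + l • u := by fun_prop
    simpa using this.tendsto 0
  obtain ⟨r, hr, hball⟩ := Metric.eventually_nhds_iff_ball.1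
    (hc.eventually (h1.and (h.oΛ.mem_nhds hy)))
  refine ⟨r / 2, by positivity, fun l hl hlr => ?_⟩
  obtain ⟨h2, h3⟩ := hball l (by rw [Metric.mem_ball, dist_zero_right, Real.norm_eq_abs, abs_of_pos hl]; linarith)
  refine ⟨h3, ?_⟩
  have h4 := (le_abs_self _).trans h2
  rw [add_sub_cancel_left] at h4
  have e1 : (dotL ∘L (Hclm (efH μ t y))) (l • u) (l • u) = l ^ 2 * efQ (efH μ t y) u := by
    rw [← Hclm_dot, ContinuousLinearMap.comp_apply, dotL_apply, map_smul, smul_dotProduct,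
      dotProduct_smul, dotProduct_comm]
    simp only [smul_eq_mul]; ring
  have e2 : dotL (efV μ t y) (l • u) = l * (u ⬝ᵥ efV μ t y) := by
    rw [dotL_apply, dotProduct_smul, dotProduct_comm, smul_eq_mul]
  have e3 : ε / 2 / (‖u‖ ^ 2 + 1) * ‖l • u‖ ^ 2 ≤ l ^ 2 * (ε / 2) := by
    rw [norm_smul, mul_pow, Real.norm_eq_abs, sq_abs]
    have : ε / 2 / (‖u‖ ^ 2 + 1) * ‖u‖ ^ 2 ≤ ε / 2 := by
      rw [div_mul_eq_mul_div, div_le_iff₀ (by positivity)]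
      nlinarith [sq_nonneg ‖u‖]
    nlinarith [sq_nonneg l]
  rw [e1] at h4
  simp only [e2] at h4
  nlinarith

end EF

lemma aux_Q_mulVec {k : ℕ} (A : Matrix (Fin k) (Fin k) ℝ) (v : Fin k → ℝ) :
    EF.efQ A v = v ⬝ᵥ (A *ᵥ v) := by
  simp only [EF.efQ, dotProduct, Matrix.mulVec, Finset.mul_sum]
  refine Finset.sum_congr rfl fun i _ => Finset.sum_congr rfl fun j _ => by ring

lemma aux_sumsq_pos {k : ℕ} {v : Fin k → ℝ} (hv : v ≠ 0) : 0 < ∑ i, v i ^ 2 := by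
  have := aux_norm_sq_le v
  have h4 : 0 < ‖v‖ := norm_pos_iff.2 hv
  nlinarith

lemma aux_eig_Q {k : ℕ} {A : Matrix (Fin k) (Fin k) ℝ} {v : Fin k → ℝ} {r : ℝ}
    (h : A *ᵥ v = r • v) : EF.efQ A v = r * ∑ i, v i ^ 2 := by
  rw [aux_Q_mulVec, h, dotProduct_smul, smul_eq_mul, dotProduct]
  simp only [sq]

lemma aux_maxEig {k : ℕ} (A : Matrix (Fin k) (Fin k) ℝ) (hs : ∀ i j, A i j = A j i)
    (v : Fin k → ℝ) : EF.efQ A v ≤ maxEig A * ∑ i, v i ^ 2 := by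
  by_cases hv : v = 0
  · simp [hv, EF.efQ]
  have hA : A.IsHermitian := by
    ext i j; simp [hs i j]
  have hsym : (Matrix.toEuclideanLin A).IsSymmetric := Matrix.isSymmetric_toEuclideanLin_iff.2 hA
  have hre : ∀ x : EuclideanSpace ℝ (Fin k), RCLike.re (inner ℝ (Matrix.toEuclideanLin A x) x) / ‖x‖ ^ 2
      = EF.efQ A x.ofLp / ∑ i, x i ^ 2 := by
    intro x
    rw [EuclideanSpace.norm_sq_eq]
    simp only [Real.norm_eq_abs, sq_abs, aux_Q_mulVec]
    congr 1
  have hne : Nontrivial (EuclideanSpace ℝ (Fin k)) := by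
    refine ⟨⟨WithLp.toLp 2 v, 0, fun h => hv ?_⟩⟩
    have := congrArg WithLp.ofLp h
    simpa using this
  have hE := hsym.hasEigenvalue_iSup_of_finiteDimensional
  obtain ⟨w, hw⟩ := hE.exists_hasEigenvector
  have hw1 := hw.apply_eq_smul
  have hw2 := hw.2
  have hb : BddAbove {r : ℝ | ∃ v : Fin k → ℝ, v ≠ 0 ∧ A.mulVec v = r • v} := by
    refine ⟨frobNorm A, ?_⟩
    rintro r ⟨u, hu, h⟩
    have := aux_frob A u
    rw [aux_eig_Q h] at this
    exact le_of_mul_le_mul_right this (aux_sumsq_pos hu)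
  have h1 : (⨆ x : { x : EuclideanSpace ℝ (Fin k) // x ≠ 0 },
      RCLike.re (inner ℝ (Matrix.toEuclideanLin A x) (x : EuclideanSpace ℝ (Fin k))) / ‖(x : EuclideanSpace ℝ (Fin k))‖ ^ 2) ≤ maxEig A := by
    refine le_csSup hb ⟨w.ofLp, ?_, ?_⟩
    · intro h; apply hw2; ext i; simp [h]
    · exact congrArg WithLp.ofLp hw1
  have h2 : EF.efQ A v / ∑ i, v i ^ 2 ≤ maxEig A := by
    refine le_trans ?_ h1
    have hx : WithLp.toLp 2 v ≠ (0 : EuclideanSpace ℝ (Fin k)) := fun h => hv (by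
      have := congrArg WithLp.ofLp h
      simpa using this)
    have := le_ciSup (f := fun x : { x : EuclideanSpace ℝ (Fin k) // x ≠ 0 } =>
      RCLike.re (inner ℝ (Matrix.toEuclideanLin A x) (x : EuclideanSpace ℝ (Fin k))) / ‖(x : EuclideanSpace ℝ (Fin k))‖ ^ 2)
      ?_ ⟨WithLp.toLp 2 v, hx⟩
    · rw [hre] at this
      exact this
    · refine ⟨frobNorm A, ?_⟩
      rintro _ ⟨⟨x, hx⟩, rfl⟩
      simp only
      rw [hre]
      have hx' : x.ofLp ≠ 0 := fun h => hx (by ext i; simp [h])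
      rw [div_le_iff₀ (aux_sumsq_pos hx')]
      exact aux_frob A x.ofLp
  rwa [div_le_iff₀ (aux_sumsq_pos hv)] at h2

lemma aux_maxEig_nonneg {k : ℕ} (A : Matrix (Fin k) (Fin k) ℝ) (hp : ∀ v, 0 ≤ EF.efQ A v) :
    0 ≤ maxEig A := by
  apply Real.sSup_nonneg
  rintro r ⟨v, hv, h⟩
  have h1 := hp v
  rw [aux_eig_Q h] at h1
  exact nonneg_of_mul_nonneg_left h1 (aux_sumsq_pos hv)
end

section
open scoped Matrix

def efP {S : Type*} [MeasurableSpace S] {k : ℕ} (μ : Measure S) (t : S → (Fin k → ℝ))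
    (M : (Fin k → ℝ) → ℝ) (y : Fin k → ℝ) : Measure S :=
  μ.withDensity fun x => ENNReal.ofReal (Real.exp (y ⬝ᵥ t x - M y))

namespace EF
variable {S : Type*} [MeasurableSpace S] {k : ℕ} {μ : Measure S} {t : S → (Fin k → ℝ)}
    {Λ Θ : Set (Fin k → ℝ)} {M : (Fin k → ℝ) → ℝ} {Vinv : (Fin k → ℝ) → (Fin k → ℝ)}

lemma meas_dens (h : EF μ t Λ Θ M Vinv) (y : Fin k → ℝ) :
    Measurable fun x => ENNReal.ofReal (Real.exp (y ⬝ᵥ t x - M y)) :=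
  ((aux_meas_exp t h.ht y).sub_const _).exp.ennreal_ofReal

lemma exp_M (h : EF μ t Λ Θ M Vinv) {y} (hy : y ∈ Λ) : Real.exp (M y) = efL μ t (fun _ => 1) y := by
  rw [h.M_eq, Real.exp_log (h.L_pos hy)]

lemma P_int (h : EF μ t Λ Θ M Vinv) {y} (hy : y ∈ Λ) (f : S → ℝ) :
    ∫ x, f x ∂(efP μ t M y) = (∫ x, f x * Real.exp (y ⬝ᵥ t x) ∂μ) / efL μ t (fun _ => 1) y := by
  rw [efP, integral_withDensity_eq_integral_toReal_smul (h.meas_dens y) (by simp),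
    ← integral_div]
  refine integral_congr_ae (Filter.Eventually.of_forall fun x => ?_)
  simp only [smul_eq_mul]
  rw [ENNReal.toReal_ofReal (Real.exp_pos _).le, Real.exp_sub, h.exp_M hy]
  ring

lemma P_integrable (h : EF μ t Λ Θ M Vinv) {y} (hy : y ∈ Λ) (f : S → ℝ) :
    Integrable f (efP μ t M y) ↔ Integrable (fun x => f x * Real.exp (y ⬝ᵥ t x)) μ := by
  rw [efP, integrable_withDensity_iff (h.meas_dens y) (by simp)]
  have : (fun x => f x * (ENNReal.ofReal (Real.exp (y ⬝ᵥ t x - M y))).toReal) =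
      fun x => (f x * Real.exp (y ⬝ᵥ t x)) * (efL μ t (fun _ => 1) y)⁻¹ := by
    funext x
    rw [ENNReal.toReal_ofReal (Real.exp_pos _).le, Real.exp_sub, h.exp_M hy]
    ring
  rw [this]
  exact integrable_mul_const_iff (isUnit_iff_ne_zero.2 (inv_ne_zero (h.L_pos hy).ne')) _

lemma P_prob (h : EF μ t Λ Θ M Vinv) {y} (hy : y ∈ Λ) : IsProbabilityMeasure (efP μ t M y) := by
  constructor
  have hI : Integrable (fun _ : S => (1:ℝ)) (efP μ t M y) := (h.P_integrable hy _).2 (h.int1 y hy)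
  have h1 := h.P_int hy (fun _ => 1)
  have e : ∫ x, 1 * Real.exp (y ⬝ᵥ t x) ∂μ = efL μ t (fun _ => 1) y := rfl
  rw [e, div_self (h.L_pos hy).ne', integral_const, smul_eq_mul, mul_one, measureReal_def] at h1
  rw [← ENNReal.toReal_eq_one_iff]; exact h1

lemma P_mean (h : EF μ t Λ Θ M Vinv) {y} (hy : y ∈ Λ) (i) : Integrable (fun x => t x i) (efP μ t M y) ∧
    ∫ x, t x i ∂(efP μ t M y) = efV μ t y i :=
  ⟨(h.P_integrable hy _).2 (h.intt i y hy), h.P_int hy _⟩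

lemma P_exp (h : EF μ t Λ Θ M Vinv) {y} (hy : y ∈ Λ) (u : Fin k → ℝ) (c l : ℝ) (hl : y + l • u ∈ Λ) :
    Integrable (fun x => Real.exp (l * (u ⬝ᵥ t x - c))) (efP μ t M y) ∧
    ∫ x, Real.exp (l * (u ⬝ᵥ t x - c)) ∂(efP μ t M y) = Real.exp (M (y + l • u) - M y - l * c) := by
  have e : (fun x => Real.exp (l * (u ⬝ᵥ t x - c)) * Real.exp (y ⬝ᵥ t x)) =
      fun x => Real.exp (-(l * c)) * (1 * Real.exp ((y + l • u) ⬝ᵥ t x)) := by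
    funext x
    rw [one_mul, ← Real.exp_add, ← Real.exp_add, add_dotProduct, smul_dotProduct, smul_eq_mul]
    congr 1; ring
  constructor
  · rw [h.P_integrable hy, e]
    exact (h.int1 _ hl).const_mul _
  · rw [h.P_int hy, e, integral_const_mul]
    have e2 : ∫ x, 1 * Real.exp ((y + l • u) ⬝ᵥ t x) ∂μ = efL μ t (fun _ => 1) (y + l • u) := rfl
    rw [e2, ← h.exp_M hy, ← h.exp_M hl, ← Real.exp_add, ← Real.exp_sub]
    congr 1; ring

lemma scalar_lil (h : EF μ t Λ Θ M Vinv) {y} (hy : y ∈ Λ) (u : Fin k → ℝ) (c : ℝ)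
    (hc : 2 * efQ (efH μ t y) u < c) :
    haveI := h.P_prob hy
    ∀ᵐ ω ∂(Measure.infinitePi (fun _ : ℕ => efP μ t M y)), ∀ᶠ n : ℕ in Filter.atTop,
      ∑ i ∈ Finset.range n, (u ⬝ᵥ t (ω i) - u ⬝ᵥ efV μ t y) ≤ Real.sqrt (c * (n * Log2 n)) := by
  haveI := h.P_prob hy
  have hQ := h.Q_nonneg hy u
  set ε := (c - 2 * efQ (efH μ t y) u) / 4 with hε
  have hε0 : 0 < ε := by rw [hε]; linarith
  obtain ⟨l₀, hl₀, hl⟩ := h.M_taylor hy u ε hε0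
  set d := u ⬝ᵥ efV μ t y with hd
  let P := Measure.infinitePi (fun _ : ℕ => efP μ t M y)
  have hm1 : Measurable (fun x => u ⬝ᵥ t x - d) := (aux_meas_exp t h.ht u).sub_const _
  have hmp : ∀ i, MeasurePreserving (fun ω : ℕ → S => ω i) P (efP μ t M y) := fun i =>
    measurePreserving_eval_infinitePi (fun _ : ℕ => efP μ t M y) i
  have hme : ∀ l : ℝ, Measurable (fun x => Real.exp (l * (u ⬝ᵥ t x - d))) := fun l =>
    (hm1.const_mul l).exp
  have hmgf : ∀ l, 0 < l → l ≤ l₀ → ∀ i, mgf (fun ω : ℕ → S => u ⬝ᵥ t (ω i) - d) P l =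
      Real.exp (M (y + l • u) - M y - l * d) := by
    intro l h1 h2 i
    rw [← (h.P_exp hy u d l (hl l h1 h2).1).2, ← (hmp i).map_eq, integral_map (hmp i).aemeasurable]
    · rfl
    · exact (hme l).aestronglyMeasurable
  refine aux_lil P (fun i ω => u ⬝ᵥ t (ω i) - d) (fun i => hm1.comp (measurable_pi_apply i)) ?_
    (efQ (efH μ t y) u + ε) l₀ (by linarith) hl₀ ?_ ?_ ?_ c (by rw [hε]; linarith)
  · exact iIndepFun_infinitePi (P := fun _ : ℕ => efP μ t M y) (X := fun _ x => u ⬝ᵥ t x - d)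
      (fun _ => hm1)
  · intro l h1 h2 i
    exact (hmp i).integrable_comp_of_integrable (h.P_exp hy u d l (hl l h1 h2).1).1
  · intro l h1 h2 i
    rw [hmgf l h1 h2 i]
    apply Real.one_le_exp
    have := h.le_M hy (hl l h1 h2).1
    rw [add_sub_cancel_left, smul_dotProduct, smul_eq_mul, ← hd] at this
    linarith
  · intro l h1 h2 i
    rw [hmgf l h1 h2 i]
    exact Real.exp_le_exp.2 (hl l h1 h2).2

end EF

lemma aux_sphere_cover {k : ℕ} (z : ℕ → (Fin k → ℝ)) (A : Matrix (Fin k) (Fin k) ℝ)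
    (hs : ∀ i j, A i j = A j i) (hlam : 0 ≤ maxEig A) (D : Set (Fin k → ℝ)) (hD : Dense D)
    (h : ∀ u ∈ D, ∀ c : ℚ, 2 * EF.efQ A u < c → ∀ᶠ n in Filter.atTop, u ⬝ᵥ z n ≤ Real.sqrt c)
    (ε : ℝ) (hε : 0 < ε) :
    ∀ᶠ n in Filter.atTop, ∑ i, z n i ^ 2 ≤ 2 * maxEig A + ε := by
  set r0 := Real.sqrt (2 * maxEig A + ε) with hr0
  have hr0p : 0 < r0 := Real.sqrt_pos.2 (by linarith)
  let K : Set (Fin k → ℝ) := {e | ∑ i, e i ^ 2 = 1}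
  have hK : IsCompact K := by
    refine Metric.isCompact_of_isClosed_isBounded ?_ ?_
    · exact isClosed_eq (by fun_prop) continuous_const
    · refine (Metric.isBounded_closedBall (x := (0 : Fin k → ℝ)) (r := 1)).subset fun e he => ?_
      rw [mem_closedBall_zero_iff]
      have := aux_norm_sq_le e
      have he : ∑ i, e i ^ 2 = 1 := he
      rw [he] at this
      nlinarith [norm_nonneg e]
  have key : ∀ e ∈ K, ∃ s ∈ nhdsWithin e K, ∀ᶠ n in Filter.atTop,
      ∀ r, r0 ≤ r → ∀ e' ∈ s, z n ≠ r • e' := by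
    intro e he
    have he : ∑ i, e i ^ 2 = 1 := he
    have hopen : IsOpen {u : Fin k → ℝ | Real.sqrt (2 * maxEig A * ∑ i, u i ^ 2) < r0 * (u ⬝ᵥ e)} := by
      refine isOpen_lt (by fun_prop) ?_
      unfold dotProduct; fun_prop
    have hne : ({u : Fin k → ℝ | Real.sqrt (2 * maxEig A * ∑ i, u i ^ 2) < r0 * (u ⬝ᵥ e)}).Nonempty := by
      refine ⟨e, ?_⟩
      have : e ⬝ᵥ e = 1 := by rw [← he]; simp [dotProduct, sq]
      show Real.sqrt (2 * maxEig A * ∑ i, e i ^ 2) < r0 * (e ⬝ᵥ e)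
      rw [he, this, mul_one, mul_one, hr0]
      exact Real.sqrt_lt_sqrt (by linarith) (by linarith)
    obtain ⟨u, hu, huD⟩ := hD.inter_open_nonempty _ hopen hne
    have hu : Real.sqrt (2 * maxEig A * ∑ i, u i ^ 2) < r0 * (u ⬝ᵥ e) := hu
    have hup : 0 < r0 * (u ⬝ᵥ e) := lt_of_le_of_lt (Real.sqrt_nonneg _) hu
    obtain ⟨c, hc1, hc2⟩ := exists_rat_btwn ((Real.sqrt_lt' hup).1 hu)
    have hc : 2 * EF.efQ A u < c := by
      have := aux_maxEig A hs u
      nlinarith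
    have hcs : Real.sqrt c < r0 * (u ⬝ᵥ e) := (Real.sqrt_lt' hup).2 hc2
    refine ⟨{e' | Real.sqrt c < r0 * (u ⬝ᵥ e')}, mem_nhdsWithin_of_mem_nhds ?_, ?_⟩
    · refine IsOpen.mem_nhds (isOpen_lt continuous_const ?_) hcs
      unfold dotProduct; fun_prop
    · filter_upwards [h u huD c hc] with n hn r hr e' he' heq
      rw [heq, dotProduct_smul, smul_eq_mul] at hn
      have he' : Real.sqrt c < r0 * (u ⬝ᵥ e') := he'
      have h1 : 0 < u ⬝ᵥ e' := by
        have := lt_of_le_of_lt (Real.sqrt_nonneg _) he'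
        exact (pos_iff_pos_of_mul_pos this).1 hr0p
      nlinarith
  have hall : ∀ᶠ n in Filter.atTop, ∀ r, r0 ≤ r → ∀ e' ∈ K, z n ≠ r • e' := by
    refine hK.induction_on (p := fun s => ∀ᶠ n in Filter.atTop, ∀ r, r0 ≤ r → ∀ e' ∈ s, z n ≠ r • e') ?_ ?_ ?_ key
    · simp
    · intro s t hst ht
      filter_upwards [ht] with n hn r hr e' he'
      exact hn r hr e' (hst he')
    · intro s t hs ht
      filter_upwards [hs, ht] with n h1 h2 r hr e' he'
      rcases he' with he' | he'
      · exact h1 r hr e' he'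
      · exact h2 r hr e' he'
  filter_upwards [hall] with n hn
  by_contra hlt
  push Not at hlt
  have hr : r0 < Real.sqrt (∑ i, z n i ^ 2) := Real.sqrt_lt_sqrt (by linarith) hlt
  have hp : 0 < ∑ i, z n i ^ 2 := by linarith
  have hsp := Real.sqrt_pos.2 hp
  refine hn _ hr.le ((Real.sqrt (∑ i, z n i ^ 2))⁻¹ • z n) ?_ ?_
  · show ∑ i, ((Real.sqrt (∑ i, z n i ^ 2))⁻¹ • z n) i ^ 2 = 1
    simp only [Pi.smul_apply, smul_eq_mul, mul_pow, ← Finset.mul_sum, inv_pow]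
    rw [Real.sq_sqrt hp.le, inv_mul_cancel₀ hp.ne']
  · rw [smul_smul, mul_inv_cancel₀ hsp.ne', one_smul]
end

section
open scoped Matrix

namespace EF
variable {S : Type*} [MeasurableSpace S] {k : ℕ} {μ : Measure S} {t : S → (Fin k → ℝ)}
    {Λ Θ : Set (Fin k → ℝ)} {M : (Fin k → ℝ) → ℝ} {Vinv : (Fin k → ℝ) → (Fin k → ℝ)}

lemma P_change (h : EF μ t Λ Θ M Vinv) (y z : Fin k → ℝ) :
    efP μ t M y = (efP μ t M z).withDensity
      (fun x => ENNReal.ofReal (Real.exp ((y - z) ⬝ᵥ t x - M y + M z))) := by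
  rw [efP, efP, ← withDensity_mul _ (h.meas_dens z)]
  · congr 1
    funext x
    rw [Pi.mul_apply, ← ENNReal.ofReal_mul (Real.exp_pos _).le, ← Real.exp_add, sub_dotProduct]
    congr 2; ring
  · exact (((aux_meas_exp t h.ht (y - z)).sub_const _).add_const _).exp.ennreal_ofReal

lemma P_ac (h : EF μ t Λ Θ M Vinv) (y z : Fin k → ℝ) : efP μ t M y ≪ efP μ t M z := by
  rw [h.P_change y z]; exact withDensity_absolutelyContinuous _ _

lemma kl_eq (h : EF μ t Λ Θ M Vinv) {η θ} (hη : η ∈ Θ) (hθ : θ ∈ Θ) :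
    klDiv' (efP μ t M (Vinv η)) (efP μ t M (Vinv θ)) = efK M Vinv η θ := by
  haveI := h.P_prob (h.hVinv θ hθ).1
  haveI := h.P_prob (h.hVinv η hη).1
  have hm : Measurable (fun x => ENNReal.ofReal
      (Real.exp ((Vinv η - Vinv θ) ⬝ᵥ t x - M (Vinv η) + M (Vinv θ)))) :=
    (((aux_meas_exp t h.ht (Vinv η - Vinv θ)).sub_const _).add_const _).exp.ennreal_ofReal
  have h1 := Measure.rnDeriv_withDensity (efP μ t M (Vinv θ)) hm
  rw [← h.P_change] at h1
  have h2 := (h.P_ac (Vinv η) (Vinv θ)).ae_le h1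
  rw [klDiv']
  have h3 : ∫ x, Real.log ((efP μ t M (Vinv η)).rnDeriv (efP μ t M (Vinv θ)) x).toReal
      ∂(efP μ t M (Vinv η)) = ∫ x, (∑ i, (Vinv η - Vinv θ) i * t x i) + (- M (Vinv η) + M (Vinv θ))
      ∂(efP μ t M (Vinv η)) := by
    refine integral_congr_ae ?_
    filter_upwards [h2] with x hx
    rw [hx, ENNReal.toReal_ofReal (Real.exp_pos _).le, Real.log_exp, dotProduct]; ring
  rw [h3, integral_add, integral_finsetSum]
  · simp_rw [integral_const_mul, (h.P_mean (h.hVinv η hη).1 _).2, h.V_Vinv hη]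
    simp [efK, dotProduct]; ring
  · exact fun i _ => (h.P_mean (h.hVinv η hη).1 i).1.const_mul _
  · exact integrable_finsetSum _ fun i _ => (h.P_mean (h.hVinv η hη).1 i).1.const_mul _
  · exact integrable_const _

end EF

lemma aux_hyper {k : ℕ} (v : Fin k → ℝ) (hv : v ≠ 0) (c : ℝ) (s : Set (Fin k → ℝ))
    (hs : s ⊆ {y | v ⬝ᵥ y = c}) : ¬ (interior (convexHull ℝ s)).Nonempty := by
  rintro ⟨θ, hθ⟩
  have hc : Convex ℝ {y : Fin k → ℝ | v ⬝ᵥ y = c} := by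
    intro x hx y hy a b ha hb hab
    simp only [Set.mem_setOf_eq, dotProduct_add, dotProduct_smul, smul_eq_mul] at *
    rw [hx, hy, ← add_mul, hab, one_mul]
  have h1 : interior (convexHull ℝ s) ⊆ {y | v ⬝ᵥ y = c} :=
    interior_subset.trans (convexHull_min hs hc)
  have hcont : Continuous (fun r : ℝ => θ + r • v) := by fun_prop
  have h2 : ∀ᶠ r : ℝ in nhds 0, θ + r • v ∈ interior (convexHull ℝ s) := by
    apply hcont.continuousAt.eventually_mem
    simpa using isOpen_interior.mem_nhds hθ
  have h3 : ∀ᶠ r : ℝ in nhdsWithin 0 {0}ᶜ, θ + r • v ∈ interior (convexHull ℝ s) :=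
    h2.filter_mono nhdsWithin_le_nhds
  obtain ⟨r, hr, hr0⟩ := (h3.and self_mem_nhdsWithin).exists
  have e1 := h1 hr
  have e2 := h1 hθ
  simp only [Set.mem_setOf_eq, dotProduct_add, dotProduct_smul, smul_eq_mul] at e1 e2
  have e3 : r * (v ⬝ᵥ v) = 0 := by linarith
  rcases mul_eq_zero.1 e3 with h | h
  · exact hr0 h
  · exact hv (dotProduct_self_eq_zero.1 h)

lemma aux_EF {S : Type*} [MeasurableSpace S] (k : ℕ) (μ : Measure S) [SigmaFinite μ]
    (t : S → (Fin k → ℝ)) (ht : Measurable t) (Λ : Set (Fin k → ℝ))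
    (hΛ : Λ = {y | ∫⁻ x, ENNReal.ofReal (Real.exp (∑ i, y i * t x i)) ∂μ < ⊤})
    (M : (Fin k → ℝ) → ℝ)
    (hM : ∀ y, M y = Real.log (∫⁻ x, ENNReal.ofReal (Real.exp (∑ i, y i * t x i)) ∂μ).toReal)
    (Θ : Set (Fin k → ℝ))
    (hΘ : Θ = interior (convexHull ℝ
      {y | ∀ U : Set (Fin k → ℝ), IsOpen U → y ∈ U → 0 < μ.map t U}))
    (hA : Θ.Nonempty) (hBopen : IsOpen Λ)
    (Vinv : (Fin k → ℝ) → (Fin k → ℝ))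
    (hVinv : ∀ θ ∈ Θ, Vinv θ ∈ Λ ∧ (fun i => fderiv ℝ M (Vinv θ) (Pi.single i 1)) = θ) :
    EF μ t Λ Θ M Vinv where
  sf := inferInstance
  ht := ht
  ne := by
    rintro rfl
    rw [hΘ] at hA
    have : {y | ∀ U : Set (Fin k → ℝ), IsOpen U → y ∈ U → 0 < (0 : Measure S).map t U} = ∅ := by
      ext y
      simp only [Measure.map_zero, Set.mem_setOf_eq, Set.mem_empty_iff_false, iff_false]
      intro hh
      simpa using hh Set.univ isOpen_univ trivial
    rw [this] at hA
    simp at hA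
  hintg := by
    intro y hy
    rw [hΛ] at hy
    refine ⟨(aux_meas_exp t ht y).exp.aestronglyMeasurable, ?_⟩
    rw [hasFiniteIntegral_iff_norm]
    have : ∀ x, ‖Real.exp (y ⬝ᵥ t x)‖ = Real.exp (∑ i, y i * t x i) := fun x => by
      rw [Real.norm_eq_abs, abs_of_pos (Real.exp_pos _), dotProduct]
    simp_rw [this]
    exact hy
  hM := by
    intro y
    rw [hM, integral_eq_lintegral_of_nonneg_ae
      (Filter.Eventually.of_forall fun x => (Real.exp_pos _).le)
      (aux_meas_exp t ht y).exp.aestronglyMeasurable]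
    rfl
  nd := by
    intro v hv c hc
    rw [hΘ] at hA
    refine aux_hyper v hv c _ ?_ hA
    intro y hy
    by_contra hne
    have hcont : Continuous (fun y : Fin k → ℝ => v ⬝ᵥ y) := by
      unfold dotProduct; fun_prop
    have hU : IsOpen {y : Fin k → ℝ | v ⬝ᵥ y ≠ c} := isOpen_ne.preimage hcont
    have := hy _ hU hne
    rw [Measure.map_apply ht hU.measurableSet] at this
    refine this.ne' ?_
    rw [ae_iff] at hc
    exact hc
  oΛ := hBopen
  oΘ := by rw [hΘ]; exact isOpen_interior
  hVinv := hVinv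
end

section
lemma aux_infinitePi_meas {α X : Type*} [MeasurableSpace α] [MeasurableSpace X]
    (κ : α → Measure X) [∀ a, IsProbabilityMeasure (κ a)] (hκ : Measurable κ) :
    Measurable fun a => Measure.infinitePi (fun _ : ℕ => κ a) := by
  refine Measurable.measure_of_isPiSystem_of_isProbabilityMeasure
    (generateFrom_squareCylinders (ι := ℕ) (α := fun _ => X)).symm
    (isPiSystem_squareCylinders (fun i => MeasurableSpace.isPiSystem_measurableSet)
      (fun i => MeasurableSet.univ)) ?_
  rintro _ ⟨s, t, ht, rfl⟩
  simp_rw [Measure.infinitePi_pi (fun _ : ℕ => κ _) (fun i _ => ht i trivial)]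
  exact Finset.measurable_prod _ fun i _ => (Measure.measurable_coe (ht i trivial)).comp hκ

lemma aux_iid_eq {S : Type*} [MeasurableSpace S] (Q : Measure (ℕ → S)) (p : Measure S)
    [IsProbabilityMeasure p]
    (h : ∀ (n : ℕ) (A : Fin n → Set S), (∀ i, MeasurableSet (A i)) →
          Q {ω | ∀ i : Fin n, ω (i : ℕ) ∈ A i} = ∏ i, p (A i)) :
    Q = Measure.infinitePi (fun _ : ℕ => p) := by
  classical
  refine Measure.eq_infinitePi _ ?_
  intro s t ht
  obtain ⟨n, hn⟩ : ∃ n, s ⊆ Finset.range n := s.exists_nat_subset_range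
  have h1 := h n (fun i => if (i : ℕ) ∈ s then t i else Set.univ) (fun i => by
    split_ifs; exacts [ht _, MeasurableSet.univ])
  have h2 : Set.pi (s : Set ℕ) t =
      {ω : ℕ → S | ∀ i : Fin n, ω (i : ℕ) ∈ if (i : ℕ) ∈ s then t i else Set.univ} := by
    ext ω
    constructor
    · intro hω i
      split_ifs with hi
      · exact hω i hi
      · trivial
    · intro hω i hi
      have := hω ⟨i, Finset.mem_range.1 (hn hi)⟩
      simp only [Finset.mem_coe] at hi
      simpa [hi] using this
  rw [h2, h1]
  have h3 : ∏ i : Fin n, p (if (i : ℕ) ∈ s then t i else Set.univ) =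
      ∏ i ∈ Finset.range n, p (if i ∈ s then t i else Set.univ) :=
    Fin.prod_univ_eq_prod_range (fun i => p (if i ∈ s then t i else Set.univ)) n
  rw [h3, ← Finset.prod_subset hn]
  · exact Finset.prod_congr rfl fun i hi => by rw [if_pos hi]
  · intro i _ hi; rw [if_neg hi, measure_univ]

lemma aux_piSystem (X : Type*) [m : MeasurableSpace X] [MeasurableSpace.CountablyGenerated X] :
    ∃ C : Set (Set X), C.Countable ∧ IsPiSystem C ∧ m = MeasurableSpace.generateFrom C ∧
      ∀ s ∈ C, MeasurableSet s := by
  have h0 : m = MeasurableSpace.generateFrom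
      (generateSetAlgebra (MeasurableSpace.countableGeneratingSet X)) := by
    rw [generateFrom_generateSetAlgebra_eq, MeasurableSpace.generateFrom_countableGeneratingSet]
  refine ⟨generateSetAlgebra (MeasurableSpace.countableGeneratingSet X),
    countable_generateSetAlgebra MeasurableSpace.countable_countableGeneratingSet,
    fun s hs t ht _ => isSetAlgebra_generateSetAlgebra.inter_mem hs ht, h0, ?_⟩
  intro s hs
  rw [h0]
  exact MeasurableSpace.measurableSet_generateFrom hs

lemma aux_meas_prob (S : Type*) [MeasurableSpace S] :
    MeasurableSet {p : Measure S | IsProbabilityMeasure p} := by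
  have : {p : Measure S | IsProbabilityMeasure p} = (fun p : Measure S => p Set.univ) ⁻¹' {1} := by
    ext p; exact isProbabilityMeasure_iff
  rw [this]
  exact Measure.measurable_coe MeasurableSet.univ (measurableSet_singleton _)

lemma aux_diag {S : Type*} [MeasurableSpace S] [MeasurableSpace.CountablyGenerated S]
    (G : Measure S → Measure S) (hG : Measurable G) (hGp : ∀ p, IsProbabilityMeasure (G p)) :
    MeasurableSet {p : Measure S | p = G p} := by
  obtain ⟨C, hC, hpi, hgen, hCm⟩ := aux_piSystem S
  have : {p : Measure S | p = G p} = {p | IsProbabilityMeasure p} ∩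
      ⋂ s ∈ C, {p | p s = G p s} := by
    ext p
    simp only [Set.mem_setOf_eq, Set.mem_inter_iff, Set.mem_iInter]
    constructor
    · intro h
      refine ⟨?_, fun s _ => by rw [← h]⟩
      rw [h]; exact hGp _
    · rintro ⟨h1, h2⟩
      haveI := hGp p
      exact ext_of_generate_finite C hgen hpi h2 (by simp)
  rw [this]
  refine (aux_meas_prob S).inter (MeasurableSet.biInter hC fun s hs => ?_)
  exact measurableSet_eq_fun (Measure.measurable_coe (hCm s hs))
    ((Measure.measurable_coe (hCm s hs)).comp hG)

lemma aux_transfer {S Y : Type*} [MeasurableSpace S] [MeasurableSpace Y]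
    (iid : Measure S → Measure (ℕ → S))
    (hiid : ∀ 𝔭 : Measure S, IsProbabilityMeasure 𝔭 →
      IsProbabilityMeasure (iid 𝔭) ∧
        ∀ (n : ℕ) (A : Fin n → Set S), (∀ i, MeasurableSet (A i)) →
          iid 𝔭 {ω | ∀ i : Fin n, ω (i : ℕ) ∈ A i} = ∏ i, 𝔭 (A i))
    (ρ : Measure (ℕ → S)) [IsProbabilityMeasure ρ]
    (ptilde : (ℕ → S) → Measure S) (hptilde_meas : Measurable ptilde)
    (hdirect : ∀ C : Set (ℕ → S), MeasurableSet C → ∀ B : Set (Measure S), MeasurableSet B →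
      ρ (C ∩ ptilde ⁻¹' B) = ∫⁻ ω in ptilde ⁻¹' B, iid (ptilde ω) C ∂ρ)
    (θt : (ℕ → S) → Y) (G : Y → Measure S) (hG : Measurable G)
    [hGp : ∀ y, IsProbabilityMeasure (G y)] (T : Measure S → Y) (hT : Measurable T)
    (hθ : ∀ᵐ ω ∂ρ, ptilde ω = G (θt ω) ∧ T (ptilde ω) = θt ω)
    (F : Y × (ℕ → S) → ℝ≥0∞) (hF : Measurable F) :
    ∫⁻ ω, F (θt ω, ω) ∂ρ =
      ∫⁻ ω, ∫⁻ ω', F (θt ω, ω') ∂(Measure.infinitePi (fun _ : ℕ => G (θt ω))) ∂ρ := by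
  have hm : Measurable fun p => Measure.infinitePi (fun _ : ℕ => G (T p)) :=
    aux_infinitePi_meas (fun p => G (T p)) (hG.comp hT)
  have h1 := aux_lintegral_disint ρ ptilde hptilde_meas id measurable_id
    (fun p => Measure.infinitePi (fun _ : ℕ => G (T p))) (fun p => inferInstance) hm ?_
    (fun z => F (T z.1, z.2)) (hF.comp ((hT.comp measurable_fst).prodMk measurable_snd))
  · have e1 : ∫⁻ ω, F (θt ω, ω) ∂ρ = ∫⁻ ω, F (T (ptilde ω), id ω) ∂ρ :=
      lintegral_congr_ae (by filter_upwards [hθ] with ω h; rw [h.2]; rfl)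
    rw [e1, h1]
    refine lintegral_congr_ae ?_
    filter_upwards [hθ] with ω h
    simp only [h.2]
  · intro A' hA' B hB
    rw [Set.preimage_id, Set.inter_comm, hdirect B hB A' hA']
    refine lintegral_congr_ae (ae_restrict_of_ae ?_)
    filter_upwards [hθ] with ω h
    rw [h.2, h.1, aux_iid_eq (iid (G (θt ω))) (G (θt ω)) (hiid _ inferInstance).2]

lemma aux_post {S Y : Type*} [MeasurableSpace S] [MeasurableSpace.CountablyGenerated S]
    [MeasurableSpace Y]
    (ρ : Measure (ℕ → S)) [IsProbabilityMeasure ρ]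
    (ptilde : (ℕ → S) → Measure S)
    (θt : (ℕ → S) → Y) (G : Y → Measure S) (hG : Measurable G)
    [hGp : ∀ y, IsProbabilityMeasure (G y)] (T : Measure S → Y) (hT : Measurable T)
    (hθ : ∀ᵐ ω ∂ρ, ptilde ω = G (θt ω) ∧ T (ptilde ω) = θt ω)
    (n : ℕ) (post : (Fin n → S) → Measure (Measure S)) (hpost_meas : Measurable post)
    (hpost : ∀ (A : Set (Fin n → S)), MeasurableSet A →
      ∀ B : Set (Measure S), MeasurableSet B →
        ρ {ω | (fun i : Fin n => ω (i : ℕ)) ∈ A ∧ ptilde ω ∈ B}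
          = ∫⁻ ω in {ω | (fun i : Fin n => ω (i : ℕ)) ∈ A},
              post (fun i : Fin n => ω (i : ℕ)) B ∂ρ) :
    (∀ (A : Set (Fin n → S)), MeasurableSet A → ∀ B : Set Y, MeasurableSet B →
        ρ {ω | (fun i : Fin n => ω (i : ℕ)) ∈ A ∧ θt ω ∈ B}
          = ∫⁻ ω in {ω | (fun i : Fin n => ω (i : ℕ)) ∈ A},
              (post (fun i : Fin n => ω (i : ℕ))).map T B ∂ρ) ∧
    ∀ᵐ ω ∂ρ, post (fun i : Fin n => ω (i : ℕ)) =
      ((post (fun i : Fin n => ω (i : ℕ))).map T).map G := by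
  have hξ : Measurable (fun (ω : ℕ → S) (i : Fin n) => ω i) :=
    measurable_pi_lambda _ fun i => measurable_pi_apply _
  constructor
  · intro A hA B hB
    have h1 := hpost A hA (T ⁻¹' B) (hT hB)
    simp_rw [Measure.map_apply hT hB]
    rw [← h1]
    apply measure_congr
    filter_upwards [hθ] with ω h
    have : (T (ptilde ω) ∈ B) = (θt ω ∈ B) := by rw [h.2]
    apply propext
    constructor
    · rintro ⟨h1, h2⟩; exact ⟨h1, this.symm ▸ h2⟩
    · rintro ⟨h1, h2⟩; exact ⟨h1, this ▸ h2⟩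
  · have hD := aux_diag (fun p => G (T p)) (hG.comp hT) (fun p => hGp _)
    have h1 := hpost Set.univ MeasurableSet.univ _ hD.compl
    have h2 : ρ {ω | (fun i : Fin n => ω (i : ℕ)) ∈ Set.univ ∧
        ptilde ω ∈ {p : Measure S | p = G (T p)}ᶜ} = 0 := by
      have h3 : ∀ᵐ ω ∂ρ, ¬ ((fun i : Fin n => ω (i : ℕ)) ∈ Set.univ ∧
        ptilde ω ∈ {p : Measure S | p = G (T p)}ᶜ) := by
        filter_upwards [hθ] with ω h h'
        apply h'.2
        show ptilde ω = G (T (ptilde ω))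
        rw [h.2]; exact h.1
      rw [ae_iff] at h3
      simpa using h3
    rw [h2] at h1
    have hmm : Measurable fun ω : ℕ → S => post (fun i : Fin n => ω (i : ℕ))
        {p : Measure S | p = G (T p)}ᶜ :=
      (Measure.measurable_coe hD.compl).comp (hpost_meas.comp hξ)
    simp only [Set.mem_univ, Set.setOf_true, Measure.restrict_univ] at h1
    have h3 := (lintegral_eq_zero_iff hmm).1 h1.symm
    filter_upwards [h3] with ω hω
    rw [Measure.map_map hG hT]
    conv_lhs => rw [← Measure.map_id (μ := post (fun i : Fin n => ω (i : ℕ)))]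
    apply Measure.map_congr
    rw [Filter.EventuallyEq, ae_iff]
    exact hω

lemma aux_prob_cg (S : Type*) [MeasurableSpace S] [MeasurableSpace.CountablyGenerated S] :
    MeasurableSpace.CountablyGenerated {p : Measure S // IsProbabilityMeasure p} := by
  obtain ⟨C, hC, hpi, hgen, hCm⟩ := aux_piSystem S
  haveI := hC.to_subtype
  let φ : {p : Measure S // IsProbabilityMeasure p} → (C → ℝ≥0∞) := fun p s => p.1 s.1
  have h1 : (inferInstance : MeasurableSpace {p : Measure S // IsProbabilityMeasure p}) =
      MeasurableSpace.comap φ inferInstance := by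
    apply le_antisymm
    · let m' : MeasurableSpace {p : Measure S // IsProbabilityMeasure p} :=
        MeasurableSpace.comap φ inferInstance
      haveI : ∀ p : {p : Measure S // IsProbabilityMeasure p}, IsProbabilityMeasure p.1 :=
        fun p => p.2
      have : @Measurable _ _ m' _ (Subtype.val : {p : Measure S // IsProbabilityMeasure p} → _) := by
        refine @Measurable.measure_of_isPiSystem_of_isProbabilityMeasure _ _ m' _ _ _ C hgen hpi ?_
        intro s hs
        have : (fun a : {p : Measure S // IsProbabilityMeasure p} => a.1 s) =
            (fun f : C → ℝ≥0∞ => f ⟨s, hs⟩) ∘ φ := rfl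
        rw [this]
        exact (measurable_pi_apply _).comp (comap_measurable φ)
      exact this.comap_le
    · refine Measurable.comap_le (measurable_pi_lambda _ fun s => ?_)
      exact (Measure.measurable_coe (hCm _ s.2)).comp measurable_subtype_coe
  have h2 := MeasurableSpace.CountablyGenerated.comap φ
  rw [← h1] at h2
  exact h2

lemma aux_ker_eq {A S : Type*} [MeasurableSpace A] [MeasurableSpace S]
    [MeasurableSpace.CountablyGenerated S] (P : Measure A) [IsProbabilityMeasure P]
    (κ₁ κ₂ : A → Measure (Measure S)) (h₁ : Measurable κ₁) (h₂ : Measurable κ₂)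
    (hp₁ : ∀ a, IsProbabilityMeasure (κ₁ a)) (hp₂ : ∀ a, IsProbabilityMeasure (κ₂ a))
    (hc : ∀ᵐ a ∂P, κ₂ a {p | IsProbabilityMeasure p}ᶜ = 0)
    (h : ∀ B, MeasurableSet B → ∀ A', MeasurableSet A' → ∫⁻ a in A', κ₁ a B ∂P = ∫⁻ a in A', κ₂ a B ∂P) :
    ∀ᵐ a ∂P, κ₁ a = κ₂ a := by
  have key : ∀ B, MeasurableSet B → ∀ᵐ a ∂P, κ₁ a B = κ₂ a B := by
    intro B hB
    refine ae_eq_of_forall_setLIntegral_eq_of_sigmaFinite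
      ((Measure.measurable_coe hB).comp h₁) ((Measure.measurable_coe hB).comp h₂) ?_
    intro A' hA' _
    exact h B hB A' hA'
  haveI := aux_prob_cg S
  obtain ⟨C, hC, hpi, hgen, hCm⟩ := aux_piSystem {p : Measure S // IsProbabilityMeasure p}
  have he : MeasurableEmbedding (Subtype.val : {p : Measure S // IsProbabilityMeasure p} → _) :=
    MeasurableEmbedding.subtype_coe (aux_meas_prob S)
  haveI := hC.to_subtype
  have h1 : ∀ᵐ a ∂P, ∀ s : C, κ₁ a (Subtype.val '' s.1) = κ₂ a (Subtype.val '' s.1) :=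
    ae_all_iff.2 fun s => key _ (he.measurableSet_image.2 (hCm _ s.2))
  filter_upwards [h1, hc, key _ (aux_meas_prob S).compl] with a ha hca hk
  have e : ∀ κ : Measure (Measure S), κ {p | IsProbabilityMeasure p}ᶜ = 0 →
      (κ.comap (Subtype.val : {p : Measure S // IsProbabilityMeasure p} → _)).map Subtype.val = κ := by
    intro κ hκ
    rw [he.map_comap]
    have : Set.range (Subtype.val : {p : Measure S // IsProbabilityMeasure p} → _) =
      {p | IsProbabilityMeasure p} := Subtype.range_coe
    rw [this]
    refine Measure.restrict_eq_self_of_ae_mem ?_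
    rw [ae_iff]
    exact hκ
  rw [← e (κ₁ a) (hk.trans hca), ← e (κ₂ a) hca]
  congr 1
  haveI := hp₁ a
  haveI := hp₂ a
  haveI : IsFiniteMeasure ((κ₁ a).comap (Subtype.val : {p : Measure S // IsProbabilityMeasure p} → _)) :=
    ⟨by rw [he.comap_apply]; exact measure_lt_top _ _⟩
  refine ext_of_generate_finite C hgen hpi ?_ ?_
  · intro s hs
    rw [he.comap_apply, he.comap_apply]
    exact ha ⟨s, hs⟩
  · rw [he.comap_apply, he.comap_apply]
    have h3 : Subtype.val '' (Set.univ : Set {p : Measure S // IsProbabilityMeasure p}) =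
      {p | IsProbabilityMeasure p} := by simp
    rw [h3]
    have u1 := prob_compl_eq_zero_iff (μ := κ₁ a) (aux_meas_prob S)
    have u2 := prob_compl_eq_zero_iff (μ := κ₂ a) (aux_meas_prob S)
    rw [u1.1 (hk.trans hca), u2.1 hca]
end

section
open scoped Matrix

open Classical in
def rr {k : ℕ} (Θ : Set (Fin k → ℝ)) (θ₀ θ : Fin k → ℝ) : Fin k → ℝ := if θ ∈ Θ then θ else θ₀

lemma rr_mem {k : ℕ} {Θ : Set (Fin k → ℝ)} {θ₀ : Fin k → ℝ} (h : θ₀ ∈ Θ) (θ) : rr Θ θ₀ θ ∈ Θ := by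
  unfold rr; split_ifs with h1
  exacts [h1, h]

lemma rr_eq {k : ℕ} {Θ : Set (Fin k → ℝ)} {θ₀ : Fin k → ℝ} {θ} (h : θ ∈ Θ) : rr Θ θ₀ θ = θ := by
  unfold rr; rw [if_pos h]

lemma rr_meas {k : ℕ} {Θ : Set (Fin k → ℝ)} {θ₀ : Fin k → ℝ} (h : IsOpen Θ) {β : Type*}
    [TopologicalSpace β] [MeasurableSpace β] [BorelSpace β] [Zero β]
    (f : (Fin k → ℝ) → β) (hf : ContinuousOn f Θ) :
    Measurable (fun θ => f (rr Θ θ₀ θ)) := by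
  classical
  have : (fun θ => f (rr Θ θ₀ θ)) = Θ.piecewise f (fun _ => f θ₀) := by
    funext θ
    by_cases hθ : θ ∈ Θ
    · rw [rr_eq hθ, Set.piecewise_eq_of_mem _ _ _ hθ]
    · rw [Set.piecewise_eq_of_notMem _ _ _ hθ, rr, if_neg hθ]
  rw [this]
  exact hf.measurable_piecewise continuousOn_const h.measurableSet

/-- mean functional -/
def efT {S : Type*} [MeasurableSpace S] {k : ℕ} (t : S → (Fin k → ℝ)) (p : Measure S) :
    Fin k → ℝ := fun i => (∫⁻ x, ENNReal.ofReal (t x i) ∂p).toReal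
      - (∫⁻ x, ENNReal.ofReal (- t x i) ∂p).toReal

lemma efT_meas {S : Type*} [MeasurableSpace S] {k : ℕ} (t : S → (Fin k → ℝ)) (ht : Measurable t) :
    Measurable (efT t) := by
  have hti : ∀ i, Measurable fun x => t x i := fun i => (measurable_pi_apply i).comp ht
  refine measurable_pi_lambda _ fun i => ?_
  exact ((Measure.measurable_lintegral (hti i).ennreal_ofReal).ennreal_toReal).sub
    ((Measure.measurable_lintegral (hti i).neg.ennreal_ofReal).ennreal_toReal)

lemma aux_Log2_pos (x : ℝ) : 1 ≤ Log2 x := by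
  unfold Log2
  split_ifs with h
  · exact le_rfl
  · push Not at h
    have h1 : Real.exp 1 ≤ Real.log x := by
      rw [Real.le_log_iff_exp_le (lt_of_lt_of_le (Real.exp_pos _) h)]; exact h
    rw [Real.le_log_iff_exp_le (lt_of_lt_of_le (Real.exp_pos _) h1)]; exact h1

lemma aux_Log2_div : Filter.Tendsto (fun n : ℕ => Log2 n / n) Filter.atTop (nhds 0) := by
  have h1 : Filter.Tendsto (fun x : ℝ => Real.log x / x) Filter.atTop (nhds 0) :=
    Real.isLittleO_log_id_atTop.tendsto_div_nhds_zero
  have h2 := h1.comp tendsto_natCast_atTop_atTop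
  refine tendsto_of_tendsto_of_tendsto_of_le_of_le' tendsto_const_nhds h2 ?_ ?_
  · exact Filter.Eventually.of_forall fun n =>
      div_nonneg (zero_le_one.trans (aux_Log2_pos _)) (Nat.cast_nonneg _)
  · filter_upwards [tendsto_natCast_atTop_atTop.eventually (Filter.eventually_ge_atTop
      (Real.exp (Real.exp 1)))] with n hn
    simp only [Function.comp]
    gcongr
    rw [Log2, if_neg (not_lt.2 hn)]
    have h1 : 0 < Real.log n := by
      apply Real.log_pos
      have := Real.add_one_le_exp (Real.exp 1)
      have := Real.exp_pos 1
      linarith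
    exact (Real.log_le_sub_one_of_pos h1).trans (by linarith)

namespace EF
variable {S : Type*} [MeasurableSpace S] {k : ℕ} {μ : Measure S} {t : S → (Fin k → ℝ)}
    {Λ Θ : Set (Fin k → ℝ)} {M : (Fin k → ℝ) → ℝ} {Vinv : (Fin k → ℝ) → (Fin k → ℝ)}

lemma MV_cont (h : EF μ t Λ Θ M Vinv) : ContinuousOn (fun θ => M (Vinv θ)) Θ := fun θ hθ =>
  ((h.M_fd (h.hVinv θ hθ).1).continuousAt.comp
    (h.Vinv_cont.continuousAt (h.oΘ.mem_nhds hθ))).continuousWithinAt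

lemma dens_meas (h : EF μ t Λ Θ M Vinv) (θ₀ : Fin k → ℝ) :
    Measurable (fun z : (Fin k → ℝ) × S => ENNReal.ofReal
      (Real.exp (Vinv (rr Θ θ₀ z.1) ⬝ᵥ t z.2 - M (Vinv (rr Θ θ₀ z.1))))) := by
  have h1 : Measurable fun θ => Vinv (rr Θ θ₀ θ) := rr_meas h.oΘ Vinv h.Vinv_cont
  have h2 : Measurable fun θ => M (Vinv (rr Θ θ₀ θ)) := rr_meas h.oΘ _ h.MV_cont
  have h3 : Measurable (fun z : (Fin k → ℝ) × S => Vinv (rr Θ θ₀ z.1) ⬝ᵥ t z.2) := by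
    unfold dotProduct
    refine Finset.measurable_fun_sum _ fun i _ => ?_
    exact (((measurable_pi_apply i).comp h1).comp measurable_fst).mul
      ((h.hti i).comp measurable_snd)
  exact (h3.sub (h2.comp measurable_fst)).exp.ennreal_ofReal

/-- the measurable extension of the family -/
def efG (μ : Measure S) (t : S → (Fin k → ℝ)) (Θ : Set (Fin k → ℝ)) (M : (Fin k → ℝ) → ℝ)
    (Vinv : (Fin k → ℝ) → (Fin k → ℝ)) (θ₀ θ : Fin k → ℝ) : Measure S :=
  efP μ t M (Vinv (rr Θ θ₀ θ))

lemma G_meas (h : EF μ t Λ Θ M Vinv) (θ₀ : Fin k → ℝ) : Measurable (efG μ t Θ M Vinv θ₀) := by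
  haveI := h.sf
  refine Measure.measurable_of_measurable_coe _ fun s hs => ?_
  simp_rw [efG, efP, withDensity_apply _ hs]
  exact (h.dens_meas θ₀).lintegral_prod_right'

lemma G_prob (h : EF μ t Λ Θ M Vinv) {θ₀ : Fin k → ℝ} (h0 : θ₀ ∈ Θ) (θ) :
    IsProbabilityMeasure (efG μ t Θ M Vinv θ₀ θ) := h.P_prob (h.hVinv _ (rr_mem h0 θ)).1

lemma T_P (h : EF μ t Λ Θ M Vinv) {θ} (hθ : θ ∈ Θ) : efT t (efP μ t M (Vinv θ)) = θ := by
  funext i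
  have h1 := h.P_mean (h.hVinv θ hθ).1 i
  rw [h.V_Vinv hθ, integral_eq_lintegral_pos_part_sub_lintegral_neg_part h1.1] at h1
  exact h1.2

lemma Q_cont (h : EF μ t Λ Θ M Vinv) (u : Fin k → ℝ) :
    ContinuousOn (fun θ => efQ (efH μ t (Vinv θ)) u) Θ := by
  intro θ hθ
  refine ContinuousAt.continuousWithinAt ?_
  have h1 : ContinuousAt (fun θ => Hclm (efH μ t (Vinv θ))) θ :=
    ContinuousAt.comp (f := Vinv) (g := fun y => Hclm (efH μ t y))
      (h.H_cont (h.hVinv θ hθ).1) (h.Vinv_cont.continuousAt (h.oΘ.mem_nhds hθ))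
  have h2 : (fun θ => efQ (efH μ t (Vinv θ)) u) =
      fun θ => dotL u (Hclm (efH μ t (Vinv θ)) u) := by
    funext θ; rw [dotL_apply, Hclm_dot]
  rw [h2]
  exact (dotL u).continuous.continuousAt.comp (h1.clm_apply continuousAt_const)

lemma lil_event (h : EF μ t Λ Θ M Vinv) {θ₀ : Fin k → ℝ} (h0 : θ₀ ∈ Θ)
    (ρ : Measure (ℕ → S)) (θt : (ℕ → S) → (Fin k → ℝ)) (hθt : Measurable θt)
    (hΘ : ∀ᵐ ω ∂ρ, θt ω ∈ Θ)
    (htr : ∀ F : (Fin k → ℝ) × (ℕ → S) → ℝ≥0∞, Measurable F → ∫⁻ ω, F (θt ω, ω) ∂ρ =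
      ∫⁻ ω, ∫⁻ ω', F (θt ω, ω') ∂(haveI := h.G_prob h0; Measure.infinitePi
        (fun _ : ℕ => efG μ t Θ M Vinv θ₀ (θt ω))) ∂ρ)
    (u : Fin k → ℝ) (c : ℝ) :
    ∀ᵐ ω ∂ρ, 2 * efQ (efH μ t (Vinv (θt ω))) u < c → ∀ᶠ n : ℕ in Filter.atTop,
      ∑ i ∈ Finset.range n, (u ⬝ᵥ t (ω i) - u ⬝ᵥ θt ω) ≤ Real.sqrt (c * (n * Log2 n)) := by
  classical
  haveI := h.G_prob h0
  let N : Set ((Fin k → ℝ) × (ℕ → S)) := {z | 2 * efQ (efH μ t (Vinv (rr Θ θ₀ z.1))) u < c ∧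
    ¬ ∀ᶠ n : ℕ in Filter.atTop,
      ∑ i ∈ Finset.range n, (u ⬝ᵥ t (z.2 i) - u ⬝ᵥ z.1) ≤ Real.sqrt (c * (n * Log2 n))}
  have hN : MeasurableSet N := by
    refine MeasurableSet.inter ?_ (MeasurableSet.compl ?_)
    · exact measurableSet_lt (((rr_meas h.oΘ _ (h.Q_cont u)).comp measurable_fst).const_mul 2)
        measurable_const
    · change MeasurableSet {z : (Fin k → ℝ) × (ℕ → S) | ∀ᶠ n : ℕ in Filter.atTop,
        ∑ i ∈ Finset.range n, (u ⬝ᵥ t (z.2 i) - u ⬝ᵥ z.1) ≤ Real.sqrt (c * (n * Log2 n))}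
      simp only [Filter.eventually_atTop]
      have : {z : (Fin k → ℝ) × (ℕ → S) | ∃ a : ℕ, ∀ b : ℕ, b ≥ a →
        ∑ i ∈ Finset.range b, (u ⬝ᵥ t (z.2 i) - u ⬝ᵥ z.1) ≤ Real.sqrt (c * (b * Log2 b))} =
        ⋃ a : ℕ, ⋂ b : ℕ, ⋂ _ : b ≥ a, {z : (Fin k → ℝ) × (ℕ → S) |
        ∑ i ∈ Finset.range b, (u ⬝ᵥ t (z.2 i) - u ⬝ᵥ z.1) ≤ Real.sqrt (c * (b * Log2 b))} := by
        ext z; simp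
      rw [this]
      refine MeasurableSet.iUnion fun a => MeasurableSet.iInter fun b => MeasurableSet.iInter fun _ =>
        measurableSet_le ?_ measurable_const
      refine Finset.measurable_fun_sum _ fun i _ => ?_
      refine ((aux_meas_exp t h.ht u).comp ((measurable_pi_apply i).comp measurable_snd)).sub ?_
      have hc : Continuous (fun y : Fin k → ℝ => u ⬝ᵥ y) := by unfold dotProduct; fun_prop
      exact hc.measurable.comp measurable_fst
  have h1 := htr (N.indicator 1) (measurable_one.indicator hN)
  have h2 : ∫⁻ ω, ∫⁻ ω', N.indicator 1 (θt ω, ω') ∂(Measure.infinitePi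
        (fun _ : ℕ => efG μ t Θ M Vinv θ₀ (θt ω))) ∂ρ = 0 := by
    rw [← lintegral_zero (μ := ρ)]
    refine lintegral_congr_ae ?_
    filter_upwards [hΘ] with ω hω
    rw [← lintegral_zero (μ := Measure.infinitePi
        (fun _ : ℕ => efG μ t Θ M Vinv θ₀ (θt ω)))]
    refine lintegral_congr_ae ?_
    by_cases hc : 2 * efQ (efH μ t (Vinv (rr Θ θ₀ (θt ω)))) u < c
    · have h3 := h.scalar_lil (h.hVinv _ (rr_mem h0 (θt ω))).1 u c hc
      rw [h.V_Vinv (rr_mem h0 (θt ω))] at h3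
      filter_upwards [h3] with ω' hω'
      rw [rr_eq hω] at hω'
      exact Set.indicator_of_notMem (fun hh => hh.2 hω') _
    · exact Filter.Eventually.of_forall fun ω' => Set.indicator_of_notMem (fun hh => hc hh.1) _
  rw [h2] at h1
  have hm1 : Measurable fun ω => N.indicator (1 : (Fin k → ℝ) × (ℕ → S) → ℝ≥0∞) (θt ω, ω) :=
    (measurable_one.indicator hN).comp (hθt.prodMk measurable_id)
  rw [lintegral_eq_zero_iff hm1] at h1
  filter_upwards [h1, hΘ] with ω hω hω2 hc
  by_contra hne
  have : (θt ω, ω) ∈ N := ⟨by rw [rr_eq hω2]; exact hc, hne⟩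
  simp [Set.indicator_of_mem this] at hω

lemma lil (h : EF μ t Λ Θ M Vinv) {θ₀ : Fin k → ℝ} (h0 : θ₀ ∈ Θ)
    (ρ : Measure (ℕ → S)) (θt : (ℕ → S) → (Fin k → ℝ)) (hθt : Measurable θt)
    (hΘ : ∀ᵐ ω ∂ρ, θt ω ∈ Θ)
    (htr : ∀ F : (Fin k → ℝ) × (ℕ → S) → ℝ≥0∞, Measurable F → ∫⁻ ω, F (θt ω, ω) ∂ρ =
      ∫⁻ ω, ∫⁻ ω', F (θt ω, ω') ∂(haveI := h.G_prob h0; Measure.infinitePi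
        (fun _ : ℕ => efG μ t Θ M Vinv θ₀ (θt ω))) ∂ρ) :
    ∀ᵐ ω ∂ρ, ∀ ε : ℝ, 0 < ε → ∀ᶠ n : ℕ in Filter.atTop,
      (n / Log2 n) * ∑ j, ((∑ i : Fin n, t (ω i) j) / (n : ℝ) - θt ω j) ^ 2
        ≤ 2 * maxEig (efH μ t (Vinv (θt ω))) + ε := by
  obtain ⟨D, hDc, hDd⟩ := TopologicalSpace.exists_countable_dense (Fin k → ℝ)
  haveI := hDc.to_subtype
  have h1 : ∀ᵐ ω ∂ρ, ∀ u : D, ∀ c : ℚ, 2 * efQ (efH μ t (Vinv (θt ω))) u < c →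
      ∀ᶠ n : ℕ in Filter.atTop,
      ∑ i ∈ Finset.range n, (u.1 ⬝ᵥ t (ω i) - u ⬝ᵥ θt ω) ≤ Real.sqrt (c * (n * Log2 n)) :=
    ae_all_iff.2 fun u => ae_all_iff.2 fun c => h.lil_event h0 ρ θt hθt hΘ htr u c
  filter_upwards [h1, hΘ] with ω hω hω2 ε hε
  have hp := fun v => h.Q_nonneg (h.hVinv _ hω2).1 v
  let z : ℕ → (Fin k → ℝ) := fun n j =>
    (∑ i ∈ Finset.range n, (t (ω i) j - θt ω j)) / Real.sqrt (n * Log2 n)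
  have h2 := aux_sphere_cover z (efH μ t (Vinv (θt ω))) (Hsymm _) (aux_maxEig_nonneg _ hp) D hDd
    ?_ ε hε
  · filter_upwards [h2, Filter.eventually_ge_atTop 1] with n hn hn1
    refine le_trans (le_of_eq ?_) hn
    rw [Finset.mul_sum]
    refine Finset.sum_congr rfl fun j _ => ?_
    have hl := aux_Log2_pos n
    have hn0 : (0:ℝ) < n := by exact_mod_cast hn1
    have e : ∑ i : Fin n, t (ω i) j = ∑ i ∈ Finset.range n, t (ω i) j :=
      Fin.sum_univ_eq_sum_range (fun i => t (ω i) j) n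
    simp only [z]
    rw [div_pow, Real.sq_sqrt (by positivity), e, Finset.sum_sub_distrib, Finset.sum_const,
      Finset.card_range, nsmul_eq_mul]
    have : Log2 n ≠ 0 := by linarith
    field_simp
  · intro u hu c hc
    filter_upwards [hω ⟨u, hu⟩ c hc, Filter.eventually_ge_atTop 1] with n hn hn1
    have hl := aux_Log2_pos n
    have hn0 : (0:ℝ) < n := by exact_mod_cast hn1
    have hc0 : (0:ℝ) ≤ c := by linarith [hp u]
    have e : u ⬝ᵥ z n = (∑ i ∈ Finset.range n, (u ⬝ᵥ t (ω i) - u ⬝ᵥ θt ω)) /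
        Real.sqrt (n * Log2 n) := by
      simp only [z, dotProduct, ← Finset.sum_sub_distrib, Finset.sum_div, Finset.mul_sum]
      rw [Finset.sum_comm]
      refine Finset.sum_congr rfl fun i _ => Finset.sum_congr rfl fun j _ => ?_
      ring
    rw [e, div_le_iff₀ (Real.sqrt_pos.2 (by positivity)), ← Real.sqrt_mul hc0]
    exact hn

end EF
end

section
open scoped Matrix

lemma aux_Phi {k : ℕ} (HessI : (Fin k → ℝ) → Matrix (Fin k) (Fin k) ℝ) (θ : Fin k → ℝ) :
    PhiFn HessI θ θ ^ 2 = 1 / 2 * frobNorm (HessI θ) := by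
  have h0 : 0 ≤ frobNorm (HessI θ) := Real.sqrt_nonneg _
  have h1 : ∫ s in (0 : ℝ)..1, (1 - s) * frobNorm (HessI (θ + s • (θ - θ))) =
      1 / 2 * frobNorm (HessI θ) := by
    simp only [sub_self, smul_zero, add_zero, intervalIntegral.integral_mul_const]
    congr 1
    rw [intervalIntegral.integral_sub (by simp) (by simp)]
    simp; norm_num
  rw [PhiFn, h1, Real.sq_sqrt (by positivity)]

namespace EF
variable {S : Type*} [MeasurableSpace S] {k : ℕ} {μ : Measure S} {t : S → (Fin k → ℝ)}
    {Λ Θ : Set (Fin k → ℝ)} {M : (Fin k → ℝ) → ℝ} {Vinv : (Fin k → ℝ) → (Fin k → ℝ)}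

lemma tal_limsup (h : EF μ t Λ Θ M Vinv) {Iμ : (Fin k → ℝ) → ℝ}
    (hIμ : ∀ θ, Iμ θ = sSup ((fun y => ∑ i, θ i * y i - M y) '' Λ)) {θ} (hθ : θ ∈ Θ)
    (HessI : (Fin k → ℝ) → Matrix (Fin k) (Fin k) ℝ)
    (hA : ∀ i j, HessI θ i j =
      fderiv ℝ (fun η => fderiv ℝ Iμ η (Pi.single j 1)) θ (Pi.single i 1))
    (C L : ℝ) (hC : 0 ≤ C) (hL : 0 ≤ L) (η : ℕ → (Fin k → ℝ)) (W : ℕ → ℝ)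
    (hTal : ∀ n, W n ^ 2 ≤ C * klDiv' (efP μ t M (Vinv (η n))) (efP μ t M (Vinv θ)))
    (hlil : ∀ ε : ℝ, 0 < ε → ∀ᶠ n : ℕ in Filter.atTop,
      (n / Log2 n) * ∑ j, (η n j - θ j) ^ 2 ≤ 2 * L + ε) :
    (∀ᶠ n in Filter.atTop, η n ∈ Θ) ∧ ∀ ε : ℝ, 0 < ε → ∀ᶠ n : ℕ in Filter.atTop,
      (n / Log2 n) * W n ^ 2 ≤ (Real.sqrt (2 * C) * PhiFn HessI θ θ * Real.sqrt L) ^ 2 + ε := by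
  have ht : Filter.Tendsto η Filter.atTop (nhds θ) := by
    rw [tendsto_iff_norm_sub_tendsto_zero]
    have h1 : Filter.Tendsto (fun n : ℕ => Real.sqrt ((2 * L + 1) * (Log2 n / n)))
        Filter.atTop (nhds 0) := by
      have := (aux_Log2_div.const_mul (2 * L + 1)).sqrt
      simpa using this
    refine tendsto_of_tendsto_of_tendsto_of_le_of_le' tendsto_const_nhds h1
      (Filter.Eventually.of_forall fun n => norm_nonneg _) ?_
    filter_upwards [hlil 1 one_pos, Filter.eventually_ge_atTop 1] with n hn hn1
    apply Real.le_sqrt_of_sq_le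
    have h2 := aux_norm_sq_le (η n - θ)
    refine h2.trans ?_
    have hl := aux_Log2_pos n
    have hn0 : (0:ℝ) < n := by exact_mod_cast hn1
    have hl0 : 0 < Log2 n := by linarith
    simp only [Pi.sub_apply]
    rw [← mul_div_assoc, le_div_iff₀ hn0]
    rw [div_mul_eq_mul_div, div_le_iff₀ hl0] at hn
    linarith
  have hmem : ∀ᶠ n in Filter.atTop, η n ∈ Θ := ht.eventually_mem (h.oΘ.mem_nhds hθ)
  refine ⟨hmem, ?_⟩
  intro ε hε
  have h0 : 0 ≤ frobNorm (HessI θ) := Real.sqrt_nonneg _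
  set f := frobNorm (HessI θ) with hf
  have hY : (Real.sqrt (2 * C) * PhiFn HessI θ θ * Real.sqrt L) ^ 2 = C * (1 / 2 * f) * (2 * L) := by
    rw [mul_pow, mul_pow, Real.sq_sqrt (by positivity), Real.sq_sqrt hL, aux_Phi]; ring
  have hc : Filter.Tendsto (fun δ : ℝ => C * (1 / 2 * f + δ) * (2 * L + δ)) (nhds 0)
      (nhds (C * (1 / 2 * f) * (2 * L))) := by
    have : Continuous (fun δ : ℝ => C * (1 / 2 * f + δ) * (2 * L + δ)) := by fun_prop
    simpa using this.tendsto 0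
  have hc2 : ∀ᶠ δ in nhdsWithin (0:ℝ) (Set.Ioi 0), C * (1 / 2 * f + δ) * (2 * L + δ) <
      C * (1 / 2 * f) * (2 * L) + ε :=
    (hc.eventually (gt_mem_nhds (by linarith))).filter_mono nhdsWithin_le_nhds
  obtain ⟨δ, hδ, hδ0⟩ := (hc2.and self_mem_nhdsWithin).exists
  have hδ0 : 0 < δ := hδ0
  filter_upwards [ht.eventually (h.K_bound hIμ hθ (HessI θ) hA δ hδ0), hlil δ hδ0, hmem]
    with n h1 h2 h3
  have h4 := hTal n
  rw [h.kl_eq h3 hθ] at h4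
  have hb : 0 ≤ (n / Log2 n : ℝ) :=
    div_nonneg (Nat.cast_nonneg _) (zero_le_one.trans (aux_Log2_pos _))
  rw [hY]
  calc (n / Log2 n) * W n ^ 2 ≤ (n / Log2 n) * (C * ((1 / 2 * f + δ) * ∑ j, (η n j - θ j) ^ 2)) := by
        apply mul_le_mul_of_nonneg_left _ hb
        exact h4.trans (mul_le_mul_of_nonneg_left h1 hC)
    _ = C * (1 / 2 * f + δ) * ((n / Log2 n) * ∑ j, (η n j - θ j) ^ 2) := by ring
    _ ≤ C * (1 / 2 * f + δ) * (2 * L + δ) := mul_le_mul_of_nonneg_left h2 (by positivity)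
    _ ≤ _ := hδ.le
end EF
end

section
set_option linter.unusedSectionVars false

lemma aux_wassW_nonneg {X : Type*} [MeasurableSpace X] (c : X → X → ℝ) (μ ν : Measure X) :
    0 ≤ wassW c 2 μ ν := by
  apply Real.sInf_nonneg
  rintro r ⟨γ, _, _, rfl⟩
  apply Real.rpow_nonneg
  refine integral_nonneg fun z => ?_
  rw [Pi.zero_apply, Real.rpow_two]; positivity

lemma aux_wassW_le {X : Type*} [MeasurableSpace X] (c : X → X → ℝ) (μ ν : Measure X)
    (γ : Measure (X × X)) (h1 : γ.map Prod.fst = μ) (h2 : γ.map Prod.snd = ν) :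
    ENNReal.ofReal (wassW c 2 μ ν ^ 2) ≤ ∫⁻ z, ENNReal.ofReal (c z.1 z.2 ^ 2) ∂γ := by
  have h0 : 0 ≤ ∫ z, c z.1 z.2 ^ 2 ∂γ := integral_nonneg fun z => by positivity
  have h3 : wassW c 2 μ ν ≤ Real.sqrt (∫ z, c z.1 z.2 ^ 2 ∂γ) := by
    refine csInf_le ⟨0, ?_⟩ ⟨γ, h1, h2, ?_⟩
    · rintro r ⟨γ, _, _, rfl⟩
      apply Real.rpow_nonneg
      refine integral_nonneg fun z => ?_
      rw [Pi.zero_apply, Real.rpow_two]; positivity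
    · rw [Real.sqrt_eq_rpow]; simp only [Real.rpow_two]
  have h4 : wassW c 2 μ ν ^ 2 ≤ ∫ z, c z.1 z.2 ^ 2 ∂γ :=
    calc _ ≤ Real.sqrt (∫ z, c z.1 z.2 ^ 2 ∂γ) ^ 2 := by gcongr; exact aux_wassW_nonneg _ _ _
      _ = _ := Real.sq_sqrt h0
  refine (ENNReal.ofReal_le_ofReal h4).trans ?_
  by_cases hI : Integrable (fun z => c z.1 z.2 ^ 2) γ
  · rw [ofReal_integral_eq_lintegral_ofReal hI (Filter.Eventually.of_forall fun z => by positivity)]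
  · rw [integral_undef hI]; simp

section
variable {S : Type*} [MetricSpace S] [SecondCountableTopology S] [MeasurableSpace S] [BorelSpace S]

def c2 (z : S × S) : ℝ≥0∞ := ENNReal.ofReal (dist z.1 z.2 ^ 2)

lemma c2_meas : Measurable (c2 : S × S → ℝ≥0∞) :=
  ((measurable_fst.dist measurable_snd).pow_const 2).ennreal_ofReal

lemma c2_le (x₀ : S) (z : S × S) : c2 z ≤ 2 * c2 (z.1, x₀) + 2 * c2 (z.2, x₀) := by
  have h1 := dist_triangle_right z.1 z.2 x₀
  have h0 : 0 ≤ dist z.1 z.2 := dist_nonneg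
  have e2 : (2 : ℝ≥0∞) = ENNReal.ofReal 2 := by simp
  unfold c2
  rw [e2, ← ENNReal.ofReal_mul (by norm_num), ← ENNReal.ofReal_mul (by norm_num),
    ← ENNReal.ofReal_add (by positivity) (by positivity)]
  apply ENNReal.ofReal_le_ofReal
  nlinarith [sq_nonneg (dist z.1 x₀ - dist z.2 x₀)]

def IsCpl (γ : Measure (S × S)) (μ ν : Measure S) : Prop := γ.map Prod.fst = μ ∧ γ.map Prod.snd = ν

def wcost (μ ν : Measure S) : ℝ≥0∞ := ⨅ (γ : Measure (S × S)) (_ : IsCpl γ μ ν), ∫⁻ z, c2 z ∂γ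

lemma wcost_le {γ : Measure (S × S)} {μ ν : Measure S} (h : IsCpl γ μ ν) :
    wcost μ ν ≤ ∫⁻ z, c2 z ∂γ := iInf₂_le γ h

lemma exists_cpl {μ ν : Measure S} (hf : wcost μ ν ≠ ∞) {ε : ℝ≥0∞} (hε : ε ≠ 0) :
    ∃ γ, IsCpl γ μ ν ∧ ∫⁻ z, c2 z ∂γ < wcost μ ν + ε := by
  have h1 := ENNReal.lt_add_right hf hε
  unfold wcost at h1
  simp only [iInf_lt_iff] at h1
  obtain ⟨γ, h, h2⟩ := h1
  exact ⟨γ, h, h2⟩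

lemma cost_le_mom (x₀ : S) {γ : Measure (S × S)} {μ ν : Measure S} (h : IsCpl γ μ ν) :
    ∫⁻ z, c2 z ∂γ ≤ 2 * ∫⁻ x, c2 (x, x₀) ∂μ + 2 * ∫⁻ x, c2 (x, x₀) ∂ν := by
  have hm : Measurable fun x : S => c2 (x, x₀) := c2_meas.comp (measurable_id.prodMk measurable_const)
  calc ∫⁻ z, c2 z ∂γ ≤ ∫⁻ z, (2 * c2 (z.1, x₀) + 2 * c2 (z.2, x₀)) ∂γ :=
        lintegral_mono fun z => c2_le x₀ z
    _ = _ := by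
        have hm1 : Measurable fun z : S × S => c2 (z.1, x₀) := hm.comp measurable_fst
        have hm2 : Measurable fun z : S × S => c2 (z.2, x₀) := hm.comp measurable_snd
        rw [lintegral_add_left (hm1.const_mul 2), lintegral_const_mul _ hm1,
          lintegral_const_mul _ hm2, ← h.1, ← h.2,
          lintegral_map hm measurable_fst, lintegral_map hm measurable_snd]

lemma cpl_prod (μ ν : Measure S) [IsProbabilityMeasure μ] [IsProbabilityMeasure ν] :
    IsCpl (μ.prod ν) μ ν := ⟨by simp, by simp⟩

lemma wcost_ne_top (x₀ : S) (μ ν : Measure S) [IsProbabilityMeasure μ] [IsProbabilityMeasure ν]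
    (hμ : ∫⁻ x, c2 (x, x₀) ∂μ ≠ ∞) (hν : ∫⁻ x, c2 (x, x₀) ∂ν ≠ ∞) : wcost μ ν ≠ ∞ := by
  refine ne_top_of_le_ne_top ?_ ((wcost_le (cpl_prod μ ν)).trans (cost_le_mom x₀ (cpl_prod μ ν)))
  exact ENNReal.add_ne_top.2 ⟨ENNReal.mul_ne_top (by simp) hμ, ENNReal.mul_ne_top (by simp) hν⟩

lemma wcost_comm (μ ν : Measure S) : wcost μ ν = wcost ν μ := by
  have key : ∀ μ ν : Measure S, wcost μ ν ≤ wcost ν μ := by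
    intro μ ν
    refine le_iInf₂ fun γ h => ?_
    have h1 : IsCpl (γ.map Prod.swap) μ ν := by
      constructor
      · rw [Measure.map_map measurable_fst measurable_swap]; exact h.2
      · rw [Measure.map_map measurable_snd measurable_swap]; exact h.1
    refine (wcost_le h1).trans ?_
    rw [lintegral_map c2_meas measurable_swap]
    refine lintegral_mono fun z => ?_
    simp [c2, dist_comm]
  exact le_antisymm (key _ _) (key _ _)

lemma wassW_sq (x₀ : S) (μ ν : Measure S) [IsProbabilityMeasure μ] [IsProbabilityMeasure ν]
    (hμ : ∫⁻ x, c2 (x, x₀) ∂μ ≠ ∞) (hν : ∫⁻ x, c2 (x, x₀) ∂ν ≠ ∞) :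
    ENNReal.ofReal (wassW (fun u v : S => dist u v) 2 μ ν ^ 2) = wcost μ ν := by
  apply le_antisymm
  · exact le_iInf₂ fun γ h => aux_wassW_le _ μ ν γ h.1 h.2
  · have hf := wcost_ne_top x₀ μ ν hμ hν
    have h1 : Real.sqrt (wcost μ ν).toReal ≤ wassW (fun u v : S => dist u v) 2 μ ν := by
      refine le_csInf ⟨_, μ.prod ν, (cpl_prod μ ν).1, (cpl_prod μ ν).2, rfl⟩ ?_
      rintro r ⟨γ, h1, h2, rfl⟩
      simp only [Real.rpow_two]
      rw [← Real.sqrt_eq_rpow]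
      apply Real.sqrt_le_sqrt
      rw [integral_eq_lintegral_of_nonneg_ae (Filter.Eventually.of_forall fun z => by positivity)
        ((measurable_fst.dist measurable_snd).pow_const 2).aestronglyMeasurable]
      apply ENNReal.toReal_mono _ (wcost_le ⟨h1, h2⟩)
      refine ne_top_of_le_ne_top ?_ (cost_le_mom x₀ ⟨h1, h2⟩)
      exact ENNReal.add_ne_top.2 ⟨ENNReal.mul_ne_top (by simp) hμ, ENNReal.mul_ne_top (by simp) hν⟩
    rw [← ENNReal.ofReal_toReal hf]
    apply ENNReal.ofReal_le_ofReal
    calc (wcost μ ν).toReal = Real.sqrt (wcost μ ν).toReal ^ 2 :=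
          (Real.sq_sqrt ENNReal.toReal_nonneg).symm
      _ ≤ _ := by gcongr
end
end

section
set_option linter.unusedSectionVars false

section
variable {S : Type*} [MeasurableSpace S]

def pertR (μ : Measure S) (p q : S → ℝ≥0∞) : ℝ≥0∞ := ∫⁻ x, (q x - p x) ∂μ

def pert (μ : Measure S) (p q : S → ℝ≥0∞) (γ : Measure (S × S)) : Measure (S × S) :=
  γ.withDensity (fun z => min 1 (q z.1 / p z.1)) +
    (pertR μ p q)⁻¹ • (((μ.prod γ).withDensity
      (fun w => (q w.1 - p w.1) * (1 - q w.2.1 / p w.2.1))).map (fun w => (w.1, w.2.2)))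

variable (μ : Measure S) [SigmaFinite μ] {p q : S → ℝ≥0∞} (γ : Measure (S × S)) [SFinite γ]

lemma pert_lintegral (hp : Measurable p) (hq : Measurable q) {f : S × S → ℝ≥0∞} (hf : Measurable f) :
    ∫⁻ z, f z ∂(pert μ p q γ) = ∫⁻ z, min 1 (q z.1 / p z.1) * f z ∂γ +
      (pertR μ p q)⁻¹ * ∫⁻ w, (q w.1 - p w.1) * (1 - q w.2.1 / p w.2.1) * f (w.1, w.2.2) ∂(μ.prod γ) := by
  have hm : Measurable fun w : S × S × S => (w.1, w.2.2) := by fun_prop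
  have h1 : Measurable (fun z : S × S => min 1 (q z.1 / p z.1)) :=
    measurable_const.min ((hq.comp measurable_fst).div (hp.comp measurable_fst))
  have h2 : Measurable (fun w : S × S × S => (q w.1 - p w.1) * (1 - q w.2.1 / p w.2.1)) := by
    fun_prop
  unfold pert
  rw [lintegral_add_measure, lintegral_smul_measure, lintegral_map hf hm,
    lintegral_withDensity_eq_lintegral_mul _ h1 hf,
    lintegral_withDensity_eq_lintegral_mul _ h2 (g := fun a => f (a.1, a.2.2)) (hf.comp hm)]
  rfl

lemma pertR_symm (hp : Measurable p) (hq : Measurable q) (hp1 : ∫⁻ x, p x ∂μ = 1)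
    (hq1 : ∫⁻ x, q x ∂μ = 1) : pertR μ p q = pertR μ q p := by
  have h1 : ∫⁻ x, min (p x) (q x) ∂μ + pertR μ p q = 1 := by
    unfold pertR
    rw [← lintegral_add_right _ (show Measurable fun x => q x - p x from hq.sub hp), ← hq1]
    refine lintegral_congr fun x => ?_
    rcases le_total (p x) (q x) with h | h
    · rw [min_eq_left h]; exact add_tsub_cancel_of_le h
    · rw [min_eq_right h, tsub_eq_zero_of_le h, add_zero]
  have h2 : ∫⁻ x, min (p x) (q x) ∂μ + pertR μ q p = 1 := by
    unfold pertR
    rw [← lintegral_add_right _ (show Measurable fun x => p x - q x from hp.sub hq), ← hp1]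
    refine lintegral_congr fun x => ?_
    rcases le_total (q x) (p x) with h | h
    · rw [min_eq_right h]; exact add_tsub_cancel_of_le h
    · rw [min_eq_left h, tsub_eq_zero_of_le h, add_zero]
  have h3 : ∫⁻ x, min (p x) (q x) ∂μ ≠ ∞ := by
    refine ne_top_of_le_ne_top ENNReal.one_ne_top ?_
    rw [← h1]; exact le_self_add
  exact (ENNReal.add_right_inj h3).1 (h1.trans h2.symm)

lemma pertR_ne_top (hq1 : ∫⁻ x, q x ∂μ = 1) : pertR μ p q ≠ ∞ := by
  refine ne_top_of_le_ne_top ENNReal.one_ne_top ?_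
  rw [← hq1]; exact lintegral_mono fun x => tsub_le_self

lemma lintegral_fst (hp : Measurable p) (hγ : γ.map Prod.fst = μ.withDensity p)
    {g : S → ℝ≥0∞} (hg : Measurable g) : ∫⁻ z, g z.1 ∂γ = ∫⁻ x, p x * g x ∂μ := by
  rw [← lintegral_map hg measurable_fst, hγ, lintegral_withDensity_eq_lintegral_mul _ hp hg]
  rfl

lemma aux_one_sub {a b : ℝ≥0∞} (ha : a ≠ 0) (ha' : a ≠ ∞) : a * (1 - b / a) = a - b := by
  rw [ENNReal.mul_sub (fun _ _ => ha'), mul_one, ENNReal.mul_div_cancel ha ha']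

lemma aux_min_mul {a b : ℝ≥0∞} (ha : a ≠ 0) (ha' : a ≠ ∞) : a * min 1 (b / a) = min a b := by
  rw [← min_mul_mul_left, mul_one, ENNReal.mul_div_cancel ha ha']

lemma pertR_aux (hp : Measurable p) (hq : Measurable q) (hp0 : ∀ x, p x ≠ 0) (hpt : ∀ x, p x ≠ ∞)
    (hp1 : ∫⁻ x, p x ∂μ = 1) (hq1 : ∫⁻ x, q x ∂μ = 1) (hγ : γ.map Prod.fst = μ.withDensity p) :
    ∫⁻ z, (1 - q z.1 / p z.1) ∂γ = pertR μ p q := by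
  rw [lintegral_fst μ γ hp hγ (g := fun x => 1 - q x / p x) (by fun_prop), pertR_symm μ hp hq hp1 hq1]
  exact lintegral_congr fun x => aux_one_sub (hp0 x) (hpt x)

lemma pertR_cancel {r a : ℝ≥0∞} (hr : r ≠ ∞) (h : r = 0 → a = 0) : r⁻¹ * (a * r) = a := by
  by_cases h0 : r = 0
  · rw [h h0]; simp
  · rw [mul_comm a r, ← mul_assoc, ENNReal.inv_mul_cancel h0 hr, one_mul]

lemma pert_cpl (hp : Measurable p) (hq : Measurable q) (hp0 : ∀ x, p x ≠ 0) (hpt : ∀ x, p x ≠ ∞)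
    (hp1 : ∫⁻ x, p x ∂μ = 1) (hq1 : ∫⁻ x, q x ∂μ = 1)
    (hγ : γ.map Prod.fst = μ.withDensity p) :
    (pert μ p q γ).map Prod.fst = μ.withDensity q ∧ (pert μ p q γ).map Prod.snd = γ.map Prod.snd := by
  have hr := pertR_ne_top μ (p := p) hq1
  have hR := pertR_aux μ γ hp hq hp0 hpt hp1 hq1 hγ
  constructor
  · ext A hA
    have hi : Measurable (A.indicator (fun _ : S => (1 : ℝ≥0∞))) := measurable_const.indicator hA
    rw [← lintegral_indicator_one hA, ← lintegral_indicator_one hA]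
    show ∫⁻ a, A.indicator (fun _ => (1 : ℝ≥0∞)) a ∂_ = ∫⁻ a, A.indicator (fun _ => (1 : ℝ≥0∞)) a ∂_
    rw [lintegral_map hi measurable_fst, pert_lintegral μ γ hp hq (f := fun z => A.indicator (fun _ => (1 : ℝ≥0∞)) z.1) (hi.comp measurable_fst),
      lintegral_withDensity_eq_lintegral_mul _ hq hi,
      lintegral_fst μ γ hp hγ (g := fun x => min 1 (q x / p x) * A.indicator (fun _ => (1 : ℝ≥0∞)) x) (by fun_prop)]
    have e1 : ∫⁻ w, (q w.1 - p w.1) * (1 - q w.2.1 / p w.2.1) * A.indicator (fun _ => (1 : ℝ≥0∞)) w.1 ∂(μ.prod γ)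
        = (∫⁻ x, (q x - p x) * A.indicator (fun _ => (1 : ℝ≥0∞)) x ∂μ) * pertR μ p q := by
      rw [← hR, ← lintegral_prod_mul (f := fun x => (q x - p x) * A.indicator (fun _ => (1 : ℝ≥0∞)) x)
        (g := fun z : S × S => 1 - q z.1 / p z.1) (by fun_prop) (by fun_prop)]
      exact lintegral_congr fun w => by ring
    rw [e1, pertR_cancel hr, ← lintegral_add_right _ (by fun_prop)]
    · refine lintegral_congr fun x => ?_
      rw [← mul_assoc, aux_min_mul (hp0 x) (hpt x), ← add_mul, Pi.mul_apply]
      congr 1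
      rcases le_total (p x) (q x) with h | h
      · rw [min_eq_left h]; exact add_tsub_cancel_of_le h
      · rw [min_eq_right h, tsub_eq_zero_of_le h, add_zero]
    · intro h0
      refine le_antisymm ?_ zero_le
      rw [← h0]
      refine lintegral_mono fun x => ?_
      calc _ ≤ (q x - p x) * 1 := by
            gcongr; exact Set.indicator_le_self' (by simp) x
        _ = _ := mul_one _
  · ext A hA
    have hi : Measurable (A.indicator (fun _ : S => (1 : ℝ≥0∞))) := measurable_const.indicator hA
    rw [← lintegral_indicator_one hA, ← lintegral_indicator_one hA]
    show ∫⁻ a, A.indicator (fun _ => (1 : ℝ≥0∞)) a ∂_ = ∫⁻ a, A.indicator (fun _ => (1 : ℝ≥0∞)) a ∂_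
    rw [lintegral_map hi measurable_snd, lintegral_map hi measurable_snd,
      pert_lintegral μ γ hp hq (f := fun z => A.indicator (fun _ => (1 : ℝ≥0∞)) z.2) (hi.comp measurable_snd)]
    have e1 : ∫⁻ w, (q w.1 - p w.1) * (1 - q w.2.1 / p w.2.1) * A.indicator (fun _ => (1 : ℝ≥0∞)) w.2.2 ∂(μ.prod γ)
        = (∫⁻ z, (1 - q z.1 / p z.1) * A.indicator (fun _ => (1 : ℝ≥0∞)) z.2 ∂γ) * pertR μ p q := by
      rw [mul_comm]
      unfold pertR
      rw [← lintegral_prod_mul (f := fun x => (q x - p x))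
        (g := fun z : S × S => (1 - q z.1 / p z.1) * A.indicator (fun _ => (1 : ℝ≥0∞)) z.2) (by fun_prop) (by fun_prop)]
      exact lintegral_congr fun w => by ring
    have h1 : Measurable (fun z : S × S => (1 - q z.1 / p z.1) * A.indicator (fun _ => (1 : ℝ≥0∞)) z.2) := by fun_prop
    rw [e1, pertR_cancel hr, ← lintegral_add_right _ h1]
    · refine lintegral_congr fun z => ?_
      rw [← add_mul]
      have : min 1 (q z.1 / p z.1) + (1 - q z.1 / p z.1) = 1 := by
        rcases le_total 1 (q z.1 / p z.1) with h | h
        · rw [min_eq_left h, tsub_eq_zero_of_le h, add_zero]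
        · rw [min_eq_right h]; exact add_tsub_cancel_of_le h
      rw [this, one_mul]
    · intro h0
      refine le_antisymm ?_ zero_le
      rw [← h0, ← hR]
      refine lintegral_mono fun x => ?_
      calc _ ≤ (1 - q x.1 / p x.1) * 1 := by
            gcongr; exact Set.indicator_le_self' (by simp) _
        _ = _ := mul_one _
end

section
variable {S : Type*} [MetricSpace S] [SecondCountableTopology S] [MeasurableSpace S] [BorelSpace S]
variable (μ : Measure S) [SigmaFinite μ] {p q : S → ℝ≥0∞} (γ : Measure (S × S)) [SFinite γ]

lemma pert_cost (hp : Measurable p) (hq : Measurable q) (hp0 : ∀ x, p x ≠ 0) (hpt : ∀ x, p x ≠ ∞)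
    (hp1 : ∫⁻ x, p x ∂μ = 1) (hq1 : ∫⁻ x, q x ∂μ = 1)
    (hγ : γ.map Prod.fst = μ.withDensity p) (x₀ : S) (R : ℝ≥0∞) :
    ∫⁻ z, c2 z ∂(pert μ p q γ) ≤ ∫⁻ z, c2 z ∂γ + (2 * ∫⁻ x, (q x - p x) * c2 (x, x₀) ∂μ
      + 2 * (R * pertR μ p q + ∫⁻ x in {x | R < c2 (x, x₀)}, c2 (x, x₀) ∂(γ.map Prod.snd))) := by
  have hr := pertR_ne_top μ (p := p) hq1
  have hR := pertR_aux μ γ hp hq hp0 hpt hp1 hq1 hγ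
  have hm : Measurable fun x : S => c2 (x, x₀) := c2_meas.comp (measurable_id.prodMk measurable_const)
  have hm2 : Measurable fun z : S × S => c2 (z.2, x₀) := hm.comp measurable_snd
  have hms : MeasurableSet {x : S | R < c2 (x, x₀)} := measurableSet_lt measurable_const hm
  rw [pert_lintegral μ γ hp hq c2_meas]
  refine add_le_add ?_ ?_
  · refine lintegral_mono fun z => ?_
    calc _ ≤ 1 * c2 z := by gcongr; exact min_le_left _ _
      _ = _ := one_mul _
  have e1 : ∫⁻ w, (q w.1 - p w.1) * (1 - q w.2.1 / p w.2.1) * c2 (w.1, w.2.2) ∂(μ.prod γ) ≤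
      2 * ((∫⁻ x, (q x - p x) * c2 (x, x₀) ∂μ) * pertR μ p q) +
      2 * ((∫⁻ z, (1 - q z.1 / p z.1) * c2 (z.2, x₀) ∂γ) * pertR μ p q) := by
    have m1 : Measurable fun x => (q x - p x) * c2 (x, x₀) := (hq.sub hp).mul hm
    have m2 : Measurable fun z : S × S => (1 - q z.1 / p z.1) := by fun_prop
    have m3 : Measurable fun z : S × S => (1 - q z.1 / p z.1) * c2 (z.2, x₀) := m2.mul hm2
    have m4 : Measurable fun x => (q x - p x) := hq.sub hp
    have a1 : (∫⁻ x, (q x - p x) * c2 (x, x₀) ∂μ) * pertR μ p q =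
        ∫⁻ w, (q w.1 - p w.1) * c2 (w.1, x₀) * (1 - q w.2.1 / p w.2.1) ∂(μ.prod γ) := by
      rw [← hR, ← lintegral_prod_mul m1.aemeasurable m2.aemeasurable]
    have a2 : (∫⁻ z, (1 - q z.1 / p z.1) * c2 (z.2, x₀) ∂γ) * pertR μ p q =
        ∫⁻ w, (q w.1 - p w.1) * ((1 - q w.2.1 / p w.2.1) * c2 (w.2.2, x₀)) ∂(μ.prod γ) := by
      rw [mul_comm]
      unfold pertR
      rw [← lintegral_prod_mul m4.aemeasurable m3.aemeasurable]
    have b1 : Measurable fun w : S × S × S => (q w.1 - p w.1) * c2 (w.1, x₀) * (1 - q w.2.1 / p w.2.1) :=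
      (m1.comp measurable_fst).mul (m2.comp measurable_snd)
    have b2 : Measurable fun w : S × S × S => (q w.1 - p w.1) * ((1 - q w.2.1 / p w.2.1) * c2 (w.2.2, x₀)) :=
      (m4.comp measurable_fst).mul (m3.comp measurable_snd)
    rw [a1, a2, ← lintegral_const_mul _ b1, ← lintegral_const_mul _ b2, ← lintegral_add_left (b1.const_mul 2)]
    refine lintegral_mono fun w => ?_
    calc _ ≤ (q w.1 - p w.1) * (1 - q w.2.1 / p w.2.1) * (2 * c2 (w.1, x₀) + 2 * c2 (w.2.2, x₀)) := by
          gcongr; exact c2_le x₀ (w.1, w.2.2)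
      _ = _ := by ring
  have e2 : ∫⁻ z, (1 - q z.1 / p z.1) * c2 (z.2, x₀) ∂γ ≤ R * pertR μ p q
      + ∫⁻ x in {x | R < c2 (x, x₀)}, c2 (x, x₀) ∂(γ.map Prod.snd) := by
    rw [← hR, ← lintegral_indicator hms, lintegral_map (hm.indicator hms) measurable_snd,
      ← lintegral_const_mul _ (by fun_prop), ← lintegral_add_right _ (show Measurable fun z : S × S => {x : S | R < c2 (x, x₀)}.indicator (fun x => c2 (x, x₀)) z.2 from (hm.indicator hms).comp measurable_snd)]
    refine lintegral_mono fun z => ?_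
    by_cases hz : R < c2 (z.2, x₀)
    · rw [Set.indicator_of_mem (show z.2 ∈ {x : S | R < c2 (x, x₀)} from hz)]
      refine le_trans ?_ le_add_self
      calc _ ≤ 1 * c2 (z.2, x₀) := by gcongr; exact tsub_le_self
        _ = _ := one_mul _
    · refine le_trans ?_ le_self_add
      rw [mul_comm]; gcongr; exact not_lt.1 hz
  calc _ ≤ (pertR μ p q)⁻¹ * (2 * ((∫⁻ x, (q x - p x) * c2 (x, x₀) ∂μ) * pertR μ p q) +
      2 * ((∫⁻ z, (1 - q z.1 / p z.1) * c2 (z.2, x₀) ∂γ) * pertR μ p q)) := by gcongr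
    _ = 2 * ((∫⁻ x, (q x - p x) * c2 (x, x₀) ∂μ) * ((pertR μ p q)⁻¹ * pertR μ p q)) +
      2 * ((∫⁻ z, (1 - q z.1 / p z.1) * c2 (z.2, x₀) ∂γ) * ((pertR μ p q)⁻¹ * pertR μ p q)) := by ring
    _ ≤ 2 * ((∫⁻ x, (q x - p x) * c2 (x, x₀) ∂μ) * 1) +
      2 * ((R * pertR μ p q
      + ∫⁻ x in {x | R < c2 (x, x₀)}, c2 (x, x₀) ∂(γ.map Prod.snd)) * 1) := by
        gcongr <;> exact ENNReal.inv_mul_le_one _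
    _ = _ := by rw [mul_one, mul_one]
end

section
variable {S A : Type*} [MeasurableSpace S] [MeasurableSpace A]

lemma aux_withDensity_meas (γ : Measure S) [SFinite γ] {f : A → S → ℝ≥0∞}
    (hf : Measurable (Function.uncurry f)) : Measurable fun a => γ.withDensity (f a) := by
  refine Measure.measurable_of_measurable_coe _ fun s hs => ?_
  simp_rw [withDensity_apply _ hs]
  exact hf.lintegral_prod_right'

lemma pert_meas (μ : Measure S) [SigmaFinite μ] (γ : Measure (S × S)) [SFinite γ]
    {p : S → ℝ≥0∞} (hp : Measurable p) {q : A → S → ℝ≥0∞} (hq : Measurable (Function.uncurry q)) :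
    Measurable fun a => pert μ p (q a) γ := by
  have hR : Measurable fun a => pertR μ p (q a) := by
    unfold pertR
    refine Measurable.lintegral_prod_right' (f := fun z : A × S => q z.1 z.2 - p z.2) ?_
    exact (hq.comp measurable_id).sub (hp.comp measurable_snd)
  have h1 : Measurable fun a => γ.withDensity (fun z => min 1 (q a z.1 / p z.1)) := by
    apply aux_withDensity_meas
    have : Measurable fun w : A × S × S => q w.1 w.2.1 := hq.comp (measurable_fst.prodMk (measurable_fst.comp measurable_snd))
    show Measurable fun w : A × S × S => min 1 (q w.1 w.2.1 / p w.2.1)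
    fun_prop
  have h2 : Measurable fun a => (((μ.prod γ).withDensity
      (fun w => (q a w.1 - p w.1) * (1 - q a w.2.1 / p w.2.1))).map (fun w => (w.1, w.2.2))) := by
    refine (Measure.measurable_map _ (by fun_prop)).comp ?_
    apply aux_withDensity_meas
    have a1 : Measurable fun w : A × S × S × S => q w.1 w.2.1 := hq.comp (measurable_fst.prodMk (by fun_prop))
    have a2 : Measurable fun w : A × S × S × S => q w.1 w.2.2.1 := hq.comp (measurable_fst.prodMk (by fun_prop))
    show Measurable fun w : A × S × S × S => (q w.1 w.2.1 - p w.2.1) * (1 - q w.1 w.2.2.1 / p w.2.2.1)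
    fun_prop
  refine Measure.measurable_of_measurable_coe _ fun s hs => ?_
  unfold pert
  simp only [Measure.add_apply, Measure.smul_apply, smul_eq_mul]
  exact ((Measure.measurable_coe hs).comp h1).add (hR.inv.mul ((Measure.measurable_coe hs).comp h2))
end
end

section
set_option linter.unusedSectionVars false
open scoped Matrix

namespace EF
section
variable {S : Type*} [MeasurableSpace S] {k : ℕ} {μ : Measure S} {t : S → (Fin k → ℝ)}
    {Λ Θ : Set (Fin k → ℝ)} {M : (Fin k → ℝ) → ℝ} {Vinv : (Fin k → ℝ) → (Fin k → ℝ)}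

/-- density of the family -/
def dn (t : S → (Fin k → ℝ)) (M : (Fin k → ℝ) → ℝ) (Vinv : (Fin k → ℝ) → (Fin k → ℝ))
    (θ : Fin k → ℝ) (x : S) : ℝ≥0∞ :=
  ENNReal.ofReal (Real.exp (Vinv θ ⬝ᵥ t x - M (Vinv θ)))

lemma dn_meas1 (h : EF μ t Λ Θ M Vinv) (θ) : Measurable (dn t M Vinv θ) := h.meas_dens (Vinv θ)
lemma dn_ne_top (θ) (x : S) : dn t M Vinv θ x ≠ ∞ := ENNReal.ofReal_ne_top
lemma dn_ne_zero (θ) (x : S) : dn t M Vinv θ x ≠ 0 := by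
  unfold dn; rw [Ne, ENNReal.ofReal_eq_zero, not_le]; exact Real.exp_pos _
lemma dn_one (h : EF μ t Λ Θ M Vinv) {θ} (hθ : θ ∈ Θ) : ∫⁻ x, dn t M Vinv θ x ∂μ = 1 := by
  have := (h.P_prob (h.hVinv θ hθ).1).measure_univ
  rwa [efP, withDensity_apply _ MeasurableSet.univ, Measure.restrict_univ] at this

lemma dn_cont (h : EF μ t Λ Θ M Vinv) (g : S → ℝ) (hg : Measurable g) (hg0 : ∀ x, 0 ≤ g x)
    (hintg : ∀ θ ∈ Θ, Integrable g (efP μ t M (Vinv θ))) {θ} (hθ : θ ∈ Θ) {ε : ℝ≥0∞} (hε : ε ≠ 0) :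
    ∀ᶠ θ' in nhds θ, ∫⁻ x, (dn t M Vinv θ' x - dn t M Vinv θ x) * ENNReal.ofReal (g x) ∂μ ≤ ε ∧
      ∫⁻ x, (dn t M Vinv θ x - dn t M Vinv θ' x) * ENNReal.ofReal (g x) ∂μ ≤ ε := by
  have hO : IsOpen (Λ ∩ efV μ t ⁻¹' Θ) :=
    ContinuousOn.isOpen_inter_preimage (fun y hy => (h.V_cont hy).continuousWithinAt) h.oΛ h.oΘ
  have hi : ∀ y ∈ Λ ∩ efV μ t ⁻¹' Θ, Integrable (fun x => g x * Real.exp (y ⬝ᵥ t x)) μ := by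
    intro y hy
    have := hintg _ hy.2
    rw [h.Vinv_V hy.1 hy.2] at this
    exact (h.P_integrable hy.1 g).1 this
  have hmem : ∀ η ∈ Θ, Vinv η ∈ Λ ∩ efV μ t ⁻¹' Θ := fun η hη =>
    ⟨(h.hVinv η hη).1, by rw [Set.mem_preimage, h.V_Vinv hη]; exact hη⟩
  have ha : ContinuousAt (fun y => Real.exp (-M y)) (Vinv θ) :=
    ((h.M_fd (h.hVinv θ hθ).1).continuousAt).neg.rexp
  have hT := aux_L1cont μ t h.ht _ hO g hg hi (Vinv θ) (hmem θ hθ) _ ha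
  have hT2 := hT.comp (h.Vinv_cont.continuousAt (h.oΘ.mem_nhds hθ)).tendsto
  have hT3 : ∀ᶠ θ' in nhds θ, ∫ x, |g x| * |Real.exp (-M (Vinv θ')) * Real.exp (Vinv θ' ⬝ᵥ t x)
      - Real.exp (-M (Vinv θ)) * Real.exp (Vinv θ ⬝ᵥ t x)| ∂μ < (min ε 1).toReal := by
    refine hT2.eventually (gt_mem_nhds ?_)
    exact ENNReal.toReal_pos (by simp [hε]) (by simp)
  filter_upwards [hT3, h.oΘ.mem_nhds hθ] with θ' h1 hθ'
  have hI : Integrable (fun x => |g x| * |Real.exp (-M (Vinv θ')) * Real.exp (Vinv θ' ⬝ᵥ t x)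
      - Real.exp (-M (Vinv θ)) * Real.exp (Vinv θ ⬝ᵥ t x)|) μ := by
    have := (((hi _ (hmem θ' hθ')).const_mul (Real.exp (-M (Vinv θ')))).sub
      ((hi _ (hmem θ hθ)).const_mul (Real.exp (-M (Vinv θ))))).abs
    refine this.congr (Filter.Eventually.of_forall fun x => ?_)
    simp only [Pi.sub_apply]
    rw [← abs_mul]; congr 1; ring
  have key : ∫⁻ x, ENNReal.ofReal (|g x| * |Real.exp (-M (Vinv θ')) * Real.exp (Vinv θ' ⬝ᵥ t x)
      - Real.exp (-M (Vinv θ)) * Real.exp (Vinv θ ⬝ᵥ t x)|) ∂μ ≤ ε := by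
    rw [← ofReal_integral_eq_lintegral_ofReal hI (Filter.Eventually.of_forall fun x => by positivity)]
    refine (ENNReal.ofReal_le_ofReal h1.le).trans ?_
    rw [ENNReal.ofReal_toReal (by simp)]
    exact min_le_left _ _
  have e : ∀ η x, dn t M Vinv η x = ENNReal.ofReal (Real.exp (-M (Vinv η)) * Real.exp (Vinv η ⬝ᵥ t x)) := by
    intro η x; rw [dn, ← Real.exp_add]; congr 2; ring
  constructor
  · refine le_trans (lintegral_mono fun x => ?_) key
    rw [e, e, ← ENNReal.ofReal_sub _ (by positivity), abs_of_nonneg (hg0 x), mul_comm,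
      ENNReal.ofReal_mul (hg0 x)]
    gcongr; exact le_abs_self _
  · refine le_trans (lintegral_mono fun x => ?_) key
    rw [e, e, ← ENNReal.ofReal_sub _ (by positivity), abs_of_nonneg (hg0 x), mul_comm,
      ENNReal.ofReal_mul (hg0 x), abs_sub_comm]
    gcongr; exact le_abs_self _
end

section
variable {S : Type*} [MetricSpace S] [SecondCountableTopology S] [MeasurableSpace S] [BorelSpace S]
    {k : ℕ} {μ : Measure S} {t : S → (Fin k → ℝ)}
    {Λ Θ : Set (Fin k → ℝ)} {M : (Fin k → ℝ) → ℝ} {Vinv : (Fin k → ℝ) → (Fin k → ℝ)}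

lemma aux_tail (x₀ : S) (ν : Measure S) (hν : ∫⁻ x, c2 (x, x₀) ∂ν ≠ ∞) {ε : ℝ≥0∞} (hε : ε ≠ 0) :
    ∃ R : ℕ, ∫⁻ x in {x | (R : ℝ≥0∞) < c2 (x, x₀)}, c2 (x, x₀) ∂ν ≤ ε := by
  have hm : Measurable fun x : S => c2 (x, x₀) := c2_meas.comp (measurable_id.prodMk measurable_const)
  have hms : ∀ R : ℕ, MeasurableSet {x : S | (R : ℝ≥0∞) < c2 (x, x₀)} := fun R =>
    measurableSet_lt measurable_const hm
  have h1 : Filter.Tendsto (fun R : ℕ => ∫⁻ x, {x : S | (R : ℝ≥0∞) < c2 (x, x₀)}.indicator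
      (fun x => c2 (x, x₀)) x ∂ν) Filter.atTop (nhds (∫⁻ _, 0 ∂ν)) := by
    refine tendsto_lintegral_of_dominated_convergence (fun x => c2 (x, x₀))
      (fun R => hm.indicator (hms R)) (fun R => Filter.Eventually.of_forall fun x =>
        Set.indicator_le_self _ _ _) hν (Filter.Eventually.of_forall fun x => ?_)
    have hx : c2 (x, x₀) ≠ ∞ := ENNReal.ofReal_ne_top
    obtain ⟨N, hN⟩ := ENNReal.exists_nat_gt hx
    refine tendsto_const_nhds.congr' ?_
    filter_upwards [Filter.eventually_ge_atTop N] with R hR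
    rw [Set.indicator_of_notMem]
    simp only [Set.mem_ofPred_eq, not_lt]
    exact hN.le.trans (by exact_mod_cast hR)
  rw [lintegral_zero] at h1
  obtain ⟨R, hR⟩ := (h1.eventually (gt_mem_nhds (pos_iff_ne_zero.2 hε))).exists
  exact ⟨R, by rw [← lintegral_indicator (hms R)]; exact hR.le⟩

lemma cpl_fin {γ : Measure (S × S)} {p ν : Measure S} [IsProbabilityMeasure p] (h : IsCpl γ p ν) :
    IsProbabilityMeasure γ := by
  constructor
  have h1 : γ.map Prod.fst Set.univ = 1 := by rw [h.1]; exact measure_univ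
  rwa [Measure.map_apply measurable_fst MeasurableSet.univ, Set.preimage_univ] at h1

lemma near (h : EF μ t Λ Θ M Vinv) (x₀ : S)
    (hmom : ∀ θ ∈ Θ, ∫⁻ x, c2 (x, x₀) ∂(efP μ t M (Vinv θ)) ≠ ∞)
    (ν : Measure S) (hν : ∫⁻ x, c2 (x, x₀) ∂ν ≠ ∞) {θ} (hθ : θ ∈ Θ) {ε : ℝ≥0∞} (hε : ε ≠ 0) :
    ∀ᶠ θ' in nhds θ, θ' ∈ Θ ∧
      (∀ γ, IsCpl γ (efP μ t M (Vinv θ')) ν →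
        ∫⁻ z, c2 z ∂(pert μ (dn t M Vinv θ') (dn t M Vinv θ) γ) ≤ ∫⁻ z, c2 z ∂γ + ε) ∧
      (∀ γ, IsCpl γ (efP μ t M (Vinv θ)) ν →
        ∫⁻ z, c2 z ∂(pert μ (dn t M Vinv θ) (dn t M Vinv θ') γ) ≤ ∫⁻ z, c2 z ∂γ + ε) := by
  have := h.sf
  have h8 : ε / 8 ≠ 0 := by simp [hε]
  obtain ⟨R, hR⟩ := aux_tail x₀ ν hν h8
  have hI2 : ∀ θ ∈ Θ, Integrable (fun x => dist x x₀ ^ 2) (efP μ t M (Vinv θ)) := by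
    intro θ hθ
    refine ⟨((measurable_id.dist measurable_const).pow_const 2).aestronglyMeasurable, ?_⟩
    rw [hasFiniteIntegral_iff_ofReal (Filter.Eventually.of_forall fun x => by positivity)]
    exact (hmom θ hθ).lt_top
  have hI1 : ∀ θ ∈ Θ, Integrable (fun _ : S => (1 : ℝ)) (efP μ t M (Vinv θ)) := by
    intro θ hθ
    have := h.P_prob (h.hVinv θ hθ).1
    exact integrable_const 1
  have c1 := h.dn_cont (fun x => dist x x₀ ^ 2) ((measurable_id.dist measurable_const).pow_const 2)
    (fun x => by positivity) hI2 hθ h8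
  have c2' := h.dn_cont (fun _ => 1) measurable_const (fun x => by positivity) hI1 hθ
    (ε := ε / 8 / (R + 1)) (by simp [hε])
  filter_upwards [c1, c2', h.oΘ.mem_nhds hθ] with θ' ⟨a1, a2⟩ ⟨b1, b2⟩ hθ'
  simp only [ENNReal.ofReal_one, mul_one] at b1 b2
  have hb : ∀ r : ℝ≥0∞, r ≤ ε / 8 / (R + 1) → (R : ℝ≥0∞) * r ≤ ε / 8 := by
    intro r hr
    calc (R : ℝ≥0∞) * r ≤ (R + 1) * (ε / 8 / (R + 1)) := by gcongr; exact le_self_add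
      _ ≤ ε / 8 := ENNReal.mul_div_le
  have h88 : 2 * (ε / 8) + 2 * (ε / 8 + ε / 8) ≤ ε := by
    calc 2 * (ε / 8) + 2 * (ε / 8 + ε / 8) = 6 * (ε / 8) := by ring
      _ ≤ 8 * (ε / 8) := by gcongr; norm_num
      _ ≤ ε := ENNReal.mul_div_le
  refine ⟨hθ', fun γ hγ => ?_, fun γ hγ => ?_⟩
  · have := h.P_prob (h.hVinv θ' hθ').1
    have := cpl_fin hγ
    refine (pert_cost μ γ (h.dn_meas1 θ') (h.dn_meas1 θ) (dn_ne_zero θ') (dn_ne_top θ') (h.dn_one hθ')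
      (h.dn_one hθ) hγ.1 x₀ R).trans ?_
    rw [hγ.2]
    gcongr
    refine le_trans ?_ h88
    gcongr
    · exact a2
    · exact hb _ b2
  · have := h.P_prob (h.hVinv θ hθ).1
    have := cpl_fin hγ
    refine (pert_cost μ γ (h.dn_meas1 θ) (h.dn_meas1 θ') (dn_ne_zero θ) (dn_ne_top θ) (h.dn_one hθ)
      (h.dn_one hθ') hγ.1 x₀ R).trans ?_
    rw [hγ.2]
    gcongr
    refine le_trans ?_ h88
    gcongr
    · exact a1
    · exact hb _ b1

lemma pert_cpl' (h : EF μ t Λ Θ M Vinv) {θ θ'} (hθ : θ ∈ Θ) (hθ' : θ' ∈ Θ) {ν : Measure S}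
    {γ : Measure (S × S)} (hγ : IsCpl γ (efP μ t M (Vinv θ)) ν) :
    IsCpl (pert μ (dn t M Vinv θ) (dn t M Vinv θ') γ) (efP μ t M (Vinv θ')) ν := by
  have := h.sf
  have := h.P_prob (h.hVinv θ hθ).1
  have := cpl_fin hγ
  have := pert_cpl μ γ (h.dn_meas1 θ) (h.dn_meas1 θ') (dn_ne_zero θ) (dn_ne_top θ) (h.dn_one hθ)
      (h.dn_one hθ') hγ.1
  exact ⟨this.1, this.2.trans hγ.2⟩

lemma near_w (h : EF μ t Λ Θ M Vinv) (x₀ : S)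
    (hmom : ∀ θ ∈ Θ, ∫⁻ x, c2 (x, x₀) ∂(efP μ t M (Vinv θ)) ≠ ∞)
    (ν : Measure S) (hν : ∫⁻ x, c2 (x, x₀) ∂ν ≠ ∞) {θ} (hθ : θ ∈ Θ) {ε : ℝ≥0∞} (hε : ε ≠ 0) :
    ∀ᶠ θ' in nhds θ, wcost (efP μ t M (Vinv θ)) ν ≤ wcost (efP μ t M (Vinv θ')) ν + ε ∧
      wcost (efP μ t M (Vinv θ')) ν ≤ wcost (efP μ t M (Vinv θ)) ν + ε := by
  filter_upwards [h.near x₀ hmom ν hν hθ hε] with θ' ⟨hθ', h1, h2⟩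
  constructor
  · conv_rhs => rw [wcost]
    simp only [ENNReal.iInf_add]
    exact le_iInf₂ fun γ hγ => (wcost_le (h.pert_cpl' hθ' hθ hγ)).trans (h1 γ hγ)
  · conv_rhs => rw [wcost]
    simp only [ENNReal.iInf_add]
    exact le_iInf₂ fun γ hγ => (wcost_le (h.pert_cpl' hθ hθ' hγ)).trans (h2 γ hγ)

lemma wcost_cont (h : EF μ t Λ Θ M Vinv) (x₀ : S)
    (hmom : ∀ θ ∈ Θ, ∫⁻ x, c2 (x, x₀) ∂(efP μ t M (Vinv θ)) ≠ ∞)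
    (ν : Measure S) [IsProbabilityMeasure ν] (hν : ∫⁻ x, c2 (x, x₀) ∂ν ≠ ∞) :
    Continuous fun θ : Θ => wcost (efP μ t M (Vinv θ)) ν := by
  have : ContinuousOn (fun θ => wcost (efP μ t M (Vinv θ)) ν) Θ := by
    intro θ hθ
    refine ContinuousAt.continuousWithinAt ?_
    have := h.P_prob (h.hVinv θ hθ).1
    refine (ENNReal.tendsto_nhds (wcost_ne_top x₀ _ _ (hmom θ hθ) hν)).2 fun ε hε => ?_
    filter_upwards [h.near_w x₀ hmom ν hν hθ hε.ne'] with θ' h1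
    exact ⟨tsub_le_iff_right.2 h1.1, h1.2⟩
  exact continuousOn_iff_continuous_domRestrict.1 this

lemma wcost_meas (h : EF μ t Λ Θ M Vinv) (x₀ : S)
    (hmom : ∀ θ ∈ Θ, ∫⁻ x, c2 (x, x₀) ∂(efP μ t M (Vinv θ)) ≠ ∞) {θ₀ : Fin k → ℝ} (h0 : θ₀ ∈ Θ) :
    Measurable fun z : (Fin k → ℝ) × (Fin k → ℝ) =>
      wcost (efG μ t Θ M Vinv θ₀ z.1) (efG μ t Θ M Vinv θ₀ z.2) := by
  have h1 : ∀ η : Θ, Continuous fun θ : Θ => wcost (efP μ t M (Vinv θ)) (efP μ t M (Vinv η)) := by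
    intro η
    have := h.P_prob (h.hVinv η η.2).1
    exact h.wcost_cont x₀ hmom _ (hmom η η.2)
  have h3 : ∀ θ : Θ, Measurable fun η : Θ => wcost (efP μ t M (Vinv θ)) (efP μ t M (Vinv η)) := by
    intro θ
    have e : (fun η : Θ => wcost (efP μ t M (Vinv θ)) (efP μ t M (Vinv η))) =
        fun η : Θ => wcost (efP μ t M (Vinv η)) (efP μ t M (Vinv θ)) := by
      funext η; exact wcost_comm _ _
    rw [e]; exact (h1 θ).measurable
  have h2 := measurable_uncurry_of_continuous_of_measurable
    (u := fun (θ : Θ) (η : Θ) => wcost (efP μ t M (Vinv θ)) (efP μ t M (Vinv η))) h1 h3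
  have hr0 : Measurable fun θ => rr Θ θ₀ θ := rr_meas h.oΘ (fun θ => θ) continuousOn_id
  have hr : Measurable fun θ => (⟨rr Θ θ₀ θ, rr_mem h0 θ⟩ : Θ) := hr0.subtype_mk
  have hr2 : Measurable fun z : (Fin k → ℝ) × (Fin k → ℝ) =>
      ((⟨rr Θ θ₀ z.1, rr_mem h0 z.1⟩ : Θ), (⟨rr Θ θ₀ z.2, rr_mem h0 z.2⟩ : Θ)) :=
    (hr.comp measurable_fst).prodMk (hr.comp measurable_snd)
  have h5 := h2.comp hr2
  simp only [Function.comp_def, Function.uncurry] at h5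
  unfold efG
  exact h5

lemma select (h : EF μ t Λ Θ M Vinv) (x₀ : S)
    (hmom : ∀ θ ∈ Θ, ∫⁻ x, c2 (x, x₀) ∂(efP μ t M (Vinv θ)) ≠ ∞) {θ₀ : Fin k → ℝ} (h0 : θ₀ ∈ Θ)
    (η : Fin k → ℝ) {ε : ℝ≥0∞} (hε : ε ≠ 0) :
    ∃ Γ : (Fin k → ℝ) → Measure (S × S), Measurable Γ ∧ ∀ θ,
      IsCpl (Γ θ) (efG μ t Θ M Vinv θ₀ θ) (efG μ t Θ M Vinv θ₀ η) ∧
      ∫⁻ z, c2 z ∂(Γ θ) ≤ wcost (efG μ t Θ M Vinv θ₀ θ) (efG μ t Θ M Vinv θ₀ η) + ε := by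
  have := h.sf
  have : Nonempty Θ := ⟨⟨θ₀, h0⟩⟩
  have hη := rr_mem h0 η
  set ν := efG μ t Θ M Vinv θ₀ η with hνdef
  have : IsProbabilityMeasure ν := h.G_prob h0 η
  have hν : ∫⁻ x, c2 (x, x₀) ∂ν ≠ ∞ := hmom _ hη
  have h4 : ε / 4 ≠ 0 := by simp [hε]
  let d : ℕ → Θ := TopologicalSpace.denseSeq Θ
  have hex : ∀ i, ∃ γ, IsCpl γ (efP μ t M (Vinv (d i))) ν ∧
      ∫⁻ z, c2 z ∂γ < wcost (efP μ t M (Vinv (d i))) ν + ε / 4 := by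
    intro i
    have := h.P_prob (h.hVinv _ (d i).2).1
    exact exists_cpl (wcost_ne_top x₀ _ _ (hmom _ (d i).2) hν) h4
  choose γ hγ hγc using hex
  have hfin : ∀ i, IsProbabilityMeasure (γ i) := fun i => by
    have := h.P_prob (h.hVinv _ (d i).2).1
    exact cpl_fin (hγ i)
  let F : ℕ → (Fin k → ℝ) → Measure (S × S) := fun i θ =>
    pert μ (dn t M Vinv (d i)) (dn t M Vinv (rr Θ θ₀ θ)) (γ i)
  have hF : ∀ i, Measurable (F i) := fun i => by
    have := hfin i
    exact pert_meas μ (γ i) (h.dn_meas1 (d i)) (h.dens_meas θ₀)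
  have hc : Measurable fun θ : Fin k → ℝ => (θ, η) := measurable_id.prodMk measurable_const
  have hW : Measurable fun θ => wcost (efG μ t Θ M Vinv θ₀ θ) ν := by
    have h5 := (h.wcost_meas x₀ hmom h0).comp hc
    simp only [Function.comp_def] at h5
    exact h5
  let p : ℕ → (Fin k → ℝ) → Prop := fun i θ =>
    ∫⁻ z, c2 z ∂(F i θ) ≤ wcost (efG μ t Θ M Vinv θ₀ θ) ν + ε
  have hp : ∀ i, MeasurableSet {θ | p i θ} := fun i =>
    measurableSet_le ((Measure.measurable_lintegral c2_meas).comp (hF i)) (hW.add_const _)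
  have hpe : ∀ θ, ∃ i, p i θ := by
    intro θ
    have hθ := rr_mem h0 θ
    have hn := (h.near x₀ hmom ν hν hθ h4).and (h.near_w x₀ hmom ν hν hθ h4)
    have hct : Filter.Tendsto (Subtype.val : Θ → (Fin k → ℝ)) (nhds ⟨rr Θ θ₀ θ, hθ⟩)
        (nhds (rr Θ θ₀ θ)) := continuous_subtype_val.continuousAt
    have hn2 := hct.eventually hn
    obtain ⟨U, hU, hUo, hUm⟩ := eventually_nhds_iff.1 hn2
    obtain ⟨i, hi⟩ := (TopologicalSpace.denseRange_denseSeq Θ).exists_mem_open hUo ⟨_, hUm⟩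
    refine ⟨i, ?_⟩
    obtain ⟨⟨-, h1, -⟩, -, h2⟩ := hU _ hi
    calc ∫⁻ z, c2 z ∂(F i θ) ≤ ∫⁻ z, c2 z ∂(γ i) + ε / 4 := h1 _ (hγ i)
      _ ≤ (wcost (efP μ t M (Vinv (d i))) ν + ε / 4) + ε / 4 := by gcongr; exact (hγc i).le
      _ ≤ ((wcost (efP μ t M (Vinv (rr Θ θ₀ θ))) ν + ε / 4) + ε / 4) + ε / 4 := by
          gcongr
      _ = wcost (efP μ t M (Vinv (rr Θ θ₀ θ))) ν + 3 * (ε / 4) := by ring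
      _ ≤ wcost (efP μ t M (Vinv (rr Θ θ₀ θ))) ν + 4 * (ε / 4) := by gcongr; norm_num
      _ ≤ wcost (efP μ t M (Vinv (rr Θ θ₀ θ))) ν + ε := by gcongr; exact ENNReal.mul_div_le
  classical
  refine ⟨fun θ => F (Nat.find (hpe θ)) θ, Measurable.find hF hp hpe, fun θ => ⟨?_, ?_⟩⟩
  · exact h.pert_cpl' (d _).2 (rr_mem h0 θ) (hγ _)
  · exact Nat.find_spec (hpe θ)
end
end EF
end

section
set_option linter.unusedSectionVars false

lemma aux_lintegral_map_le {X Y : Type*} [MeasurableSpace X] [MeasurableSpace Y] (m : Measure X)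
    (g : X → Y) (hg : Measurable g) (f : Y → ℝ≥0∞) :
    ∫⁻ y, f y ∂(m.map g) ≤ ∫⁻ x, f (g x) ∂m := by
  obtain ⟨φ, hφ, hle, he⟩ := exists_measurable_le_lintegral_eq (m.map g) f
  rw [he, lintegral_map hφ hg]
  exact lintegral_mono fun x => hle _

lemma empShift_meas {S : Type*} [MeasurableSpace S] (n m : ℕ) :
    Measurable (empShift (S := S) n m) := by
  refine Measure.measurable_of_measurable_coe _ fun s hs => ?_
  unfold empShift
  simp only [Measure.smul_apply, Measure.finsetSum_apply, smul_eq_mul]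
  refine Measurable.const_mul ?_ _
  refine Finset.measurable_fun_sum _ fun i _ => ?_
  exact (Measure.measurable_coe hs).comp (Measure.measurable_dirac.comp (measurable_pi_apply _))

lemma empShift_prob {S : Type*} [MeasurableSpace S] (n : ℕ) {m : ℕ} (hm : 1 ≤ m) (ω : ℕ → S) :
    IsProbabilityMeasure (empShift n m ω) := by
  constructor
  unfold empShift
  simp only [Measure.smul_apply, Measure.finsetSum_apply, smul_eq_mul, measure_univ]
  simp
  rw [ENNReal.inv_mul_cancel] <;> simp
  omega

lemma empShift_map {S X : Type*} [MeasurableSpace S] [MeasurableSpace X] (n m : ℕ) (z : ℕ → X)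
    (f : X → S) (hf : Measurable f) :
    (empShift n m z).map f = empShift n m (fun i => f (z i)) := by
  ext s hs
  rw [Measure.map_apply hf hs]
  unfold empShift
  simp only [Measure.smul_apply, Measure.finsetSum_apply, smul_eq_mul]
  congr 1
  refine Finset.sum_congr rfl fun i _ => ?_
  rw [Measure.dirac_apply' _ (hf hs), Measure.dirac_apply' _ hs]; rfl

section
variable {S : Type*} [MetricSpace S] [SecondCountableTopology S] [MeasurableSpace S] [BorelSpace S]

lemma emp_cost (n m : ℕ) (z : ℕ → S × S) :
    ENNReal.ofReal (wassW (fun u v => dist u v) 2 (empShift n m (fun i => (z i).1))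
      (empShift n m (fun i => (z i).2)) ^ 2) ≤
      (m : ℝ≥0∞)⁻¹ * ∑ i ∈ Finset.range m, c2 (z (i + n)) := by
  refine (aux_wassW_le _ _ _ (empShift n m z) (empShift_map n m z _ measurable_fst)
    (empShift_map n m z _ measurable_snd)).trans (le_of_eq ?_)
  change ∫⁻ x, c2 x ∂(empShift n m z) = _
  unfold empShift
  rw [lintegral_smul_measure, lintegral_finsetSum_measure, smul_eq_mul]
  congr 1
  refine Finset.sum_congr rfl fun i _ => ?_
  rw [lintegral_dirac' _ c2_meas]

lemma outer_i {Y : Type*} [MeasurableSpace Y] (Q : Measure Y) [IsProbabilityMeasure Q]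
    (G : Y → Measure S) (hG : Measurable G) (ν : Measure S) :
    ENNReal.ofReal (wassW (fun μ' ν => wassW (fun u v : S => dist u v) 2 μ' ν) 2 (Q.map G)
      (Measure.dirac ν) ^ 2) ≤
      ∫⁻ y, ENNReal.ofReal (wassW (fun u v : S => dist u v) 2 (G y) ν ^ 2) ∂Q := by
  have hm : Measurable fun y => (G y, ν) := hG.prodMk measurable_const
  refine (aux_wassW_le _ _ _ (Q.map fun y => (G y, ν)) ?_ ?_).trans (aux_lintegral_map_le Q _ hm _)
  · rw [Measure.map_map measurable_fst hm]; rfl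
  · rw [Measure.map_map measurable_snd hm]
    have : (Prod.snd ∘ fun y => (G y, ν)) = fun _ => ν := rfl
    rw [this, Measure.map_const]; simp

lemma outer_ii {Y : Type*} [MeasurableSpace Y] (Q : Measure Y) [IsProbabilityMeasure Q]
    (G : Y → Measure S) (Γ : Y → Measure (S × S)) (hΓ : Measurable Γ) (ν : Measure S)
    [hGp : ∀ y, IsProbabilityMeasure (G y)] [IsProbabilityMeasure ν]
    (hcpl : ∀ y, IsCpl (Γ y) (G y) ν) (n : ℕ) {m : ℕ} (hm : 1 ≤ m) :
    ENNReal.ofReal (wassW (fun μ' ν => wassW (fun u v : S => dist u v) 2 μ' ν) 2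
      (Q.bind fun y => (Measure.infinitePi (fun _ : ℕ => G y)).map (empShift n m))
      ((Measure.infinitePi (fun _ : ℕ => ν)).map (empShift n m)) ^ 2) ≤
      ∫⁻ y, ∫⁻ z, c2 z ∂(Γ y) ∂Q := by
  haveI hΓp : ∀ y, IsProbabilityMeasure (Γ y) := fun y => EF.cpl_fin (hcpl y)
  have hI := aux_infinitePi_meas Γ hΓ
  have e1 : Measurable fun z : ℕ → S × S => fun i => (z i).1 := by fun_prop
  have e2 : Measurable fun z : ℕ → S × S => fun i => (z i).2 := by fun_prop
  have g1 := (empShift_meas (S := S) n m).comp e1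
  have g2 := (empShift_meas (S := S) n m).comp e2
  simp only [Function.comp_def] at g1 g2
  have hg : Measurable fun z : ℕ → S × S =>
    (empShift n m (fun i => (z i).1), empShift n m (fun i => (z i).2)) := g1.prodMk g2
  have m1 : ∀ y, (Measure.infinitePi (fun _ : ℕ => Γ y)).map (fun z i => (z i).1) =
      Measure.infinitePi (fun _ : ℕ => G y) := by
    intro y
    rw [Measure.infinitePi_map_pi (fun _ : ℕ => Γ y) (f := fun _ z => z.1) (fun _ => measurable_fst)]
    simp only [(hcpl y).1]
  have m2 : ∀ y, (Measure.infinitePi (fun _ : ℕ => Γ y)).map (fun z i => (z i).2) =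
      Measure.infinitePi (fun _ : ℕ => ν) := by
    intro y
    rw [Measure.infinitePi_map_pi (fun _ : ℕ => Γ y) (f := fun _ z => z.2) (fun _ => measurable_snd)]
    simp only [(hcpl y).2]
  set g : (ℕ → S × S) → Measure S × Measure S := fun z =>
    (empShift n m (fun i => (z i).1), empShift n m (fun i => (z i).2)) with hgdef
  set K := (Q.bind fun y => Measure.infinitePi (fun _ : ℕ => Γ y)) with hK
  set N1 := (Q.bind fun y => (Measure.infinitePi (fun _ : ℕ => G y)).map (empShift n m)) with hN1
  set N2 := ((Measure.infinitePi (fun _ : ℕ => ν)).map (empShift n m)) with hN2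
  have k1 : (K.map g).map Prod.fst = N1 := by
    rw [Measure.map_map measurable_fst hg]
    have hc : Prod.fst ∘ g = fun z => empShift n m (fun i => (z i).1) := rfl
    rw [hc, hN1, hK]
    ext s hs
    have hmm : Measurable fun y => (Measure.infinitePi (fun _ : ℕ => G y)).map (empShift n m) := by
      have : (fun y => (Measure.infinitePi (fun _ : ℕ => G y)).map (empShift n m)) =
        fun y => ((Measure.infinitePi (fun _ : ℕ => Γ y)).map (fun z i => (z i).1)).map (empShift n m) := by
        funext y; rw [m1]
      rw [this]
      exact (Measure.measurable_map _ (empShift_meas n m)).comp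
        ((Measure.measurable_map _ e1).comp hI)
    rw [Measure.map_apply g1 hs,
      Measure.bind_apply (g1 hs) hI.aemeasurable, Measure.bind_apply hs hmm.aemeasurable]
    refine lintegral_congr fun y => ?_
    rw [← m1 y, Measure.map_map (empShift_meas n m) e1, Function.comp_def, Measure.map_apply g1 hs]
  have k2 : (K.map g).map Prod.snd = N2 := by
    rw [Measure.map_map measurable_snd hg]
    have hc : Prod.snd ∘ g = fun z => empShift n m (fun i => (z i).2) := rfl
    rw [hc, hN2, hK]
    ext s hs
    rw [Measure.map_apply g2 hs, Measure.bind_apply (g2 hs) hI.aemeasurable]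
    have : ∀ y, Measure.infinitePi (fun _ : ℕ => Γ y)
        ((fun z => empShift n m (fun i => (z i).2)) ⁻¹' s) =
        ((Measure.infinitePi (fun _ : ℕ => ν)).map (empShift n m)) s := by
      intro y
      rw [← m2 y, Measure.map_map (empShift_meas n m) e2, Function.comp_def, Measure.map_apply g2 hs]
    refine (lintegral_congr fun y => this y).trans ?_
    simp
  have k3 : ∫⁻ z, ENNReal.ofReal (wassW (fun u v : S => dist u v) 2 (g z).1 (g z).2 ^ 2) ∂K ≤
    ∫⁻ y, ∫⁻ z, c2 z ∂(Γ y) ∂Q := by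
    have hci : ∀ j : ℕ, Measurable fun z : ℕ → S × S => c2 (z j) := by
      intro j
      have h1 := c2_meas.comp (measurable_pi_apply (X := fun _ : ℕ => S × S) j)
      simp only [Function.comp_def] at h1
      exact h1
    have hsm : Measurable fun z : ℕ → S × S =>
        (m : ℝ≥0∞)⁻¹ * ∑ i ∈ Finset.range m, c2 (z (i + n)) :=
      (Finset.measurable_fun_sum _ fun i _ => hci _).const_mul _
    refine (lintegral_mono fun z => emp_cost n m z).trans (le_of_eq ?_)
    rw [Measure.lintegral_bind hI.aemeasurable hsm.aemeasurable]
    refine lintegral_congr fun y => ?_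
    rw [lintegral_const_mul _
      (Finset.measurable_fun_sum _ fun i _ => hci _),
      lintegral_finsetSum _ fun i _ => hci _]
    have : ∀ j, ∫⁻ z : ℕ → S × S, c2 (z j) ∂(Measure.infinitePi (fun _ : ℕ => Γ y)) =
        ∫⁻ z, c2 z ∂(Γ y) := by
      intro j
      rw [← lintegral_map c2_meas (measurable_pi_apply j),
        show (Measure.infinitePi (fun _ : ℕ => Γ y)).map (fun z => z j) = Γ y from
          Measure.infinitePi_map_eval _ j]
    simp only [this, Finset.sum_const, Finset.card_range, nsmul_eq_mul]
    rw [← mul_assoc, ENNReal.inv_mul_cancel, one_mul] <;> simp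
    omega
  · have k4 := aux_wassW_le (fun μ' ν => wassW (fun u v : S => dist u v) 2 μ' ν) N1 N2 (K.map g) k1 k2
    have k5 := aux_lintegral_map_le K g hg
      (fun z => ENNReal.ofReal (wassW (fun u v : S => dist u v) 2 z.1 z.2 ^ 2))
    exact k4.trans (k5.trans k3)
end
end

section
set_option linter.unusedSectionVars false

lemma aux_indep_emp {S : Type*} [MeasurableSpace S] (p : Measure S) [IsProbabilityMeasure p]
    (n m : ℕ) (A : Set (Fin n → S)) (hA : MeasurableSet A) (B : Set (Measure S))
    (hB : MeasurableSet B) :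
    Measure.infinitePi (fun _ : ℕ => p)
      ((fun (ω : ℕ → S) (i : Fin n) => ω i) ⁻¹' A ∩ empShift n m ⁻¹' B) =
    Measure.infinitePi (fun _ : ℕ => p) ((fun (ω : ℕ → S) (i : Fin n) => ω i) ⁻¹' A) *
      Measure.infinitePi (fun _ : ℕ => p) (empShift n m ⁻¹' B) := by
  have h1 : iIndepFun (fun (i : ℕ) (ω : ℕ → S) => ω i) (Measure.infinitePi (fun _ : ℕ => p)) :=
    iIndepFun_infinitePi (X := fun (_ : ℕ) (x : S) => x) (fun _ => measurable_id)
  have hd : Disjoint (Finset.range n) (Finset.Ico n (n + m)) := by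
    rw [Finset.disjoint_left]; intro a ha hb
    simp at ha hb; omega
  have h2 := h1.indepFun_finset (Finset.range n) (Finset.Ico n (n + m)) hd
    (fun i => measurable_pi_apply i)
  let φ : (Finset.range n → S) → (Fin n → S) := fun u i => u ⟨i, Finset.mem_range.2 i.2⟩
  let ψ : (Finset.Ico n (n + m) → S) → Measure S := fun u =>
    (m : ℝ≥0∞)⁻¹ • ∑ i : Fin m, Measure.dirac (u ⟨(i : ℕ) + n, by simp; omega⟩)
  have hφ : Measurable φ := measurable_pi_lambda _ fun i => measurable_pi_apply _
  have hψ : Measurable ψ := by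
    refine Measure.measurable_of_measurable_coe _ fun s hs => ?_
    simp only [ψ, Measure.smul_apply, Measure.finsetSum_apply, smul_eq_mul]
    refine Measurable.const_mul ?_ _
    refine Finset.measurable_fun_sum _ fun i _ => ?_
    exact (Measure.measurable_coe hs).comp (Measure.measurable_dirac.comp (measurable_pi_apply _))
  have h3 := h2.comp hφ hψ
  have h4 := h3.measure_inter_preimage_eq_mul A B hA hB
  have e : empShift n m = ψ ∘ fun (ω : ℕ → S) (i : Finset.Ico n (n + m)) => ω i := by
    funext ω
    simp only [empShift, ψ, Function.comp_def]
    rw [Finset.sum_range]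
  rw [e]
  exact h4

lemma aux_qm {S Y : Type*} [MeasurableSpace S] [MeasurableSpace.CountablyGenerated S]
    [MeasurableSpace Y]
    (iid : Measure S → Measure (ℕ → S))
    (hiid : ∀ 𝔭 : Measure S, IsProbabilityMeasure 𝔭 →
      IsProbabilityMeasure (iid 𝔭) ∧
        ∀ (n : ℕ) (A : Fin n → Set S), (∀ i, MeasurableSet (A i)) →
          iid 𝔭 {ω | ∀ i : Fin n, ω (i : ℕ) ∈ A i} = ∏ i, 𝔭 (A i))
    (ρ : Measure (ℕ → S)) [IsProbabilityMeasure ρ]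
    (ptilde : (ℕ → S) → Measure S) (hptilde_meas : Measurable ptilde)
    (hdirect : ∀ C : Set (ℕ → S), MeasurableSet C → ∀ B : Set (Measure S), MeasurableSet B →
      ρ (C ∩ ptilde ⁻¹' B) = ∫⁻ ω in ptilde ⁻¹' B, iid (ptilde ω) C ∂ρ)
    (θt : (ℕ → S) → Y) (hθm : Measurable θt) (G : Y → Measure S) (hG : Measurable G)
    [hGp : ∀ y, IsProbabilityMeasure (G y)] (T : Measure S → Y) (hT : Measurable T)
    (hθ : ∀ᵐ ω ∂ρ, ptilde ω = G (θt ω) ∧ T (ptilde ω) = θt ω)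
    (n m : ℕ) (hm : 1 ≤ m) (κ : (Fin n → S) → Measure Y) (hκp : ∀ v, IsProbabilityMeasure (κ v))
    (hκ : Measurable κ)
    (hpost : ∀ (A : Set (Fin n → S)), MeasurableSet A → ∀ B : Set Y, MeasurableSet B →
        ρ {ω | (fun i : Fin n => ω (i : ℕ)) ∈ A ∧ θt ω ∈ B}
          = ∫⁻ ω in {ω | (fun i : Fin n => ω (i : ℕ)) ∈ A},
              κ (fun i : Fin n => ω (i : ℕ)) B ∂ρ)
    (q : (Fin n → S) → Measure (Measure S)) (hqp : ∀ v, IsProbabilityMeasure (q v))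
    (hq : Measurable q)
    (hqm : ∀ (A : Set (Fin n → S)), MeasurableSet A → ∀ B : Set (Measure S), MeasurableSet B →
        ρ {ω | (fun i : Fin n => ω (i : ℕ)) ∈ A ∧ empShift n m ω ∈ B}
          = ∫⁻ ω in {ω | (fun i : Fin n => ω (i : ℕ)) ∈ A},
              q (fun i : Fin n => ω (i : ℕ)) B ∂ρ) :
    ∀ᵐ ω ∂ρ, q (fun i : Fin n => ω (i : ℕ)) = (κ (fun i : Fin n => ω (i : ℕ))).bind
      (fun y => (Measure.infinitePi (fun _ : ℕ => G y)).map (empShift n m)) := by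
  have hξ : Measurable (fun (ω : ℕ → S) (i : Fin n) => ω i) :=
    measurable_pi_lambda _ fun i => measurable_pi_apply _
  have hE := empShift_meas (S := S) n m
  have hI := aux_infinitePi_meas G hG
  have hR : Measurable fun y => (Measure.infinitePi (fun _ : ℕ => G y)).map (empShift n m) :=
    (Measure.measurable_map _ hE).comp hI
  haveI hRp : ∀ y, IsProbabilityMeasure
      ((Measure.infinitePi (fun _ : ℕ => G y)).map (empShift n m)) := fun y =>
    Measure.isProbabilityMeasure_map hE.aemeasurable
  haveI : IsProbabilityMeasure (ρ.map (fun (ω : ℕ → S) (i : Fin n) => ω i)) :=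
    Measure.isProbabilityMeasure_map hξ.aemeasurable
  have hκ2 : Measurable fun v => (κ v).bind
      (fun y => (Measure.infinitePi (fun _ : ℕ => G y)).map (empShift n m)) :=
    (Measure.measurable_bind' hR).comp hκ
  refine ae_of_ae_map hξ.aemeasurable (p := fun v => q v = (κ v).bind
      (fun y => (Measure.infinitePi (fun _ : ℕ => G y)).map (empShift n m))) ?_
  refine aux_ker_eq _ q _ hq hκ2 hqp ?_ ?_ ?_
  · intro v
    constructor
    rw [Measure.bind_apply MeasurableSet.univ hR.aemeasurable]
    simp
  · refine Filter.Eventually.of_forall fun v => ?_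
    rw [Measure.bind_apply (aux_meas_prob S).compl hR.aemeasurable]
    refine (lintegral_congr fun y => ?_).trans lintegral_zero
    rw [Measure.map_apply hE (aux_meas_prob S).compl]
    have : empShift n m ⁻¹' {p : Measure S | IsProbabilityMeasure p}ᶜ = ∅ := by
      ext ω; simp [empShift_prob n hm ω]
    rw [this]; simp
  · intro B hB A hA
    have hRB : Measurable fun y => (Measure.infinitePi (fun _ : ℕ => G y)) (empShift n m ⁻¹' B) :=
      (Measure.measurable_coe (hE hB)).comp hI
    have hq1 := (Measure.measurable_coe hB).comp hq
    have hq2 := (Measure.measurable_coe hB).comp hκ2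
    simp only [Function.comp_def] at hq1 hq2
    rw [setLIntegral_map hA hq1 hξ, setLIntegral_map hA hq2 hξ]
    have l1 := hqm A hA B hB
    change _ = ∫⁻ ω in (fun (ω : ℕ → S) (i : Fin n) => ω i) ⁻¹' A, _ ∂ρ at l1
    refine l1.symm.trans ?_
    have hAm := hξ hA
    have l2 : ∀ ω : ℕ → S, ((κ (fun i : Fin n => ω i)).bind
      (fun y => (Measure.infinitePi (fun _ : ℕ => G y)).map (empShift n m))) B =
      ∫⁻ y, (Measure.infinitePi (fun _ : ℕ => G y)) (empShift n m ⁻¹' B)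
        ∂(κ (fun i : Fin n => ω i)) := by
      intro ω
      rw [Measure.bind_apply hB hR.aemeasurable]
      refine lintegral_congr fun y => ?_
      rw [Measure.map_apply hE hB]
    simp only [l2]
    rw [← lintegral_indicator hAm]
    let F1 : (Fin n → S) × Y → ℝ≥0∞ := fun z => A.indicator 1 z.1 *
      (Measure.infinitePi (fun _ : ℕ => G z.2)) (empShift n m ⁻¹' B)
    have hF1 : Measurable F1 :=
      ((measurable_one.indicator hA).comp measurable_fst).mul (hRB.comp measurable_snd)
    have d1 := aux_lintegral_disint ρ _ hξ θt hθm κ hκp hκ (fun A' hA' B' hB' => hpost A' hA' B' hB')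
      F1 hF1
    have r1 : ∀ ω : ℕ → S, ((fun (ω : ℕ → S) (i : Fin n) => ω i) ⁻¹' A).indicator (fun ω =>
        ∫⁻ y, (Measure.infinitePi (fun _ : ℕ => G y)) (empShift n m ⁻¹' B)
          ∂(κ (fun i : Fin n => ω i))) ω = ∫⁻ y, F1 (fun i : Fin n => ω i, y)
          ∂(κ (fun i : Fin n => ω i)) := by
      intro ω
      simp only [F1]
      by_cases h : (fun i : Fin n => ω i) ∈ A
      · rw [Set.indicator_of_mem (show ω ∈ (fun (ω : ℕ → S) (i : Fin n) => ω i) ⁻¹' A from h)]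
        simp [Set.indicator_of_mem h]
      · rw [Set.indicator_of_notMem (show ω ∉ (fun (ω : ℕ → S) (i : Fin n) => ω i) ⁻¹' A from h)]
        simp [Set.indicator_of_notMem h]
    rw [lintegral_congr r1, ← d1]
    let F2 : Y × (ℕ → S) → ℝ≥0∞ := fun z => F1 (fun i : Fin n => z.2 i, z.1)
    have hF2 : Measurable F2 := hF1.comp ((hξ.comp measurable_snd).prodMk measurable_fst)
    have d2 := aux_transfer iid hiid ρ ptilde hptilde_meas hdirect θt G hG T hT hθ F2 hF2
    have d3 := aux_transfer iid hiid ρ ptilde hptilde_meas hdirect θt G hG T hT hθ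
      (fun z => ((fun (ω : ℕ → S) (i : Fin n) => ω i) ⁻¹' A ∩ empShift n m ⁻¹' B).indicator 1 z.2)
      ((measurable_one.indicator (hAm.inter (hE hB))).comp measurable_snd)
    simp only [F2] at d2
    rw [d2]
    simp only [lintegral_indicator_one (hAm.inter (hE hB))] at d3
    refine d3.trans (lintegral_congr fun ω => ?_)
    rw [aux_indep_emp _ n m A hA B hB]
    simp only [F1]
    have hq3 := ((measurable_one (α := ℝ≥0∞)).indicator hA).comp hξ
    simp only [Function.comp_def] at hq3
    rw [lintegral_mul_const _ hq3]
    congr 1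
    have : ∀ ω' : ℕ → S, A.indicator (1 : (Fin n → S) → ℝ≥0∞) (fun i : Fin n => ω' i) =
      ((fun (ω : ℕ → S) (i : Fin n) => ω i) ⁻¹' A).indicator 1 ω' := fun ω' => rfl
    rw [lintegral_congr this, lintegral_indicator_one hAm]

lemma aux_final {W : ℕ → ℝ} {A : ℕ → ℝ≥0∞} {Y : ℝ} (hY : 0 ≤ Y) (hW : ∀ n, 0 ≤ W n)
    {r : ℕ → ℝ} (hr : ∀ n, 0 ≤ r n)
    (h1 : ∀ᶠ n in Filter.atTop, ENNReal.ofReal (W n ^ 2) ≤ A n)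
    (h2 : Filter.limsup (fun n => ENNReal.ofReal (r n) * A n) Filter.atTop ≤ ENNReal.ofReal (Y ^ 2)) :
    Filter.limsup (fun n => ENNReal.ofReal (Real.sqrt (r n) * W n)) Filter.atTop ≤
      ENNReal.ofReal Y := by
  refine ENNReal.le_of_forall_pos_le_add fun ε hε _ => ?_
  have h3 : Filter.limsup (fun n => ENNReal.ofReal (r n) * A n) Filter.atTop <
      ENNReal.ofReal ((Y + ε) ^ 2) := by
    refine h2.trans_lt ((ENNReal.ofReal_lt_ofReal_iff (by positivity)).2 ?_)
    have : (0 : ℝ) < ε := hε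
    nlinarith
  have h4 := Filter.eventually_lt_of_limsup_lt h3
  refine Filter.limsup_le_of_le (by isBoundedDefault) ?_
  filter_upwards [h1, h4] with n a b
  rw [← ENNReal.ofReal_coe_nnreal, ← ENNReal.ofReal_add hY (by positivity)]
  apply ENNReal.ofReal_le_ofReal
  have c : ENNReal.ofReal (r n * W n ^ 2) < ENNReal.ofReal ((Y + ε) ^ 2) := by
    rw [ENNReal.ofReal_mul (hr n)]
    refine lt_of_le_of_lt ?_ b
    gcongr
  have c' := (ENNReal.ofReal_lt_ofReal_iff_of_nonneg (mul_nonneg (hr n) (sq_nonneg _))).1 c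
  refine abs_le_of_sq_le_sq' ?_ (by positivity) |>.2
  rw [mul_pow, Real.sq_sqrt (hr n)]; exact c'.le
end

section
set_option linter.unusedSectionVars false

section
variable {S : Type*} [MetricSpace S] [SecondCountableTopology S] [MeasurableSpace S] [BorelSpace S]

open Classical in
/-- The rescaled transport cost, switched off when the estimate leaves `E`. -/
def Xfn {Y : Type*} (G : Y → Measure S) (E : Set Y) (r : ℝ) (η y : Y) : ℝ≥0∞ :=
  ENNReal.ofReal r * (if η ∈ E then wcost (G y) (G η) else 0)

lemma aux_assembly {Y : Type*} [MeasurableSpace Y]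
    (iid : Measure S → Measure (ℕ → S))
    (hiid : ∀ 𝔭 : Measure S, IsProbabilityMeasure 𝔭 →
      IsProbabilityMeasure (iid 𝔭) ∧
        ∀ (n : ℕ) (A : Fin n → Set S), (∀ i, MeasurableSet (A i)) →
          iid 𝔭 {ω | ∀ i : Fin n, ω (i : ℕ) ∈ A i} = ∏ i, 𝔭 (A i))
    (ρ : Measure (ℕ → S)) [IsProbabilityMeasure ρ]
    (ptilde : (ℕ → S) → Measure S) (hptilde_meas : Measurable ptilde)
    (hdirect : ∀ C : Set (ℕ → S), MeasurableSet C → ∀ B : Set (Measure S), MeasurableSet B →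
      ρ (C ∩ ptilde ⁻¹' B) = ∫⁻ ω in ptilde ⁻¹' B, iid (ptilde ω) C ∂ρ)
    (θt : (ℕ → S) → Y) (hθm : Measurable θt) (G : Y → Measure S) (hG : Measurable G)
    [hGp : ∀ y, IsProbabilityMeasure (G y)] (T : Measure S → Y) (hT : Measurable T)
    (hθ : ∀ᵐ ω ∂ρ, ptilde ω = G (θt ω) ∧ T (ptilde ω) = θt ω)
    (x₀ : S) (hmom : ∀ y, ∫⁻ x, c2 (x, x₀) ∂(G y) ≠ ∞)
    (hw : Measurable fun z : Y × Y => wcost (G z.1) (G z.2))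
    (hsel : ∀ η, ∀ ε : ℝ≥0∞, ε ≠ 0 → ∃ Γ : Y → Measure (S × S), Measurable Γ ∧ ∀ y,
      IsCpl (Γ y) (G y) (G η) ∧ ∫⁻ z, c2 z ∂(Γ y) ≤ wcost (G y) (G η) + ε)
    (E : Set Y) (hE : MeasurableSet E)
    (η : (n : ℕ) → (Fin n → S) → Y) (hη : ∀ n, Measurable (η n))
    (r : ℕ → ℝ) (hr : ∀ n, 0 ≤ r n)
    (hdom : ∫⁻ ω, ∫⁻ ω', ⨆ n, Xfn G E (r n) (η n fun i : Fin n => ω' i) (θt ω)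
      ∂(Measure.infinitePi (fun _ : ℕ => G (θt ω))) ∂ρ ≠ ∞)
    (Yl : (ℕ → S) → ℝ) (hYl : ∀ᵐ ω ∂ρ, 0 ≤ Yl ω)
    (hlim : ∀ᵐ ω ∂ρ, (∀ᶠ n in Filter.atTop, η n (fun i : Fin n => ω i) ∈ E) ∧
      Filter.limsup (fun n => Xfn G E (r n) (η n fun i : Fin n => ω i) (θt ω)) Filter.atTop ≤
        ENNReal.ofReal (Yl ω ^ 2))
    (post : (n : ℕ) → (Fin n → S) → Measure (Measure S))
    (hpost_prob : ∀ n v, IsProbabilityMeasure (post n v))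
    (hpost_meas : ∀ n, Measurable (post n))
    (hpost : ∀ (n : ℕ) (A : Set (Fin n → S)), MeasurableSet A →
      ∀ B : Set (Measure S), MeasurableSet B →
        ρ {ω | (fun i : Fin n => ω (i : ℕ)) ∈ A ∧ ptilde ω ∈ B}
          = ∫⁻ ω in {ω | (fun i : Fin n => ω (i : ℕ)) ∈ A},
              post n (fun i : Fin n => ω (i : ℕ)) B ∂ρ)
    (qm : (m n : ℕ) → (Fin n → S) → Measure (Measure S))
    (hqm_prob : ∀ m n v, IsProbabilityMeasure (qm m n v))
    (hqm_meas : ∀ m n, Measurable (qm m n))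
    (hqm : ∀ (m n : ℕ) (A : Set (Fin n → S)), MeasurableSet A →
      ∀ B : Set (Measure S), MeasurableSet B →
        ρ {ω | (fun i : Fin n => ω (i : ℕ)) ∈ A ∧ empShift n m ω ∈ B}
          = ∫⁻ ω in {ω | (fun i : Fin n => ω (i : ℕ)) ∈ A},
              qm m n (fun i : Fin n => ω (i : ℕ)) B ∂ρ) :
    (∀ᵐ ω ∂ρ, Filter.limsup (fun n : ℕ => ENNReal.ofReal
        (Real.sqrt (r n)
          * wassW (fun μ' ν => wassW (fun u v => dist u v) 2 μ' ν) 2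
            (post n (fun i : Fin n => ω (i : ℕ)))
            (Measure.dirac (G (η n fun i : Fin n => ω i))))) Filter.atTop
      ≤ ENNReal.ofReal (Yl ω)) ∧
    (∀ (m : ℕ), 1 ≤ m →
      ∀ᵐ ω ∂ρ, Filter.limsup (fun n : ℕ => ENNReal.ofReal
          (Real.sqrt (r n)
            * wassW (fun μ' ν => wassW (fun u v => dist u v) 2 μ' ν) 2
              (qm m n (fun i : Fin n => ω (i : ℕ)))
              ((Measure.infinitePi fun _ : ℕ => G (η n fun i : Fin n => ω i)).map
                (empShift n m)))) Filter.atTop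
        ≤ ENNReal.ofReal (Yl ω)) := by
  classical
  haveI : MeasurableSpace.CountablyGenerated S := inferInstance
  let κ : (n : ℕ) → (Fin n → S) → Measure Y := fun n v => (post n v).map T
  have hκp : ∀ n v, IsProbabilityMeasure (κ n v) := fun n v =>
    Measure.isProbabilityMeasure_map hT.aemeasurable
  have hκ : ∀ n, Measurable (κ n) := fun n => (Measure.measurable_map _ hT).comp (hpost_meas n)
  have hpp := fun n => aux_post ρ ptilde θt G hG T hT hθ n (post n) (hpost_meas n) (hpost n)
  have hκpost : ∀ (n : ℕ) (A : Set (Fin n → S)), MeasurableSet A → ∀ B : Set Y, MeasurableSet B →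
        ρ {ω | (fun i : Fin n => ω (i : ℕ)) ∈ A ∧ θt ω ∈ B}
          = ∫⁻ ω in {ω | (fun i : Fin n => ω (i : ℕ)) ∈ A},
              κ n (fun i : Fin n => ω (i : ℕ)) B ∂ρ := fun n => (hpp n).1
  have hpG : ∀ᵐ ω ∂ρ, ∀ n, post n (fun i : Fin n => ω (i : ℕ)) =
      (κ n (fun i : Fin n => ω (i : ℕ))).map G := ae_all_iff.2 fun n => (hpp n).2
  have hXm : ∀ r : ℝ, Measurable fun z : Y × Y => Xfn G E r z.1 z.2 := by
    intro r
    have h1 := hw.comp measurable_swap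
    simp only [Function.comp_def, Prod.fst_swap, Prod.snd_swap] at h1
    unfold Xfn
    exact (Measurable.ite (measurable_fst hE) h1 measurable_const).const_mul _
  have hXn : ∀ n, Measurable fun z : (Fin n → S) × Y => Xfn G E (r n) (η n z.1) z.2 := by
    intro n
    have h1 := (hXm (r n)).comp (((hη n).comp measurable_fst).prodMk
      (measurable_snd (α := Fin n → S) (β := Y)))
    simp only [Function.comp_def] at h1
    exact h1
  have hξ : ∀ n, Measurable (fun (ω : ℕ → S) (i : Fin n) => ω i) :=
    fun n => measurable_pi_lambda _ fun i => measurable_pi_apply _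
  have hF : Measurable fun z : Y × (ℕ → S) =>
      ⨆ n, Xfn G E (r n) (η n fun i : Fin n => z.2 i) z.1 := by
    refine Measurable.iSup fun n => ?_
    have h1 := (hXn n).comp (((hξ n).comp (measurable_snd (α := Y))).prodMk measurable_fst)
    simp only [Function.comp_def] at h1
    exact h1
  have htr := aux_transfer iid hiid ρ ptilde hptilde_meas hdirect θt G hG T hT hθ _ hF
  have hcore := aux_merging_core ρ θt hθm κ hκp hκ hκpost
    (fun n z => Xfn G E (r n) (η n z.1) z.2) hXn (by rw [htr]; exact hdom)
  let A : ℕ → (ℕ → S) → ℝ≥0∞ := fun n ω =>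
    ∫⁻ y, wcost (G y) (G (η n fun i : Fin n => ω i)) ∂(κ n fun i : Fin n => ω i)
  have hAlim : ∀ᵐ ω ∂ρ, Filter.limsup (fun n => ENNReal.ofReal (r n) * A n ω) Filter.atTop ≤
      ENNReal.ofReal (Yl ω ^ 2) := by
    filter_upwards [hcore, hlim] with ω h1 h2
    refine le_trans (le_of_eq ?_) (h1.trans h2.2)
    refine Filter.limsup_congr ?_
    filter_upwards [h2.1] with n hn
    simp only [A, Xfn, if_pos hn]
    rw [lintegral_const_mul' _ _ ENNReal.ofReal_ne_top]
  constructor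
  · filter_upwards [hAlim, hpG, hYl] with ω h1 h2 h3
    refine aux_final h3 (fun n => aux_wassW_nonneg _ _ _) hr (Filter.Eventually.of_forall fun n => ?_) h1
    rw [h2 n]
    haveI := hκp n (fun i : Fin n => ω i)
    refine (outer_i _ G hG _).trans (le_of_eq (lintegral_congr fun y => ?_))
    exact wassW_sq x₀ _ _ (hmom _) (hmom _)
  · intro m hm
    have hq : ∀ᵐ ω ∂ρ, ∀ n, qm m n (fun i : Fin n => ω (i : ℕ)) =
        (κ n (fun i : Fin n => ω (i : ℕ))).bind
        (fun y => (Measure.infinitePi (fun _ : ℕ => G y)).map (empShift n m)) :=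
      ae_all_iff.2 fun n => aux_qm iid hiid ρ ptilde hptilde_meas hdirect θt hθm G hG T hT hθ n m hm
        (κ n) (hκp n) (hκ n) (hκpost n) (qm m n) (hqm_prob m n) (hqm_meas m n) (hqm m n)
    filter_upwards [hAlim, hq, hYl] with ω h1 h2 h3
    refine aux_final h3 (fun n => aux_wassW_nonneg _ _ _) hr (Filter.Eventually.of_forall fun n => ?_) h1
    rw [h2 n]
    haveI := hκp n (fun i : Fin n => ω i)
    refine ENNReal.le_of_forall_pos_le_add fun ε hε _ => ?_
    obtain ⟨Γ, hΓ, hΓ2⟩ := hsel (η n fun i : Fin n => ω i) ε (by exact_mod_cast hε.ne')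
    refine (outer_ii _ G Γ hΓ _ (fun y => (hΓ2 y).1) n hm).trans ?_
    refine (lintegral_mono fun y => (hΓ2 y).2).trans (le_of_eq ?_)
    rw [lintegral_add_right _ measurable_const]
    simp [A]
end
end

lemma aux_mom_change {S : Type*} [MetricSpace S] [SecondCountableTopology S] [MeasurableSpace S]
    [BorelSpace S] (p : Measure S) [IsProbabilityMeasure p] (x₀ x₁ : S)
    (hx : Integrable (fun x => dist x x₁ ^ 2) p) : ∫⁻ x, c2 (x, x₀) ∂p ≠ ∞ := by
  have h1 : ∫⁻ x, c2 (x, x₁) ∂p ≠ ∞ := by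
    refine ne_top_of_le_ne_top hx.2.ne (lintegral_mono fun x => ?_)
    exact Real.ofReal_le_enorm _
  have h2 : ∫⁻ x, c2 (x, x₀) ∂p ≤ ∫⁻ x, (2 * c2 (x, x₁) + 2 * c2 (x₀, x₁)) ∂p :=
    lintegral_mono fun x => c2_le x₁ (x, x₀)
  refine ne_top_of_le_ne_top ?_ h2
  rw [lintegral_add_right _ measurable_const, lintegral_const_mul' _ _ (by simp)]
  simp only [lintegral_const, measure_univ, mul_one]
  exact ENNReal.add_ne_top.2 ⟨ENNReal.mul_ne_top (by simp) h1,
    ENNReal.mul_ne_top (by simp) ENNReal.ofReal_ne_top⟩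

/-- Bayesian merging for exponential families: if the directing
measure is `μ_θ̃` a.s., Talagrand's inequality, condition (eq:CostExp) and the
integrability of `C₂(μ_θ̃)` hold, then posterior and predictive distributions
merge at rate `b_n = (n/Log₂ n)^{1/2}` with limiting bound
`Y₂(p̃) = √(2 C_T(θ̃)) Φ(θ̃) σ_max(θ̃)`, `ρ`-almost surely. -/
theorem bayesian_expFamily_merging
    {S : Type*} [MetricSpace S] [TopologicalSpace.SeparableSpace S]
    [MeasurableSpace S] [BorelSpace S]
    (hRadon : ∀ μ : Measure S, IsProbabilityMeasure μ → μ.InnerRegular)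
    (k : ℕ) (μ : Measure S) [SigmaFinite μ] (t : S → (Fin k → ℝ)) (ht : Measurable t)
    -- the log-Laplace transform `M` and the sets `Λ` and `Θ`
    (Λ : Set (Fin k → ℝ))
    (hΛ : Λ = {y | ∫⁻ x, ENNReal.ofReal (Real.exp (∑ i, y i * t x i)) ∂μ < ⊤})
    (M : (Fin k → ℝ) → ℝ)
    (hM : ∀ y, M y = Real.log (∫⁻ x, ENNReal.ofReal (Real.exp (∑ i, y i * t x i)) ∂μ).toReal)
    (Θ : Set (Fin k → ℝ))
    (hΘ : Θ = interior (convexHull ℝ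
      {y | ∀ U : Set (Fin k → ℝ), IsOpen U → y ∈ U → 0 < μ.map t U}))
    -- assumptions (A) and (B)
    (hA : Θ.Nonempty) (hB : Λ.Nonempty) (hBopen : IsOpen Λ)
    -- `Vinv` is the inverse of the mean-value map `V = ∇M : Λ → Θ`
    (Vinv : (Fin k → ℝ) → (Fin k → ℝ))
    (hVinv : ∀ θ ∈ Θ, Vinv θ ∈ Λ ∧ (fun i => fderiv ℝ M (Vinv θ) (Pi.single i 1)) = θ)
    -- the exponential family in its mean-value parametrization
    (expFam : (Fin k → ℝ) → Measure S)
    (hexpFam : ∀ θ, expFam θ =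
      μ.withDensity fun x => ENNReal.ofReal (Real.exp (∑ i, Vinv θ i * t x i - M (Vinv θ))))
    (hprob : ∀ θ ∈ Θ, IsProbabilityMeasure (expFam θ))
    (hmom2 : ∀ θ ∈ Θ, ∃ x₀ : S, Integrable (fun x => dist x x₀ ^ 2) (expFam θ))
    -- the Legendre transform `I_μ` of `M`, its Hessian, and the Hessian of `M`
    (Iμ : (Fin k → ℝ) → ℝ)
    (hIμ : ∀ θ, Iμ θ = sSup ((fun y => ∑ i, θ i * y i - M y) '' Λ))
    (HessI : (Fin k → ℝ) → Matrix (Fin k) (Fin k) ℝ)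
    (hHessI : ∀ θ ∈ Θ, ∀ i j, HessI θ i j =
      fderiv ℝ (fun η => fderiv ℝ Iμ η (Pi.single j 1)) θ (Pi.single i 1))
    (HessM : (Fin k → ℝ) → Matrix (Fin k) (Fin k) ℝ)
    (hHessM : ∀ θ ∈ Θ, ∀ i j, HessM θ i j =
      fderiv ℝ (fun y => fderiv ℝ M y (Pi.single j 1)) (Vinv θ) (Pi.single i 1))
    -- the cumulant generating function `Ψ` of `t(ξ₁)` under `μ_θ₀`
    -- and its Legendre transform `I_{θ₀}`, as functions of the base point `θ₀`
    (Ψof : (Fin k → ℝ) → (Fin k → ℝ) → ℝ)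
    (hΨof : ∀ θ₀ y, Ψof θ₀ y = Real.log
      (∫⁻ x, ENNReal.ofReal (Real.exp (∑ i, y i * t x i)) ∂(expFam θ₀)).toReal)
    (Iof : (Fin k → ℝ) → (Fin k → ℝ) → ℝ)
    (hIof : ∀ θ₀ θ, Iof θ₀ θ = sSup ((fun y => ∑ i, θ i * y i - Ψof θ₀ y) '' Λ))
    -- the product-measure map `𝔭 ↦ 𝔭^∞`
    (iid : Measure S → Measure (ℕ → S))
    (hiid : ∀ 𝔭 : Measure S, IsProbabilityMeasure 𝔭 →
      IsProbabilityMeasure (iid 𝔭) ∧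
        ∀ (n : ℕ) (A : Fin n → Set S), (∀ i, MeasurableSet (A i)) →
          iid 𝔭 {ω | ∀ i : Fin n, ω (i : ℕ) ∈ A i} = ∏ i, 𝔭 (A i))
    -- an exchangeable law `ρ` with directing measure `p̃ = μ_θ̃`
    (ρ : Measure (ℕ → S)) [IsProbabilityMeasure ρ]
    (hexch : ∀ σ : Equiv.Perm ℕ, ρ.map (fun ω => ω ∘ σ) = ρ)
    (ptilde : (ℕ → S) → Measure S) (hptilde_meas : Measurable ptilde)
    (hptilde_prob : ∀ᵐ ω ∂ρ, IsProbabilityMeasure (ptilde ω))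
    (hdirect : ∀ C : Set (ℕ → S), MeasurableSet C → ∀ B : Set (Measure S), MeasurableSet B →
      ρ (C ∩ ptilde ⁻¹' B) = ∫⁻ ω in ptilde ⁻¹' B, iid (ptilde ω) C ∂ρ)
    (θt : (ℕ → S) → (Fin k → ℝ)) (hθt_meas : Measurable θt)
    (hθt : ∀ᵐ ω ∂ρ, θt ω ∈ Θ ∧ ptilde ω = expFam (θt ω))
    -- the Talagrand inequality, a.s., with `θ̃` in place of `θ₀` and `θ̂_n` in place of `θ`
    (CT : (Fin k → ℝ) → ℝ) (hCT : ∀ᵐ ω ∂ρ, 0 ≤ CT (θt ω))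
    (hTal : ∀ᵐ ω ∂ρ, ∀ (n : ℕ) (v : Fin n → S),
      wassW (fun u v' => dist u v') 2 (expFam (θt ω))
          (expFam (fun j => (∑ i, t (v i) j) / (n : ℝ))) ^ 2
        ≤ CT (θt ω) * klDiv'
            (expFam (fun j => (∑ i, t (v i) j) / (n : ℝ))) (expFam (θt ω)))
    -- the condition (eq:CostExp), a.s., with `θ̃` in place of `θ₀`
    (hCost : ∀ᵐ ω ∂ρ, CostExpCond Θ HessI (Iof (θt ω)) (θt ω))
    -- `C₂(μ_θ̃)` is the constant of the exponential-family moment theorem,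
    -- it is a real random variable and `ρ[C₂(μ_θ̃)] < ∞`
    (C₂ : (Fin k → ℝ) → ℝ)
    (hC₂_meas : Measurable fun ω => C₂ (θt ω))
    (hC₂_int : Integrable (fun ω => C₂ (θt ω)) ρ)
    (hC₂ : ∀ᵐ ω ∂ρ, ∫⁻ ω', ⨆ n : ℕ, ENNReal.ofReal
        ((Real.sqrt (((n : ℝ) + 1) / Log2 ((n : ℝ) + 1))
          * wassW (fun u v => dist u v) 2 (expFam (θt ω))
              (expFam (fun j =>
                (∑ i ∈ Finset.range (n + 1), t (ω' i) j) / ((n : ℝ) + 1)))) ^ 2)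
        ∂(iid (expFam (θt ω)))
      ≤ ENNReal.ofReal (C₂ (θt ω)))
    -- the posterior distributions `π(ξ^{(n)})`
    (post : (n : ℕ) → (Fin n → S) → Measure (Measure S))
    (hpost_prob : ∀ n v, IsProbabilityMeasure (post n v))
    (hpost_meas : ∀ n, Measurable (post n))
    (hpost : ∀ (n : ℕ) (A : Set (Fin n → S)), MeasurableSet A →
      ∀ B : Set (Measure S), MeasurableSet B →
        ρ {ω | (fun i : Fin n => ω (i : ℕ)) ∈ A ∧ ptilde ω ∈ B}
          = ∫⁻ ω in {ω | (fun i : Fin n => ω (i : ℕ)) ∈ A},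
              post n (fun i : Fin n => ω (i : ℕ)) B ∂ρ)
    -- the conditional distributions `q_m(ξ^{(n)})` of `ẽ_{n,m}` given `ξ^{(n)}`
    (qm : (m n : ℕ) → (Fin n → S) → Measure (Measure S))
    (hqm_prob : ∀ m n v, IsProbabilityMeasure (qm m n v))
    (hqm_meas : ∀ m n, Measurable (qm m n))
    (hqm : ∀ (m n : ℕ) (A : Set (Fin n → S)), MeasurableSet A →
      ∀ B : Set (Measure S), MeasurableSet B →
        ρ {ω | (fun i : Fin n => ω (i : ℕ)) ∈ A ∧ empShift n m ω ∈ B}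
          = ∫⁻ ω in {ω | (fun i : Fin n => ω (i : ℕ)) ∈ A},
              qm m n (fun i : Fin n => ω (i : ℕ)) B ∂ρ) :
    -- (i) merging of posterior distributions
    (∀ᵐ ω ∂ρ, Filter.limsup (fun n : ℕ => ENNReal.ofReal
        (Real.sqrt ((n : ℝ) / Log2 n)
          * wassW (fun μ' ν => wassW (fun u v => dist u v) 2 μ' ν) 2
            (post n (fun i : Fin n => ω (i : ℕ)))
            (Measure.dirac (expFam (fun j =>
              (∑ i : Fin n, t (ω (i : ℕ)) j) / (n : ℝ)))))) Filter.atTop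
      ≤ ENNReal.ofReal (Real.sqrt (2 * CT (θt ω)) * PhiFn HessI (θt ω) (θt ω)
          * Real.sqrt (maxEig (HessM (θt ω))))) ∧
    -- (ii) merging of predictive distributions
    (∀ (m : ℕ), 1 ≤ m →
      ∀ᵐ ω ∂ρ, Filter.limsup (fun n : ℕ => ENNReal.ofReal
          (Real.sqrt ((n : ℝ) / Log2 n)
            * wassW (fun μ' ν => wassW (fun u v => dist u v) 2 μ' ν) 2
              (qm m n (fun i : Fin n => ω (i : ℕ)))
              ((iid (expFam (fun j =>
                (∑ i : Fin n, t (ω (i : ℕ)) j) / (n : ℝ)))).map (empShift n m))))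
          Filter.atTop
        ≤ ENNReal.ofReal (Real.sqrt (2 * CT (θt ω)) * PhiFn HessI (θt ω) (θt ω)
            * Real.sqrt (maxEig (HessM (θt ω))))) := by
  haveI : SecondCountableTopology S := UniformSpace.secondCountable_of_separable S
  have h : EF μ t Λ Θ M Vinv := aux_EF k μ t ht Λ hΛ M hM Θ hΘ hA hBopen Vinv hVinv
  obtain ⟨θ₀, h0⟩ := hA
  have hP : ∀ θ, expFam θ = efP μ t M (Vinv θ) := fun θ => hexpFam θ
  set G := EF.efG μ t Θ M Vinv θ₀ with hGdef
  have hGm : Measurable G := h.G_meas θ₀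
  haveI hGp : ∀ y, IsProbabilityMeasure (G y) := h.G_prob h0
  have hGe : ∀ θ ∈ Θ, expFam θ = G θ := by
    intro θ hθ
    rw [hP, hGdef]; unfold EF.efG; rw [rr_eq hθ]
  obtain ⟨x₀, -⟩ := hmom2 θ₀ h0
  have hmom : ∀ θ ∈ Θ, ∫⁻ x, c2 (x, x₀) ∂(efP μ t M (Vinv θ)) ≠ ∞ := by
    intro θ hθ
    obtain ⟨x₁, hx⟩ := hmom2 θ hθ
    rw [hP] at hx
    haveI := h.P_prob (h.hVinv θ hθ).1
    exact aux_mom_change _ x₀ x₁ hx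
  have hmomG : ∀ y, ∫⁻ x, c2 (x, x₀) ∂(G y) ≠ ∞ := fun y => hmom _ (rr_mem h0 y)
  have hθ : ∀ᵐ ω ∂ρ, ptilde ω = G (θt ω) ∧ efT t (ptilde ω) = θt ω := by
    filter_upwards [hθt] with ω hω
    refine ⟨by rw [hω.2, hGe _ hω.1], ?_⟩
    rw [hω.2, hP, h.T_P hω.1]
  have htr := fun F hF => aux_transfer iid hiid ρ ptilde hptilde_meas hdirect θt G hGm
    (efT t) (efT_meas t ht) hθ F hF
  have hlil := h.lil h0 ρ θt hθt_meas (hθt.mono fun ω hω => hω.1) htr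
  have hL0 : ∀ n : ℕ, 0 ≤ (n : ℝ) / Log2 n := fun n =>
    div_nonneg (Nat.cast_nonneg _) (zero_le_one.trans (aux_Log2_pos _))
  have hW : ∀ θ ∈ Θ, ∀ η ∈ Θ, wcost (G θ) (G η) =
      ENNReal.ofReal (wassW (fun u v : S => dist u v) 2 (expFam θ) (expFam η) ^ 2) := by
    intro θ hθ η hη
    rw [hGe θ hθ, hGe η hη, wassW_sq x₀ _ _ (hmomG _) (hmomG _)]
  have hHM : ∀ θ ∈ Θ, HessM θ = efH μ t (Vinv θ) := by
    intro θ hθ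
    ext i j
    rw [hHessM θ hθ, h.HessM_eq (h.hVinv θ hθ).1]
  let ηf : (n : ℕ) → (Fin n → S) → (Fin k → ℝ) := fun n v j => (∑ i, t (v i) j) / (n : ℝ)
  have hηf : ∀ n, Measurable (ηf n) := by
    intro n
    refine measurable_pi_lambda _ fun j => ?_
    refine Measurable.div_const ?_ _
    refine Finset.measurable_fun_sum _ fun i _ => ?_
    exact (measurable_pi_apply j).comp (ht.comp (measurable_pi_apply i))
  have hX : ∀ θ ∈ Θ, ∀ (r : ℝ), 0 ≤ r → ∀ η, Xfn G Θ r η θ ≤ ENNReal.ofReal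
      (r * wassW (fun u v : S => dist u v) 2 (expFam θ) (expFam η) ^ 2) := by
    intro θ hθ r hr η
    unfold Xfn
    split_ifs with hη
    · rw [hW θ hθ η hη, ← ENNReal.ofReal_mul hr]
    · simp
  have hlim : ∀ᵐ ω ∂ρ, (∀ᶠ n in Filter.atTop, ηf n (fun i : Fin n => ω i) ∈ Θ) ∧
      Filter.limsup (fun n : ℕ => Xfn G Θ ((n : ℝ) / Log2 n) (ηf n fun i : Fin n => ω i) (θt ω))
        Filter.atTop ≤ ENNReal.ofReal ((Real.sqrt (2 * CT (θt ω)) * PhiFn HessI (θt ω) (θt ω)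
          * Real.sqrt (maxEig (HessM (θt ω)))) ^ 2) := by
    filter_upwards [hθt, hCT, hTal, hlil] with ω h1 h2 h3 h4
    have hT := h.tal_limsup hIμ h1.1 HessI (hHessI _ h1.1) (CT (θt ω))
      (maxEig (efH μ t (Vinv (θt ω)))) h2
      (aux_maxEig_nonneg _ fun v => h.Q_nonneg (h.hVinv _ h1.1).1 v)
      (fun n => ηf n fun i : Fin n => ω i)
      (fun n => wassW (fun u v : S => dist u v) 2 (expFam (θt ω))
        (expFam (ηf n fun i : Fin n => ω i)))
      (fun n => by
        have h5 := h3 n (fun i : Fin n => ω i)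
        rw [← hP, ← hP]
        exact h5) h4
    refine ⟨hT.1, ?_⟩
    rw [hHM _ h1.1]
    refine ENNReal.le_of_forall_pos_le_add fun ε hε _ => ?_
    refine Filter.limsup_le_of_le (by isBoundedDefault) ?_
    filter_upwards [hT.2 ε hε] with n hn
    refine (hX _ h1.1 _ (hL0 n) _).trans ?_
    rw [← ENNReal.ofReal_coe_nnreal, ← ENNReal.ofReal_add (sq_nonneg _) ε.coe_nonneg]
    exact ENNReal.ofReal_le_ofReal hn
  have hdom : ∫⁻ ω, ∫⁻ ω', ⨆ n : ℕ, Xfn G Θ ((n : ℝ) / Log2 n) (ηf n fun i : Fin n => ω' i) (θt ω)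
      ∂(Measure.infinitePi (fun _ : ℕ => G (θt ω))) ∂ρ ≠ ∞ := by
    have hfin : ∫⁻ ω, ENNReal.ofReal (C₂ (θt ω)) ∂ρ ≠ ∞ := by
      refine ne_top_of_le_ne_top hC₂_int.2.ne (lintegral_mono fun ω => ?_)
      exact Real.ofReal_le_enorm _
    refine ne_top_of_le_ne_top hfin (lintegral_mono_ae ?_)
    filter_upwards [hθt, hC₂] with ω h1 h2
    refine le_trans ?_ h2
    haveI := hprob _ h1.1
    rw [aux_iid_eq (iid (expFam (θt ω))) (expFam (θt ω)) (hiid _ inferInstance).2]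
    simp only [hGe _ h1.1]
    refine lintegral_mono fun ω' => iSup_le fun n => ?_
    rcases n with _ | n
    · simp [Xfn]
    · refine le_trans ?_ (le_iSup _ n)
      refine (hX _ h1.1 _ (hL0 (n + 1)) _).trans (le_of_eq ?_)
      rw [mul_pow, Real.sq_sqrt (by have := hL0 (n + 1); push_cast at this; exact this), hGe _ h1.1]
      simp only [ηf]
      push_cast
      simp only [Finset.sum_range]
  have key := aux_assembly iid hiid ρ ptilde hptilde_meas hdirect θt hθt_meas G hGm
    (efT t) (efT_meas t ht) hθ x₀ hmomG (h.wcost_meas x₀ hmom h0)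
    (fun η ε hε => h.select x₀ hmom h0 η hε) Θ h.oΘ.measurableSet ηf hηf
    (fun n => (n : ℝ) / Log2 n) hL0 hdom
    (fun ω => Real.sqrt (2 * CT (θt ω)) * PhiFn HessI (θt ω) (θt ω)
          * Real.sqrt (maxEig (HessM (θt ω))))
    (Filter.Eventually.of_forall fun ω => mul_nonneg (mul_nonneg (Real.sqrt_nonneg _)
      (Real.sqrt_nonneg _)) (Real.sqrt_nonneg _)) hlim post hpost_prob hpost_meas hpost
    qm hqm_prob hqm_meas hqm
  constructor
  · filter_upwards [key.1, hlim] with ω h1 h2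
    refine le_trans (le_of_eq ?_) h1
    refine Filter.limsup_congr ?_
    filter_upwards [h2.1] with n hn
    rw [← hGe _ hn]
  · intro m hm
    filter_upwards [key.2 m hm, hlim] with ω h1 h2
    refine le_trans (le_of_eq ?_) h1
    refine Filter.limsup_congr ?_
    filter_upwards [h2.1] with n hn
    have e1 := hGe _ hn
    have e2 : iid (expFam (fun j => (∑ i : Fin n, t (ω (i : ℕ)) j) / (n : ℝ))) =
        Measure.infinitePi (fun _ : ℕ => G (ηf n fun i : Fin n => ω i)) := by
      change iid (expFam (ηf n fun i : Fin n => ω i)) = _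
      rw [e1]
      exact aux_iid_eq _ _ (hiid _ (hGp _)).2
    rw [e2]

end
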